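/- arXiv:2109.04308 — 2 statements merged into one kernel-verified Lean document; each statement's English description precedes it below -/
import Mathlib

section
/- Let N and p be primes with p ≥ 5 and N ≡ −1 (mod p). Then there exists a normalized cuspidal Hecke eigenform f = Σ_{n≥1} a_n q^n of weight 2 and level Γ0(N^2) whose Fourier coefficients a_n are algebraic integers generating a number field K_f with ring of integers O_f, together with a prime ideal 𝔭 of O_f lying over p, such that a_ℓ ≡ 1 + ℓ (mod 𝔭) for every prime number ℓ (including ℓ = N). -/
section EigenvectorExistence

/-- A minimal prime of a subring of a finite commutative algebra of operators is the kernel of a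
system of simultaneous eigenvalues. -/
theorem exists_eigenvector_of_mem_minimalPrimes {A B V : Type*} [CommRing A] [CommRing B]
    [Algebra ℂ B] [FiniteDimensional ℂ B] [AddCommGroup V] [Module ℂ V] [Module B V]
    [IsScalarTower ℂ B V] [FiniteDimensional ℂ V] [FaithfulSMul B V]
    (φ : A →+* B) (hφ : Function.Injective φ) (q : Ideal A) (hq : q ∈ minimalPrimes A) :
    ∃ (χ : A →+* ℂ) (y : V), RingHom.ker χ = q ∧ y ≠ 0 ∧ ∀ a, φ a • y = χ a • y := by
  obtain ⟨n, hn, rfl⟩ := Ideal.exists_comap_eq_of_mem_minimalPrimes_of_injective hφ q hq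
  have : IsArtinianRing B := isArtinian_of_tower ℂ inferInstance
  have : Module.Finite B V := Module.Finite.of_restrictScalars_finite ℂ B V
  have hmin : n ∈ minimalPrimes B := by
    rw [Ring.KrullDimLE.minimalPrimes_eq_setOfPred_isPrime]; exact hn
  have hann : Module.annihilator B V = ⊥ := Module.annihilator_eq_bot.2 inferInstance
  have hass : n ∈ associatedPrimes B V := by
    apply Module.associatedPrimes.minimalPrimes_annihilator_subset_associatedPrimes B V
    rw [hann]; exact hmin
  obtain ⟨_, y, hy⟩ := isAssociatedPrime_iff.1 hass
  have hbij : Function.Bijective (algebraMap ℂ (B ⧸ n)) :=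
    IsAlgClosed.algebraMap_bijective_of_isIntegral
  let e : ℂ ≃+* B ⧸ n := RingEquiv.ofBijective _ hbij
  refine ⟨(e.symm.toRingHom.comp (Ideal.Quotient.mk n)).comp φ, y, ?_, ?_, ?_⟩
  · ext a
    simp [RingHom.mem_ker, Ideal.Quotient.eq_zero_iff_mem]
  · rintro rfl
    apply hn.ne_top
    rw [hy]; ext; simp
  · intro a
    set c : ℂ := e.symm (Ideal.Quotient.mk n (φ a)) with hc
    have h1 : Ideal.Quotient.mk n (φ a) = Ideal.Quotient.mk n (algebraMap ℂ B c) := by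
      have : e c = Ideal.Quotient.mk n (φ a) := by simp [hc]
      rw [← this]; rfl
    have h2 : φ a - algebraMap ℂ B c ∈ n := by
      rwa [← Ideal.Quotient.eq]
    rw [hy] at h2
    have h3 : (φ a - algebraMap ℂ B c) • y = 0 := by simpa using h2
    rw [sub_smul, sub_eq_zero, algebraMap_smul] at h3
    simpa [hc] using h3

end EigenvectorExistence

section DeligneSerre

open scoped IsMulCommutative

/-- The Deligne-Serre lifting lemma: an eigenvector modulo `p` in a lattice stable under commuting
operators lifts to a system of eigenvalues in characteristic zero. -/
theorem exists_eigenvector_of_eigenvector_mod {V : Type} {ι : Type} [AddCommGroup V] [Module ℂ V]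
    (T : ι → Module.End ℂ V) (hcomm : ∀ i j, T i * T j = T j * T i)
    (L : Submodule ℤ V) (hfg : L.FG) (hspan : Submodule.span ℂ (L : Set V) = ⊤)
    (hL : ∀ i, ∀ x ∈ L, T i x ∈ L) (p : ℕ) (hp : p.Prime) (f₀ : V) (hf₀ : f₀ ∈ L)
    (hf₀p : ∀ g ∈ L, f₀ ≠ (p : ℤ) • g) (c : ι → ℤ)
    (hc : ∀ i, ∃ g ∈ L, T i f₀ - c i • f₀ = (p : ℤ) • g) :
    ∃ (A : Type) (_ : CommRing A) (_ : Module.Finite ℤ A) (t : ι → A)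
      (χ : A →+* ℂ) (I : Ideal A), I.IsPrime ∧ RingHom.ker χ ≤ I ∧ (p : A) ∈ I ∧
        (∀ i, t i - (c i : A) ∈ I) ∧ (∀ S : Subring A, (∀ i, t i ∈ S) → ∀ x, x ∈ S) ∧
        ∃ y : V, y ≠ 0 ∧ ∀ i, T i y = χ (t i) • y := by
  have hcomm' : ∀ x ∈ Set.range T, ∀ y ∈ Set.range T, x * y = y * x := by
    rintro _ ⟨i, rfl⟩ _ ⟨j, rfl⟩; exact hcomm i j
  obtain ⟨s, hs⟩ := hfg
  have hspan' : Submodule.span ℂ (s : Set V) = ⊤ := by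
    rw [eq_top_iff, ← hspan, Submodule.span_le, ← hs]
    intro x hx
    exact Submodule.span_subset_span ℤ ℂ _ hx
  have : FiniteDimensional ℂ V := .of_fg_top (hspan' ▸ ⟨s, rfl⟩)
  have := Algebra.isMulCommutative_adjoin ℤ hcomm'
  have := Algebra.isMulCommutative_adjoin ℂ hcomm'
  set A := Algebra.adjoin ℤ (Set.range T) with hA
  set B := Algebra.adjoin ℂ (Set.range T) with hB
  have hAB : A ≤ B.restrictScalars ℤ := by
    rw [hA, Algebra.adjoin_le_iff]
    exact Algebra.subset_adjoin
  let φ : A →ₐ[ℤ] B.restrictScalars ℤ := Subalgebra.inclusion hAB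
  let φ' : A →+* B := φ.toRingHom
  have hAL : ∀ a ∈ A, ∀ x ∈ L, a x ∈ L := by
    intro a ha
    induction ha using Algebra.adjoin_induction with
    | mem a ha => obtain ⟨i, rfl⟩ := ha; exact hL i
    | algebraMap r => intro x hx; simpa [Module.algebraMap_end_apply] using L.smul_mem r hx
    | add a b _ _ ha hb => intro x hx; exact L.add_mem (ha x hx) (hb x hx)
    | mul a b _ _ ha hb => intro x hx; exact ha _ (hb x hx)
  have hLfin : Module.Finite ℤ L := Module.Finite.iff_fg.2 ⟨s, hs⟩
  have hsL : ∀ x ∈ s, x ∈ L := fun x hx ↦ hs ▸ Submodule.subset_span hx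
  let ψ : A →ₗ[ℤ] (s → L) :=
    { toFun := fun a x ↦ ⟨a.1 x, hAL a a.2 x (hsL x x.2)⟩
      map_add' := fun a b ↦ by ext; simp
      map_smul' := fun n a ↦ by ext; simp }
  have hψ : Function.Injective ψ := by
    intro a b hab
    apply Subtype.ext
    apply LinearMap.ext_on hspan'
    intro x hx
    have := congrArg Subtype.val (congrFun hab ⟨x, hx⟩)
    simpa [ψ] using this
  have hfin : Module.Finite ℤ A := Module.Finite.of_injective ψ hψ
  let P : Submodule ℤ V := L.map ((p : ℤ) • LinearMap.id)
  have hP : ∀ x, x ∈ P ↔ ∃ g ∈ L, x = (p : ℤ) • g := by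
    intro x; simp [P, Submodule.mem_map, eq_comm]
  have hAP : ∀ a ∈ A, ∀ x ∈ P, a x ∈ P := by
    intro a ha x hx
    obtain ⟨g, hg, rfl⟩ := (hP x).1 hx
    exact (hP _).2 ⟨a g, hAL a ha g hg, map_zsmul _ _ _⟩
  have hf₀P : f₀ ∉ P := fun h ↦ by
    obtain ⟨g, hg, h⟩ := (hP _).1 h
    exact hf₀p g hg h
  have hpP : ∀ x ∈ L, (p : ℤ) • x ∈ P := fun x hx ↦ (hP _).2 ⟨x, hx, rfl⟩
  have hint : ∀ n : ℤ, n • f₀ ∈ P → (p : ℤ) ∣ n := by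
    intro n hn
    by_contra h
    obtain ⟨u, v, huv⟩ := (Nat.prime_iff_prime_int.1 hp).coprime_iff_not_dvd.2 h
    apply hf₀P
    have : f₀ = u • ((p : ℤ) • f₀) + v • (n • f₀) := by
      rw [smul_smul, smul_smul, ← add_smul, huv, one_smul]
    rw [this]
    exact P.add_mem (P.smul_mem _ (hpP _ hf₀)) (P.smul_mem _ hn)
  have hA_int : ∀ a ∈ A, ∃ n : ℤ, a f₀ - n • f₀ ∈ P := by
    intro a ha
    induction ha using Algebra.adjoin_induction with
    | mem a ha =>
      obtain ⟨i, rfl⟩ := ha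
      obtain ⟨g, hg, h⟩ := hc i
      exact ⟨c i, (hP _).2 ⟨g, hg, h⟩⟩
    | algebraMap r => exact ⟨r, by simp⟩
    | add a b _ _ ha hb =>
      obtain ⟨m, hm⟩ := ha
      obtain ⟨n, hn⟩ := hb
      refine ⟨m + n, ?_⟩
      convert P.add_mem hm hn using 1
      simp only [LinearMap.add_apply, add_smul]; abel
    | mul a b ha' hb' ha hb =>
      obtain ⟨m, hm⟩ := ha
      obtain ⟨n, hn⟩ := hb
      refine ⟨n * m, ?_⟩
      convert P.add_mem (hAP a ha' _ hn) (P.smul_mem n hm) using 1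
      simp only [Module.End.mul_apply, map_sub, map_zsmul, smul_sub, mul_smul]; abel
  let I : Ideal A :=
    { carrier := {a | a.1 f₀ ∈ P}
      add_mem' := fun {a b} ha hb ↦ P.add_mem ha hb
      zero_mem' := by simp
      smul_mem' := fun a b hb ↦ hAP a a.2 _ hb }
  have hI : ∀ a : A, a ∈ I ↔ a.1 f₀ ∈ P := fun a ↦ Iff.rfl
  have hIprime : I.IsPrime := by
    refine Ideal.isPrime_iff.2 ⟨?_, ?_⟩
    · rw [Ideal.ne_top_iff_one, hI]; exact hf₀P
    · intro a b hab
      obtain ⟨m, hm⟩ := hA_int a a.2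
      obtain ⟨n, hn⟩ := hA_int b b.2
      have key : (n * m) • f₀ ∈ P := by
        have h1 := P.add_mem (hAP a a.2 _ hn) (P.smul_mem n hm)
        have h2 := P.sub_mem ((hI _).1 hab) h1
        convert h2 using 1
        simp only [MulMemClass.coe_mul, Module.End.mul_apply, map_sub, map_zsmul, smul_sub,
          mul_smul]
        abel
      have aux : ∀ (a : A) (m : ℤ), a.1 f₀ - m • f₀ ∈ P → (p : ℤ) ∣ m → a ∈ I := by
        rintro a _ hm ⟨k, rfl⟩
        rw [hI]
        have h1 : ((p : ℤ) * k) • f₀ ∈ P := by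
          rw [mul_smul]; exact hpP _ (L.smul_mem _ hf₀)
        simpa using P.add_mem hm h1
      rcases (Nat.prime_iff_prime_int.1 hp).dvd_or_dvd (hint _ key) with h | h
      · exact .inr (aux b n hn h)
      · exact .inl (aux a m hm h)
  obtain ⟨q, hq, hqI⟩ := Ideal.exists_minimalPrimes_le (I := (⊥ : Ideal A)) (J := I) bot_le
  have : FiniteDimensional ℂ B := inferInstance
  obtain ⟨χ, y, hχ, hy0, hy⟩ := exists_eigenvector_of_mem_minimalPrimes (V := V) φ'
    (Subalgebra.inclusion_injective hAB) q hq
  refine ⟨A, inferInstance, hfin, fun i ↦ ⟨T i, Algebra.subset_adjoin ⟨i, rfl⟩⟩, χ, I, hIprime,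
    hχ ▸ hqI, ?_, ?_, ?_, y, hy0, fun i ↦ ?_⟩
  · rw [hI]
    simpa using hpP _ hf₀
  · intro i
    rw [hI]
    obtain ⟨g, hg, h⟩ := hc i
    refine (hP _).2 ⟨g, hg, ?_⟩
    rw [← h]
    simp
  · rintro S hS ⟨x, hx⟩
    induction hx using Algebra.adjoin_induction with
    | mem a ha => obtain ⟨i, rfl⟩ := ha; exact hS i
    | algebraMap r => exact intCast_mem S r
    | add a b _ _ ha hb => exact S.add_mem ha hb
    | mul a b _ _ ha hb => exact S.mul_mem ha hb
  · exact hy ⟨T i, Algebra.subset_adjoin ⟨i, rfl⟩⟩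

end DeligneSerre

section EigenSequence

/-- A sequence satisfying the Hecke recursions for the eigenvalues `lam ℓ`, with `ε ℓ` the weight
of the second term of the `ℓ`-th Hecke operator. -/
def IsHeckeSeq (ε : ℕ → ℂ) (lam : ℕ → ℂ) (a : ℕ → ℂ) : Prop :=
  ∀ ℓ, ℓ.Prime → ∀ m, a (ℓ * m) + (if ℓ ∣ m then ε ℓ * a (m / ℓ) else 0) = lam ℓ * a m

variable {ε lam a : ℕ → ℂ}

lemma IsHeckeSeq.apply_one_ne_zero (h : IsHeckeSeq ε lam a) (h0 : a 0 = 0) (hne : a ≠ 0) :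
    a 1 ≠ 0 := by
  intro h1
  apply hne
  funext n
  induction n using Nat.strong_induction_on with
  | _ n ih =>
    rcases Nat.lt_or_ge 1 n with hn | hn
    · obtain ⟨ℓ, hℓ, m, rfl⟩ := Nat.exists_prime_and_dvd hn.ne'
      have hm : 0 < m := Nat.pos_of_ne_zero (by rintro rfl; simp at hn)
      have hlt : m < ℓ * m := lt_mul_of_one_lt_left hm hℓ.one_lt
      have h2 := h ℓ hℓ m
      have h3 := ih (m / ℓ) ((Nat.div_le_self _ _).trans_lt hlt)
      rw [ih m hlt, h3] at h2
      simpa using h2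
    · interval_cases n <;> simp [h0, h1]

lemma IsHeckeSeq.div (h : IsHeckeSeq ε lam a) (c : ℂ) : IsHeckeSeq ε lam (fun n ↦ a n / c) := by
  intro ℓ hℓ m
  have := h ℓ hℓ m
  dsimp only
  rw [← mul_div_assoc (lam ℓ), ← this]
  split_ifs <;> ring

lemma IsHeckeSeq.apply_prime (h : IsHeckeSeq ε lam a) (h1 : a 1 = 1) {ℓ : ℕ} (hℓ : ℓ.Prime) :
    a ℓ = lam ℓ := by
  have := h ℓ hℓ 1
  simpa [h1, hℓ.one_lt.ne', hℓ.ne_one] using this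

lemma IsHeckeSeq.apply_mul (h : IsHeckeSeq ε lam a) (h0 : a 0 = 0) (h1 : a 1 = 1) (m n : ℕ)
    (hmn : Nat.Coprime m n) : a (m * n) = a m * a n := by
  induction m using Nat.strong_induction_on generalizing n with
  | _ m ih =>
    rcases Nat.lt_or_ge 1 m with hm | hm
    · obtain ⟨ℓ, hℓ, k, rfl⟩ := Nat.exists_prime_and_dvd hm.ne'
      have hk : 0 < k := Nat.pos_of_ne_zero (by rintro rfl; simp at hm)
      have hlt : k < ℓ * k := lt_mul_of_one_lt_left hk hℓ.one_lt
      have hkn : Nat.Coprime k n := Nat.Coprime.coprime_mul_left hmn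
      have hℓn : Nat.Coprime ℓ n := Nat.Coprime.coprime_mul_right hmn
      have e1 := h ℓ hℓ k
      have e2 := h ℓ hℓ (k * n)
      have hiff : ℓ ∣ k * n ↔ ℓ ∣ k := ⟨hℓn.dvd_of_dvd_mul_right, fun h ↦ h.mul_right n⟩
      rw [ih k hlt n hkn] at e2
      by_cases hd : ℓ ∣ k
      · obtain ⟨j, rfl⟩ := hd
        have e3 := ih j ((Nat.le_mul_of_pos_left j hℓ.pos).trans_lt hlt) n
          (Nat.Coprime.coprime_mul_left hkn)
        rw [if_pos (by simp), Nat.mul_div_cancel_left _ hℓ.pos] at e1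
        rw [if_pos (by simp [mul_assoc]), mul_assoc ℓ j n, Nat.mul_div_cancel_left _ hℓ.pos,
          e3] at e2
        rw [mul_assoc ℓ, mul_assoc ℓ j n]
        linear_combination e2 - a n * e1
      · rw [if_neg hd] at e1
        rw [if_neg (hiff.not.2 hd)] at e2
        rw [mul_assoc ℓ]
        linear_combination e2 - a n * e1
    · interval_cases m
      · simp [(Nat.coprime_zero_left n).1 hmn, h0]
      · simp [h1]

lemma IsHeckeSeq.apply_pow (h : IsHeckeSeq ε lam a) (h1 : a 1 = 1) {ℓ : ℕ} (hℓ : ℓ.Prime) (k : ℕ)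
    (hk : 1 ≤ k) : a (ℓ ^ (k + 1)) = a ℓ * a (ℓ ^ k) - ε ℓ * a (ℓ ^ (k - 1)) := by
  obtain ⟨j, rfl⟩ := Nat.exists_eq_add_of_le' hk
  have e := h ℓ hℓ (ℓ ^ (j + 1))
  rw [if_pos (dvd_pow_self _ (by simp)), pow_succ, Nat.mul_div_cancel _ hℓ.pos] at e
  rw [h.apply_prime h1 hℓ, pow_succ ℓ (j + 1), pow_succ ℓ j, mul_comm _ ℓ, ← e]
  simp

lemma IsHeckeSeq.mem_subring (h : IsHeckeSeq ε lam a) (h0 : a 0 = 0) (h1 : a 1 = 1) (S : Subring ℂ)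
    (hlam : ∀ ℓ, ℓ.Prime → lam ℓ ∈ S) (hε : ∀ ℓ, ℓ.Prime → ε ℓ ∈ S) (n : ℕ) : a n ∈ S := by
  induction n using Nat.strong_induction_on with
  | _ n ih =>
    rcases Nat.lt_or_ge 1 n with hn | hn
    · obtain ⟨ℓ, hℓ, m, rfl⟩ := Nat.exists_prime_and_dvd hn.ne'
      have hm : 0 < m := Nat.pos_of_ne_zero (by rintro rfl; simp at hn)
      have hlt : m < ℓ * m := lt_mul_of_one_lt_left hm hℓ.one_lt
      rw [eq_sub_of_add_eq (h ℓ hℓ m)]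
      refine S.sub_mem (S.mul_mem (hlam ℓ hℓ) (ih m hlt)) ?_
      split_ifs
      · exact S.mul_mem (hε ℓ hℓ) (ih _ ((Nat.div_le_self _ _).trans_lt hlt))
      · exact S.zero_mem
    · interval_cases n
      · rw [h0]; exact S.zero_mem
      · rw [h1]; exact S.one_mem

end EigenSequence

section CoefficientField

open NumberField

/-- A prime of a finite `ℤ`-algebra containing the kernel of a complex-valued character gives a
prime of the ring of integers of the field generated by the values. -/
theorem exists_prime_ringOfIntegers_of_character {A ι : Type*} [CommRing A] [Module.Finite ℤ A]
    (t : ι → A) (ht : ∀ S : Subring A, (∀ i, t i ∈ S) → ∀ x, x ∈ S) (χ : A →+* ℂ)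
    (I : Ideal A) [I.IsPrime] (hI : RingHom.ker χ ≤ I) (s : Set ℂ) (hs : ∀ i, χ (t i) ∈ s)
    (hsχ : s ⊆ χ.range) :
    FiniteDimensional ℚ (IntermediateField.adjoin ℚ s) ∧
      ∃ (φ : A →+* 𝓞 (IntermediateField.adjoin ℚ s))
        (P : Ideal (𝓞 (IntermediateField.adjoin ℚ s))), P.IsPrime ∧ P.comap φ = I ∧
        ∀ x, algebraMap (𝓞 (IntermediateField.adjoin ℚ s)) ℂ (φ x) = χ x := by
  set K := IntermediateField.adjoin ℚ s with hK
  have hint : ∀ x : A, IsIntegral ℤ (χ x) := fun x ↦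
    (Algebra.IsIntegral.isIntegral (R := ℤ) x).map χ.toIntAlgHom
  have hmem : ∀ x : A, χ x ∈ K := by
    refine ht (K.toSubfield.toSubring.comap χ) fun i ↦ ?_
    exact IntermediateField.subset_adjoin ℚ s (hs i)
  constructor
  · obtain ⟨g, hg⟩ := (inferInstance : Module.Finite ℤ A).fg_top
    let G : Set ℂ := χ '' g
    have hGfin : Finite G := (g.finite_toSet.image χ)
    have h1 : FiniteDimensional ℚ (IntermediateField.adjoin ℚ G) := by
      apply IntermediateField.finiteDimensional_adjoin
      rintro _ ⟨x, -, rfl⟩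
      exact (hint x).tower_top
    have hG : ∀ x, χ x ∈ IntermediateField.adjoin ℚ G := fun x ↦ by
      have hx : x ∈ Submodule.span ℤ (g : Set A) := hg ▸ Submodule.mem_top
      induction hx using Submodule.span_induction with
      | mem x hx => exact IntermediateField.subset_adjoin ℚ G ⟨x, hx, rfl⟩
      | zero => rw [map_zero]; exact zero_mem _
      | add x y _ _ hx hy => rw [map_add]; exact add_mem hx hy
      | smul n x _ hx => rw [map_zsmul]; exact zsmul_mem hx n
    have h2 : K ≤ IntermediateField.adjoin ℚ G := by
      rw [hK, IntermediateField.adjoin_le_iff]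
      intro z hz
      obtain ⟨x, rfl⟩ := hsχ hz
      exact hG x
    exact Submodule.finiteDimensional_of_le (S₁ := K.toSubalgebra.toSubmodule)
      (S₂ := (IntermediateField.adjoin ℚ G).toSubalgebra.toSubmodule) h2
  · let χK : A →+* K := χ.codRestrict K.toSubfield hmem
    have hintK : ∀ x, IsIntegral ℤ (χK x) := fun x ↦
      (Algebra.IsIntegral.isIntegral (R := ℤ) x).map χK.toIntAlgHom
    let φ : A →+* 𝓞 K := χK.codRestrict (integralClosure ℤ K) hintK
    have hφ : ∀ x, algebraMap (𝓞 K) ℂ (φ x) = χ x := fun x ↦ rfl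
    let := φ.toAlgebra
    have hφint : Algebra.IsIntegral A (𝓞 K) := ⟨fun x ↦ by
      have : IsIntegral ℤ x := RingOfIntegers.isIntegral x
      exact this.tower_top⟩
    obtain ⟨P, -, hP, hPI⟩ := Ideal.exists_ideal_over_prime_of_isIntegral (S := 𝓞 K) I ⊥ (by
      intro x hx
      apply hI
      have hx : φ x = 0 := hx
      rw [RingHom.mem_ker, ← hφ, hx, map_zero])
    exact ⟨φ, P, hP, hPI, hφ⟩

end CoefficientField

noncomputable section QSeries

open UpperHalfPlane Filter Topology
open scoped Manifold

/-- The nome `q = e^{2 π i z}`. -/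
def nome (z : ℂ) : ℂ := Complex.exp (2 * Real.pi * Complex.I * z)

lemma nome_ne_zero (z : ℂ) : nome z ≠ 0 := Complex.exp_ne_zero _

lemma nome_add (z w : ℂ) : nome (z + w) = nome z * nome w := by
  simp [nome, mul_add, Complex.exp_add]

lemma nome_natCast_mul (n : ℕ) (z : ℂ) : nome (n * z) = nome z ^ n := by
  rw [nome, nome, ← Complex.exp_nat_mul]; ring_nf

lemma nome_intCast (n : ℤ) : nome n = 1 := by
  rw [nome, mul_comm, Complex.exp_int_mul_two_pi_mul_I]

lemma nome_add_intCast (z : ℂ) (n : ℤ) : nome (z + n) = nome z := by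
  rw [nome_add, nome_intCast, mul_one]

lemma norm_nome (z : ℂ) : ‖nome z‖ = Real.exp (-2 * Real.pi * z.im) := by
  rw [nome, Complex.norm_exp]; congr 1
  simp [Complex.mul_re, Complex.mul_im]

lemma norm_nome_lt_one {z : ℂ} (hz : 0 < z.im) : ‖nome z‖ < 1 := by
  rw [norm_nome, Real.exp_lt_one_iff]
  have := mul_pos Real.pi_pos hz
  nlinarith

lemma exists_nome_eq {q : ℂ} (hq : ‖q‖ < 1) (hq0 : q ≠ 0) : ∃ z : ℍ, nome z = q := by
  have h0 : (2 * Real.pi * Complex.I : ℂ) ≠ 0 := by simp [Real.pi_ne_zero]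
  set w : ℂ := Complex.log q / (2 * Real.pi * Complex.I) with hw
  have hn : nome w = q := by
    rw [nome, hw, mul_div_cancel₀ _ h0, Complex.exp_log hq0]
  have him : 0 < w.im := by
    have := norm_nome w
    rw [hn] at this
    by_contra! h
    rw [this, Real.exp_lt_one_iff] at hq
    have := Real.pi_pos
    nlinarith
  exact ⟨⟨w, him⟩, hn⟩

lemma tendsto_nome : Tendsto (fun z : ℍ ↦ nome z) atImInfty (𝓝 0) := by
  rw [tendsto_zero_iff_norm_tendsto_zero]
  simp_rw [norm_nome]
  refine Real.tendsto_exp_atBot.comp ?_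
  have : Tendsto (fun z : ℍ ↦ (z : ℂ).im) atImInfty atTop := tendsto_comap
  exact this.const_mul_atTop_of_neg (by simp [Real.pi_pos])

/-- `F` is given on the whole upper half plane by the convergent `q`-series `∑ aₙ qⁿ`. -/
def HasQSeries (a : ℕ → ℂ) (F : ℍ → ℂ) : Prop :=
  ∀ z : ℍ, HasSum (fun n ↦ a n * nome z ^ n) (F z)

namespace HasQSeries

variable {a b : ℕ → ℂ} {F G : ℍ → ℂ}

lemma summable (h : HasQSeries a F) {q : ℂ} (hq : ‖q‖ < 1) : Summable fun n ↦ a n * q ^ n := by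
  rcases eq_or_ne q 0 with rfl | hq0
  · exact summable_of_ne_finset_zero (s := {0}) fun n hn ↦ by simp_all
  · obtain ⟨z, rfl⟩ := exists_nome_eq hq hq0
    exact (h z).summable

lemma hasFPowerSeriesOnBall (h : HasQSeries a F) :
    HasFPowerSeriesOnBall (fun q ↦ ∑' n, a n * q ^ n) (.ofScalars ℂ a) 0 1 := by
  constructor
  · refine le_of_forall_lt_imp_le_of_dense fun r hr ↦ ?_
    lift r to NNReal using hr.ne_top
    apply FormalMultilinearSeries.le_radius_of_summable
    have := (h.summable (q := (r : ℂ)) (by simpa using hr)).norm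
    simpa using this
  · simp
  · intro y hy
    rw [← ENNReal.coe_one, Metric.eball_coe, NNReal.coe_one, mem_ball_zero_iff] at hy
    simpa [mul_comm] using (h.summable hy).hasSum

lemma eq_tsum (h : HasQSeries a F) (z : ℍ) : F z = ∑' n, a n * nome z ^ n := (h z).tsum_eq.symm

lemma unique (h : HasQSeries a F) (h' : HasQSeries b F) : a = b := by
  have h1 := h.hasFPowerSeriesOnBall.hasFPowerSeriesAt
  have h2 := h'.hasFPowerSeriesOnBall.hasFPowerSeriesAt
  have heq : (fun q ↦ ∑' n, a n * q ^ n) =ᶠ[𝓝 0] fun q ↦ ∑' n, b n * q ^ n := by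
    refine (h1.continuousAt.eventuallyEq_nhds_iff_eventuallyEq_nhdsNE h2.continuousAt).1 ?_
    filter_upwards [self_mem_nhdsWithin,
      mem_nhdsWithin_of_mem_nhds (Metric.ball_mem_nhds (0 : ℂ) one_pos)] with q hq0 hq
    obtain ⟨z, rfl⟩ := exists_nome_eq (by simpa using hq) hq0
    rw [← h.eq_tsum, ← h'.eq_tsum]
  have h3 := (h1.congr heq).eq_formalMultilinearSeries h2
  funext n
  simpa using congrArg (FormalMultilinearSeries.coeff · n) h3

lemma mdifferentiable (h : HasQSeries a F) : MDiff F := by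
  rw [UpperHalfPlane.mdifferentiable_iff]
  have h1 : DifferentiableOn ℂ (fun z ↦ ∑' n, a n * nome z ^ n) {z | 0 < z.im} := by
    have h2 := h.hasFPowerSeriesOnBall.differentiableOn
    refine (h2.comp (f := nome) (s := {z | 0 < z.im}) ?_ ?_)
    · unfold nome; fun_prop
    · intro z hz
      rw [← ENNReal.coe_one, Metric.eball_coe, NNReal.coe_one, mem_ball_zero_iff]
      exact norm_nome_lt_one hz
  refine h1.congr fun z hz ↦ ?_
  simp [h.eq_tsum, UpperHalfPlane.ofComplex_apply_of_im_pos hz]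

lemma tendsto (h : HasQSeries a F) : Tendsto F atImInfty (𝓝 (a 0)) := by
  have h1 := h.hasFPowerSeriesOnBall.hasFPowerSeriesAt.continuousAt.tendsto.comp tendsto_nome
  have h0 : ∑' n, a n * (0 : ℂ) ^ n = a 0 := by
    rw [tsum_eq_single 0 (fun n hn ↦ by simp [hn])]; simp
  rw [h0] at h1
  exact h1.congr fun z ↦ (h.eq_tsum z).symm

lemma add (h : HasQSeries a F) (h' : HasQSeries b G) : HasQSeries (a + b) (F + G) := fun z ↦ by
  simpa [add_mul] using (h z).add (h' z)

lemma const_mul (h : HasQSeries a F) (c : ℂ) : HasQSeries (c • a) (c • F) := fun z ↦ by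
  simpa [mul_assoc] using (h z).mul_left c

lemma zero : HasQSeries 0 0 := fun z ↦ by simp

lemma sum {ι : Type*} (s : Finset ι) {a : ι → ℕ → ℂ} {F : ι → ℍ → ℂ}
    (h : ∀ i ∈ s, HasQSeries (a i) (F i)) : HasQSeries (∑ i ∈ s, a i) (∑ i ∈ s, F i) := by
  classical
  induction s using Finset.induction_on with
  | empty => simpa using zero
  | insert i s hi ih =>
    rw [Finset.sum_insert hi, Finset.sum_insert hi]
    exact (h i (by simp)).add (ih fun j hj ↦ h j (by simp [hj]))

lemma mul (h : HasQSeries a F) (h' : HasQSeries b G) :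
    HasQSeries (fun n ↦ ∑ x ∈ Finset.HasAntidiagonal.antidiagonal n, a x.1 * b x.2) (F * G) :=
    fun z ↦ by
  have h1 := (h z).summable.norm
  have h2 := (h' z).summable.norm
  have h3 := tsum_mul_tsum_eq_tsum_sum_antidiagonal_of_summable_norm h1 h2
  have h4 := (summable_norm_sum_mul_antidiagonal_of_summable_norm h1 h2).of_norm
  rw [(h z).tsum_eq, (h' z).tsum_eq] at h3
  rw [Pi.mul_apply, h3]
  refine h4.hasSum.congr_fun fun n ↦ ?_
  dsimp only
  rw [Finset.sum_mul]
  refine Finset.sum_congr rfl fun x hx ↦ ?_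
  rw [← Finset.HasAntidiagonal.mem_antidiagonal.1 hx]
  ring

/-- Replacing `z` by `mz`. -/
lemma dilate (h : HasQSeries a F) {m : ℕ} (hm : 0 < m) {G : ℍ → ℂ}
    (hG : ∀ z w : ℍ, (w : ℂ) = m * z → G z = F w) :
    HasQSeries (fun n ↦ if m ∣ n then a (n / m) else 0) G := fun z ↦ by
  have him : 0 < ((m : ℂ) * z).im := by
    simpa using mul_pos (by exact_mod_cast hm : (0 : ℝ) < m) z.im_pos
  have h1 := h ⟨m * z, him⟩
  rw [← hG z ⟨m * z, him⟩ rfl] at h1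
  have hinj : Function.Injective fun n : ℕ ↦ m * n := fun x y hxy ↦ by
    simpa [hm.ne'] using hxy
  refine (hinj.hasSum_iff ?_).1 ?_
  · intro n hn
    dsimp only
    rw [if_neg, zero_mul]
    rintro ⟨k, rfl⟩
    exact hn ⟨k, rfl⟩
  · convert h1 using 2 with n
    simp [hm, nome_natCast_mul, pow_mul]

/-- Averaging over the translates `(z + j) / m` picks out the coefficients of index divisible by
`m`. -/
lemma average (h : HasQSeries a F) {m : ℕ} (hm : 0 < m) {G : ℍ → ℂ}
    (hG : ∀ z : ℍ, ∀ w : Fin m → ℍ, (∀ j, (w j : ℂ) = (z + (j : ℕ)) / m) →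
      G z = (m : ℂ)⁻¹ * ∑ j, F (w j)) :
    HasQSeries (fun n ↦ a (m * n)) G := fun z ↦ by
  have hm' : (m : ℂ) ≠ 0 := by exact_mod_cast hm.ne'
  have him : ∀ j : Fin m, 0 < (((z : ℂ) + (j : ℕ)) / m).im := fun j ↦ by
    rw [Complex.div_natCast_im]
    have : 0 < (z : ℂ).im := z.im_pos
    simp only [Complex.add_im, Complex.natCast_im, add_zero]
    positivity
  have h1 := (hasSum_sum (s := Finset.univ) fun j _ ↦ h ⟨_, him j⟩).mul_left (m : ℂ)⁻¹
  rw [← hG z (fun j ↦ ⟨_, him j⟩) fun j ↦ rfl] at h1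
  have hζ : IsPrimitiveRoot (nome ((m : ℂ)⁻¹)) m := by
    have := Complex.isPrimitiveRoot_exp m hm.ne'
    simpa [nome, div_eq_mul_inv] using this
  have key : ∀ n : ℕ, (m : ℂ)⁻¹ * ∑ j : Fin m, a n * nome (((z : ℂ) + (j : ℕ)) / m) ^ n =
      if m ∣ n then a n * nome z ^ (n / m) else 0 := by
    intro n
    have e1 : ∀ j : Fin m, nome (((z : ℂ) + (j : ℕ)) / m) ^ n =
        nome (z / m) ^ n * (nome ((m : ℂ)⁻¹) ^ n) ^ (j : ℕ) := by
      intro j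
      rw [add_div, nome_add, mul_pow, div_eq_mul_inv ((j : ℕ) : ℂ), nome_natCast_mul, ← pow_mul,
        ← pow_mul, mul_comm n]
    simp_rw [e1, ← Finset.mul_sum]
    rw [Fin.sum_univ_eq_sum_range (fun j ↦ (nome ((m : ℂ)⁻¹) ^ n) ^ j)]
    split_ifs with hd
    · obtain ⟨k, rfl⟩ := hd
      have e2 : nome ((m : ℂ)⁻¹) ^ (m * k) = 1 := by rw [pow_mul, hζ.pow_eq_one, one_pow]
      have e3 : nome ((z : ℂ) / m) ^ (m * k) = nome z ^ k := by
        rw [pow_mul, ← nome_natCast_mul, mul_div_cancel₀ _ hm']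
      rw [e2, e3, Nat.mul_div_cancel_left _ hm]
      simp
      field_simp
    · have e2 : nome ((m : ℂ)⁻¹) ^ n ≠ 1 := fun h ↦ hd ((hζ.pow_eq_one_iff_dvd n).1 h)
      rw [geom_sum_eq e2, ← pow_mul, mul_comm n, pow_mul, hζ.pow_eq_one]
      simp
  have hinj : Function.Injective fun n : ℕ ↦ m * n := fun x y hxy ↦ by
    simpa [hm.ne'] using hxy
  have h2 := (hinj.hasSum_iff (f := fun n : ℕ ↦ if m ∣ n then a n * nome z ^ (n / m) else 0)
    (a := G z) (fun n hn ↦ by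
      rw [if_neg]
      rintro ⟨k, rfl⟩
      exact hn ⟨k, rfl⟩)).2 (by simpa [key] using h1)
  convert h2 using 2 with n
  simp [hm]

end HasQSeries

end QSeries

noncomputable section WeightOne

open UpperHalfPlane Filter Topology EisensteinSeries ModularForm
open scoped Matrix MatrixGroups

/-- The lattice vector `x₀ z + x₁`. -/
def latticeVec (x : Fin 2 → ℤ) (z : ℂ) : ℂ := x 0 * z + x 1

/-- The summand of the Weierstrass zeta function, as a function of `u` and the period `ω`. -/
def zetaTerm (u ω : ℂ) : ℂ := 1 / (u + ω) - 1 / ω + u / ω ^ 2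

/-- The weight one Eisenstein series attached to the `N`-division point `v / N`. -/
def weightOne (N : ℕ) (v : Fin 2 → ℤ) (z : ℍ) : ℂ :=
  (2 * Real.pi * Complex.I)⁻¹ * (∑' x : Fin 2 → ℤ, zetaTerm (latticeVec v z / N) (latticeVec x z)
    - latticeVec v z / N * G2 z) + v 0 / N

lemma latticeVec_ne_zero {x : Fin 2 → ℤ} (hx : x ≠ 0) (z : ℍ) : latticeVec x z ≠ 0 := by
  intro h
  apply hx
  have h1 := congrArg Complex.im h
  have h2 := congrArg Complex.re h
  have : (x 0 : ℝ) = 0 := by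
    simpa [latticeVec, z.im_ne_zero] using h1
  have h0 : x 0 = 0 := by exact_mod_cast this
  simp only [latticeVec, h0] at h2
  have h3 : x 1 = 0 := by
    have : (x 1 : ℝ) = 0 := by simpa using h2
    exact_mod_cast this
  ext i; fin_cases i <;> simp [h0, h3]

lemma summable_norm_latticeVec_inv_pow_three (z : ℍ) :
    Summable fun x : Fin 2 → ℤ ↦ ‖(latticeVec x z)⁻¹‖ ^ 3 := by
  have := summable_norm_eisSummand (k := 3) le_rfl z
  refine this.congr fun x ↦ ?_
  simp [eisSummand, latticeVec, zpow_ofNat]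

lemma summable_zetaTerm (u : ℂ) (z : ℍ) :
    Summable fun x : Fin 2 → ℤ ↦ zetaTerm u (latticeVec x z) := by
  have hs := summable_norm_latticeVec_inv_pow_three z
  refine Summable.of_norm_bounded_eventually (g := fun x ↦ 2 * ‖u‖ ^ 2 * ‖(latticeVec x z)⁻¹‖ ^ 3)
    (hs.mul_left _) ?_
  have h1 := hs.tendsto_cofinite_zero.eventually_lt_const
    (u := ((2 * ‖u‖ + 1)⁻¹) ^ 3) (by positivity)
  have h0 : ∀ᶠ x : Fin 2 → ℤ in cofinite, x ≠ 0 := (Set.finite_singleton 0).compl_mem_cofinite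
  filter_upwards [h1, h0] with x hx hx0
  have hω := latticeVec_ne_zero hx0 z
  set ω := latticeVec x z
  have hωpos : 0 < ‖ω‖ := norm_pos_iff.2 hω
  have h2 : ‖ω‖⁻¹ < (2 * ‖u‖ + 1)⁻¹ := by
    rw [← norm_inv]
    exact lt_of_pow_lt_pow_left₀ 3 (by positivity) hx
  have h3 : 2 * ‖u‖ + 1 < ‖ω‖ := (inv_lt_inv₀ hωpos (by positivity)).1 h2
  have h4 : ‖ω‖ / 2 ≤ ‖u + ω‖ := by
    have := norm_sub_norm_le ω (-u)
    rw [norm_neg, sub_neg_eq_add, add_comm ω u] at this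
    linarith
  have h5 : u + ω ≠ 0 := norm_pos_iff.1 (lt_of_lt_of_le (by positivity) h4)
  have h6 : zetaTerm u ω = u ^ 2 / (ω ^ 2 * (u + ω)) := by
    unfold zetaTerm; field_simp; ring
  rw [h6, norm_div, norm_mul, norm_pow, norm_pow, norm_inv, div_le_iff₀ (by positivity)]
  calc ‖u‖ ^ 2 = 2 * ‖u‖ ^ 2 * ‖ω‖⁻¹ ^ 3 * (‖ω‖ ^ 2 * (‖ω‖ / 2)) := by field_simp
    _ ≤ _ := by gcongr

lemma vecMul_coe_vecMul_inv_coe (γ : SL(2, ℤ)) (x : Fin 2 → ℤ) :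
    (x ᵥ* (γ : Matrix (Fin 2) (Fin 2) ℤ)) ᵥ* ((γ⁻¹ : SL(2, ℤ)) : Matrix (Fin 2) (Fin 2) ℤ) = x := by
  rw [Matrix.vecMul_vecMul, ← Matrix.SpecialLinearGroup.coe_mul, mul_inv_cancel]; simp

/-- Right multiplication by `γ` permutes integral row vectors. -/
def vecMulEquiv (γ : SL(2, ℤ)) : (Fin 2 → ℤ) ≃ (Fin 2 → ℤ) where
  toFun x := x ᵥ* (γ : Matrix (Fin 2) (Fin 2) ℤ)
  invFun x := x ᵥ* ((γ⁻¹ : SL(2, ℤ)) : Matrix (Fin 2) (Fin 2) ℤ)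
  left_inv x := vecMul_coe_vecMul_inv_coe γ x
  right_inv x := by simpa using vecMul_coe_vecMul_inv_coe γ⁻¹ x

lemma latticeVec_smul (γ : SL(2, ℤ)) (x : Fin 2 → ℤ) (z : ℍ) :
    latticeVec x (γ • z : ℍ) =
      latticeVec (x ᵥ* (γ : Matrix (Fin 2) (Fin 2) ℤ)) z / denom γ z := by
  have hd := denom_ne_zero γ z
  rw [UpperHalfPlane.specialLinearGroup_apply]
  rw [ModularGroup.denom_apply] at hd ⊢
  rw [eq_div_iff hd]
  simp only [latticeVec, Matrix.vecMul, dotProduct, Fin.sum_univ_two]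
  push_cast
  simp only [algebraMap_int_eq, Int.coe_castRingHom, Complex.ofReal_intCast]
  generalize hD : (γ 1 0 : ℂ) * (z : ℂ) + (γ 1 1 : ℂ) = D at hd ⊢
  rw [add_mul, mul_assoc, div_mul_cancel₀ _ hd, ← hD]
  ring

lemma zetaTerm_div (u ω : ℂ) {j : ℂ} (hj : j ≠ 0) :
    zetaTerm (u / j) (ω / j) = j * zetaTerm u ω := by
  unfold zetaTerm
  rw [← add_div]
  simp only [one_div_div, div_pow, div_div_div_eq]
  field_simp

lemma G2_smul (γ : SL(2, ℤ)) (z : ℍ) :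
    G2 (γ • z) = denom γ z ^ 2 * G2 z - 2 * Real.pi * Complex.I * γ 1 0 * denom γ z := by
  have h := congrFun (G2_slash_action γ) z
  have hd := denom_ne_zero γ z
  rw [SL_slash_apply, Pi.sub_apply, D2] at h
  rw [zpow_neg] at h
  have h2 : (denom γ z) ^ (2 : ℤ) = denom γ z ^ 2 := by norm_cast
  rw [h2] at h
  field_simp at h
  linear_combination h

lemma weightOne_smul (N : ℕ) (v : Fin 2 → ℤ) (γ : SL(2, ℤ)) (z : ℍ) :
    weightOne N v (γ • z) = denom γ z * weightOne N (v ᵥ* (γ : Matrix (Fin 2) (Fin 2) ℤ)) z := by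
  have hd := denom_ne_zero γ z
  have h0 : (2 * Real.pi * Complex.I : ℂ) ≠ 0 := by simp [Real.pi_ne_zero]
  unfold weightOne
  have e1 : ∑' x : Fin 2 → ℤ, zetaTerm (latticeVec v (γ • z : ℍ) / N) (latticeVec x (γ • z : ℍ)) =
      denom γ z * ∑' x : Fin 2 → ℤ,
        zetaTerm (latticeVec (v ᵥ* (γ : Matrix (Fin 2) (Fin 2) ℤ)) z / N) (latticeVec x z) := by
    rw [← (vecMulEquiv γ).tsum_eq (fun x ↦
        zetaTerm (latticeVec (v ᵥ* (γ : Matrix (Fin 2) (Fin 2) ℤ)) z / N) (latticeVec x z)),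
      ← tsum_mul_left]
    refine tsum_congr fun x ↦ ?_
    rw [latticeVec_smul, latticeVec_smul, div_right_comm, zetaTerm_div _ _ hd]
    rfl
  rw [e1, G2_smul, latticeVec_smul]
  have hdet : (γ 0 0 * γ 1 1 - γ 0 1 * γ 1 0 : ℂ) = 1 := by
    have := γ.det_coe
    rw [Matrix.det_fin_two] at this
    exact_mod_cast this
  have e2 : (γ 1 0 : ℂ) * latticeVec (v ᵥ* (γ : Matrix (Fin 2) (Fin 2) ℤ)) z + v 0 =
      denom γ z * (v ᵥ* (γ : Matrix (Fin 2) (Fin 2) ℤ)) 0 := by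
    rw [ModularGroup.denom_apply]
    simp only [latticeVec, Matrix.vecMul, dotProduct, Fin.sum_univ_two]
    push_cast
    linear_combination (-(v 0 : ℂ)) * hdet
  have e3 : (2 * Real.pi * Complex.I : ℂ)⁻¹ * (2 * Real.pi * Complex.I) = 1 := inv_mul_cancel₀ h0
  set D := denom γ z
  generalize (2 * Real.pi * Complex.I : ℂ) = c at e3 h0 ⊢
  generalize latticeVec (v ᵥ* (γ : Matrix (Fin 2) (Fin 2) ℤ)) z = L at e2 ⊢
  have e4 : L / D / N * (D ^ 2 * G2 z - c * γ 1 0 * D) =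
      D * (L / N * G2 z) - c * (γ 1 0 * L / N) := by
    field_simp
  rw [e4]
  linear_combination (γ 1 0 * L / N : ℂ) * e3 + (N : ℂ)⁻¹ * e2

end WeightOne

noncomputable section SymmetricSums

open UpperHalfPlane Filter Topology EisensteinSeries ModularForm Complex SummationFilter
open scoped Matrix MatrixGroups

lemma sum_Icc_neg_succ {M : Type*} [AddCommMonoid M] (f : ℤ → M) (n : ℕ) :
    ∑ m ∈ Finset.Icc (-((n + 1 : ℕ) : ℤ)) ((n + 1 : ℕ) : ℤ), f m =
      ∑ m ∈ Finset.Icc (-(n : ℤ)) n, f m + (f (n + 1) + f (-(n + 1))) := by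
  have h : Finset.Icc (-((n + 1 : ℕ) : ℤ)) ((n + 1 : ℕ) : ℤ) =
      insert (n + 1 : ℤ) (insert (-(n + 1) : ℤ) (Finset.Icc (-(n : ℤ)) n)) := by
    ext; simp only [Finset.mem_Icc, Finset.mem_insert]; omega
  rw [h, Finset.sum_insert (by simp; omega), Finset.sum_insert (by simp)]
  abel_nf

lemma hasSum_inv_add_intCast {x : ℂ} (hx : x ∈ integerComplement ∨ x = 0) :
    HasSum (fun n : ℤ ↦ 1 / (x + n)) (Real.pi * cot (Real.pi * x)) (symmetricIcc ℤ) := by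
  rw [hasSum_symmetricIcc_iff]
  have h : ∀ n : ℕ, ∑ m ∈ Finset.Icc (-(n : ℤ)) n, 1 / (x + m) =
      1 / x + ∑ j ∈ Finset.range n, cotTerm x j := by
    intro n
    induction n with
    | zero => simp
    | succ n ih =>
      rw [sum_Icc_neg_succ, ih, Finset.sum_range_succ, cotTerm]
      push_cast
      rw [← sub_eq_add_neg x]
      ring
  simp_rw [h]
  rcases hx with hx | rfl
  · simpa using (tendsto_logDeriv_euler_cot_sub hx).const_add (1 / x)
  · have : ∀ j : ℕ, cotTerm 0 j = 0 := fun j ↦ by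
      rw [cotTerm, zero_sub, zero_add, one_div_neg_eq_neg_one_div, neg_add_cancel]
    simp [this, cot]

lemma tsum_zetaTerm_row (u : ℂ) (z : ℍ) (m : ℤ) (hu : u + m * z ∈ integerComplement) :
    ∑' n : ℤ, zetaTerm u (latticeVec ![m, n] z) =
      Real.pi * cot (Real.pi * (u + m * z)) - Real.pi * cot (Real.pi * (m * z)) +
        u * e2Summand m z := by
  have h1 := hasSum_inv_add_intCast (.inl hu)
  have h2 : HasSum (fun n : ℤ ↦ 1 / ((m * z : ℂ) + n)) (Real.pi * cot (Real.pi * (m * z)))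
      (symmetricIcc ℤ) := by
    refine hasSum_inv_add_intCast ?_
    rcases eq_or_ne m 0 with rfl | hm
    · right; simp
    · left
      rw [mem_integerComplement_iff]
      rintro ⟨k, hk⟩
      have := congrArg Complex.im hk
      simp [hm, z.im_ne_zero] at this
  have h3 : HasSum (fun n : ℤ ↦ u * eisSummand 2 ![m, n] z) (u * e2Summand m z)
      (symmetricIcc ℤ) :=
    ((e2Summand_summable m z).hasSum.mul_left u).mono_left (SummationFilter.le_atTop)
  have hs : Summable fun n : ℤ ↦ zetaTerm u (latticeVec ![m, n] z) := by
    refine (summable_zetaTerm u z).comp_injective (i := fun n : ℤ ↦ ![m, n]) fun a b h ↦ ?_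
    simpa using congrFun h 1
  have h4 : HasSum (fun n : ℤ ↦ zetaTerm u (latticeVec ![m, n] z))
      (∑' n : ℤ, zetaTerm u (latticeVec ![m, n] z)) (symmetricIcc ℤ) :=
    hs.hasSum.mono_left (SummationFilter.le_atTop)
  refine h4.unique (((h1.sub h2).add h3).congr_fun fun n ↦ ?_)
  simp [zetaTerm, latticeVec, eisSummand, zpow_ofNat, add_assoc, div_eq_mul_inv]

lemma hasSum_zero_of_odd {f : ℤ → ℂ} (hf : ∀ m, f (-m) = -f m) :
    HasSum f 0 (symmetricIcc ℤ) := by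
  rw [hasSum_symmetricIcc_iff]
  have h : ∀ n : ℕ, ∑ m ∈ Finset.Icc (-(n : ℤ)) n, f m = 0 := by
    intro n
    induction n with
    | zero => simpa [CharZero.eq_neg_self_iff] using hf 0
    | succ n ih => rw [sum_Icc_neg_succ, ih, hf]; simp
  simp [h]

/-- The Eisenstein series `weightOne` as a conditionally convergent series of cotangents. -/
lemma hasSum_weightOne {N : ℕ} (hN : 0 < N) {v : Fin 2 → ℤ} (hv : ¬ ((N : ℤ) ∣ v 0 ∧ (N : ℤ) ∣ v 1))
    (z : ℍ) :
    HasSum (fun m : ℤ ↦ (2 * Real.pi * Complex.I)⁻¹ *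
        (Real.pi * cot (Real.pi * (latticeVec v z / N + m * z))))
      (weightOne N v z - v 0 / N) (symmetricIcc ℤ) := by
  have hN' : (N : ℂ) ≠ 0 := by exact_mod_cast hN.ne'
  set u : ℂ := latticeVec v z / N with hu
  have hu' : ∀ m : ℤ, u + m * z ∈ integerComplement := by
    intro m
    rw [mem_integerComplement_iff]
    rintro ⟨k, hk⟩
    have h0 : latticeVec ![v 0 + m * N, v 1 - k * N] z = 0 := by
      have : latticeVec v z = N * u := by rw [hu]; field_simp
      simp only [latticeVec] at this ⊢
      simp
      linear_combination this - (N : ℂ) * hk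
    have h1 : ![v 0 + m * N, v 1 - k * N] = 0 := by
      by_contra h
      exact latticeVec_ne_zero h z h0
    have h2 := congrFun h1 0
    have h3 := congrFun h1 1
    simp at h2 h3
    exact hv ⟨⟨-m, by linarith⟩, ⟨k, by linarith⟩⟩
  have h1 : HasSum (fun m : ℤ ↦ ∑' n : ℤ, zetaTerm u (latticeVec ![m, n] z))
      (∑' x : Fin 2 → ℤ, zetaTerm u (latticeVec x z)) := by
    have := (summable_zetaTerm u z).hasSum
    rw [← (finTwoArrowEquiv ℤ).symm.hasSum_iff] at this
    exact this.prod_fiberwise fun m ↦ (this.summable.prod_factor m).hasSum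
  have h2 : HasSum _ _ (symmetricIcc ℤ) := h1.mono_left (SummationFilter.le_atTop)
  have hG : HasSum (e2Summand · z) (G2 z) (symmetricIcc ℤ) :=
    (hasSum_e2Summand_symmetricIcc z).summable.hasSum
  have h3 := (h2.sub (hG.mul_left u)).add
    (hasSum_zero_of_odd (f := fun m ↦ Real.pi * cot (Real.pi * (m * z))) fun m ↦ by
      simp [cot, neg_mul, div_neg])
  have h4 := (h3.mul_left (2 * Real.pi * Complex.I)⁻¹)
  rw [show weightOne N v z - v 0 / N = (2 * Real.pi * Complex.I)⁻¹ *
      (∑' x : Fin 2 → ℤ, zetaTerm u (latticeVec x z) - u * G2 z + 0) by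
    rw [add_zero, hu]; exact add_sub_cancel_right _ _]
  refine h4.congr_fun fun m ↦ ?_
  rw [tsum_zetaTerm_row u z m (hu' m)]
  ring

end SymmetricSums

noncomputable section WeightOneQSeries

open UpperHalfPlane Filter Topology EisensteinSeries ModularForm Complex SummationFilter

lemma HasSum.of_eq {X : Type*} {L : SummationFilter X} {f g : X → ℂ} {a b : ℂ} (h : HasSum f a L)
    (hf : ∀ x, g x = f x) (ha : b = a) : HasSum g b L := by
  rwa [funext hf, ha]

lemma hasSum_nome_pow_succ {w : ℂ} (hw : 0 < w.im) :
    HasSum (fun k : ℕ ↦ nome w ^ (k + 1))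
      (-1 / 2 - (2 * Real.pi * Complex.I)⁻¹ * (Real.pi * cot (Real.pi * w))) := by
  have h0 : (2 * Real.pi * Complex.I : ℂ) ≠ 0 := by simp [Real.pi_ne_zero]
  have hs : Summable fun k : ℕ ↦ nome w ^ k :=
    summable_geometric_of_norm_lt_one (norm_nome_lt_one hw)
  have h1 : (Real.pi * cot (Real.pi * w) : ℂ) =
      Real.pi * Complex.I - 2 * Real.pi * Complex.I * ∑' k : ℕ, nome w ^ k :=
    pi_mul_cot_pi_q_exp ⟨w, hw⟩
  have h2 := (hasSum_nat_add_iff' (f := fun k ↦ nome w ^ k) 1).2 hs.hasSum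
  refine h2.of_eq (fun _ ↦ rfl) ?_
  rw [h1]
  simp only [Finset.range_one, Finset.sum_singleton, pow_zero]
  field_simp
  ring

/-- The `k`-th coefficient of the `q`-expansion of the cotangent of `π (e z + c)`. -/
def cotCoeff (c : ℂ) (e : ℤ) (k : ℕ) : ℂ := -(e.sign : ℂ) * nome (e.sign * c) ^ (k + 1)

/-- The constant term of the `q`-expansion of the cotangent of `π (e z + c)`. -/
def cotConst (c : ℂ) (e : ℤ) : ℂ :=
  if e = 0 then (2 * Real.pi * Complex.I)⁻¹ * (Real.pi * cot (Real.pi * c)) else -(e.sign : ℂ) / 2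

lemma hasSum_cotCoeff (c : ℝ) (e : ℤ) (z : ℍ) :
    HasSum (fun k : ℕ ↦ cotCoeff c e k * nome z ^ (e.natAbs * (k + 1)))
      ((2 * Real.pi * Complex.I)⁻¹ * (Real.pi * cot (Real.pi * (e * z + c))) - cotConst c e) := by
  rcases lt_trichotomy e 0 with he | rfl | he
  · have him : 0 < (-(e * z + c : ℂ)).im := by
      simpa using mul_neg_of_neg_of_pos (by exact_mod_cast he : (e : ℝ) < 0) z.im_pos
    refine (hasSum_nome_pow_succ him).of_eq (fun k ↦ ?_) ?_
    · have hn : (e.natAbs : ℂ) = -e := by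
        rw [← Int.cast_natCast, Int.natCast_natAbs, abs_of_neg he, Int.cast_neg]
      rw [cotCoeff, Int.sign_eq_neg_one_of_neg he, pow_mul, ← nome_natCast_mul e.natAbs, hn,
        mul_assoc, ← mul_pow, ← nome_add]
      push_cast
      ring_nf
    · rw [cotConst, if_neg he.ne, Int.sign_eq_neg_one_of_neg he]
      rw [mul_neg, show ∀ x : ℂ, cot (-x) = -cot x from fun x ↦ by simp [cot, div_neg]]
      push_cast
      ring
  · simp [cotCoeff, cotConst, hasSum_zero]
  · have him : 0 < (e * z + c : ℂ).im := by
      simpa using mul_pos (by exact_mod_cast he : (0 : ℝ) < e) z.im_pos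
    refine (hasSum_nome_pow_succ him).neg.of_eq (fun k ↦ ?_) ?_
    · have hn : (e.natAbs : ℂ) = e := by
        rw [← Int.cast_natCast, Int.natCast_natAbs, abs_of_pos he]
      rw [cotCoeff, Int.sign_eq_one_of_pos he, pow_mul, ← nome_natCast_mul e.natAbs, hn,
        mul_assoc, ← mul_pow, ← nome_add]
      push_cast
      ring_nf
    · rw [cotConst, if_neg he.ne', Int.sign_eq_one_of_pos he]
      push_cast
      ring

lemma summable_pow_natAbs {r : ℝ} (h0 : 0 ≤ r) (h1 : r < 1) : Summable fun e : ℤ ↦ r ^ e.natAbs :=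
  Summable.of_nat_of_neg (by simpa using summable_geometric_of_lt_one h0 h1)
    (by simpa using summable_geometric_of_lt_one h0 h1)

lemma norm_nome_ofReal (x : ℝ) : ‖nome x‖ = 1 := by simp [norm_nome]

lemma summable_cotCoeff (c : ℝ) {N : ℕ} (hN : 0 < N) (a : ℤ) (z : ℍ) :
    Summable fun x : ℤ × ℕ ↦
      cotCoeff c (a + x.1 * N) x.2 * nome z ^ ((a + x.1 * N).natAbs * (x.2 + 1)) := by
  have hr := norm_nome_lt_one z.im_pos
  have hr0 := norm_nonneg (nome z)
  have h1 : Summable fun m : ℤ ↦ ‖nome z‖ ^ (a + m * N).natAbs :=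
    (summable_pow_natAbs hr0 hr).comp_injective (i := fun m : ℤ ↦ a + m * N) fun m n h ↦ by
      simpa [hN.ne'] using h
  have h2 := h1.mul_of_nonneg (summable_geometric_of_lt_one hr0 hr)
    (fun _ ↦ by positivity) (fun _ ↦ by positivity)
  refine Summable.of_norm_bounded h2 fun ⟨m, k⟩ ↦ ?_
  dsimp only
  generalize a + m * N = e
  rcases eq_or_ne e 0 with rfl | he
  · simp only [cotCoeff, Int.sign_zero, Int.cast_zero, neg_zero, zero_mul, norm_zero]; positivity
  · have h3 : ‖cotCoeff c e k‖ = 1 := by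
      have h4 : ‖nome (e.sign * c)‖ = 1 := by
        have := norm_nome_ofReal (e.sign * c)
        push_cast at this
        exact this
      rw [cotCoeff, norm_mul, norm_pow, h4, one_pow, mul_one, norm_neg]
      rcases lt_or_gt_of_ne he with h | h
      · simp [Int.sign_eq_neg_one_of_neg h]
      · simp [Int.sign_eq_one_of_pos h]
    rw [norm_mul, h3, one_mul, norm_pow, ← pow_add]
    refine pow_le_pow_of_le_one hr0 hr.le ?_
    have : 1 ≤ e.natAbs := Int.natAbs_pos.2 he
    nlinarith

lemma hasSum_abs_sub_abs (k : ℤ) :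
    HasSum (fun m : ℤ ↦ ((|m + k + 1| - |m + k| : ℤ) : ℂ)) (2 * k + 1) (symmetricIcc ℤ) := by
  rw [hasSum_symmetricIcc_iff]
  have h : ∀ n : ℕ, ∑ m ∈ Finset.Icc (-(n : ℤ)) n, (|m + k + 1| - |m + k|) =
      |n + k + 1| - |-n + k| := by
    intro n
    induction n with
    | zero => simp
    | succ n ih =>
      rw [sum_Icc_neg_succ, ih]
      push_cast
      rw [show -(n + 1 : ℤ) + k + 1 = -n + k by ring, show (n : ℤ) + 1 + k = n + k + 1 by ring]
      ring
  refine tendsto_const_nhds.congr' ?_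
  filter_upwards [eventually_ge_atTop (k.natAbs + 1)] with n hn
  rw [← Int.cast_sum, h, abs_of_nonneg (by omega), abs_of_nonpos (by omega)]
  push_cast
  ring

/-- The value of `weightOne N v` at the cusp `∞`. -/
def weightOneConst (N : ℕ) (v : Fin 2 → ℤ) : ℂ :=
  if (N : ℤ) ∣ v 0 then (2 * Real.pi * Complex.I)⁻¹ * (Real.pi * cot (Real.pi * (v 1 / N)))
  else (v 0 % N : ℤ) / N - 1 / 2

lemma hasSum_cotConst {N : ℕ} (hN : 0 < N) (v : Fin 2 → ℤ) :
    HasSum (fun m : ℤ ↦ cotConst (v 1 / N) (v 0 + m * N)) (weightOneConst N v - v 0 / N)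
      (symmetricIcc ℤ) := by
  have hN' : (N : ℂ) ≠ 0 := by exact_mod_cast hN.ne'
  have hNZ : (0 : ℤ) < N := by exact_mod_cast hN
  have hdiv := Int.emod_add_mul_ediv (v 0) N
  have hpos := Int.emod_nonneg (v 0) hNZ.ne'
  have hlt := Int.emod_lt_of_pos (v 0) hNZ
  rw [weightOneConst]
  generalize (v 1 / N : ℂ) = c
  generalize v 0 = a at *
  generalize a / (N : ℤ) = k at *
  have hk := hasSum_abs_sub_abs k
  have hac : (a : ℂ) = (a % N : ℤ) + N * k := by exact_mod_cast hdiv.symm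
  split_ifs with hdvd
  · have h0 : a % N = 0 := Int.emod_eq_zero_of_dvd hdvd
    rw [h0] at hdiv hac
    have hk' := hasSum_abs_sub_abs (k - 1)
    have hsingle : HasSum (fun m : ℤ ↦ if m = -k then cotConst c 0 else 0) (cotConst c 0)
      (symmetricIcc ℤ) := (hasSum_ite_eq (-k) _).mono_left SummationFilter.le_atTop
    refine (((hk.add hk').mul_left (-1 / 4 : ℂ)).add hsingle).of_eq (fun m ↦ ?_) ?_
    · have he : a + m * N = (m + k) * N := by rw [← hdiv]; ring
      rw [he]
      rcases lt_trichotomy (m + k) 0 with h | h | h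
      · rw [cotConst, if_neg (mul_ne_zero h.ne hNZ.ne'), if_neg (by omega),
          Int.sign_eq_neg_one_of_neg (mul_neg_of_neg_of_pos h hNZ),
          abs_of_nonpos (by omega : m + k + 1 ≤ 0), abs_of_neg h,
          abs_of_nonpos (by omega : m + (k - 1) + 1 ≤ 0), abs_of_neg (by omega : m + (k - 1) < 0)]
        push_cast
        ring
      · rw [h, zero_mul, if_pos (by omega), show m + (k - 1) + 1 = 0 by omega,
          show m + (k - 1) = -1 by omega]
        norm_num
      · rw [cotConst, if_neg (mul_ne_zero h.ne' hNZ.ne'), if_neg (by omega),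
          Int.sign_eq_one_of_pos (mul_pos h hNZ),
          abs_of_pos (by omega : 0 < m + k + 1), abs_of_pos h,
          abs_of_pos (by omega : 0 < m + (k - 1) + 1), abs_of_nonneg (by omega : 0 ≤ m + (k - 1))]
        push_cast
        ring
    · rw [hac, cotConst, if_pos rfl]
      push_cast
      field_simp
      ring
  · have h0 : 0 < a % N := lt_of_le_of_ne hpos fun h ↦ hdvd (Int.dvd_of_emod_eq_zero h.symm)
    refine (hk.mul_left (-1 / 2 : ℂ)).of_eq (fun m ↦ ?_) ?_
    · have he : a + m * N = (m + k) * N + a % N := by linear_combination -hdiv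
      rw [he]
      rcases lt_or_ge (m + k) 0 with h | h
      · have h1 : (m + k) * N + a % N < 0 := by nlinarith
        rw [cotConst, if_neg h1.ne, Int.sign_eq_neg_one_of_neg h1,
          abs_of_nonpos (by omega : m + k + 1 ≤ 0), abs_of_neg h]
        push_cast
        ring
      · have h1 : 0 < (m + k) * N + a % N := by positivity
        rw [cotConst, if_neg h1.ne', Int.sign_eq_one_of_pos h1,
          abs_of_pos (by omega : 0 < m + k + 1), abs_of_nonneg h]
        push_cast
        ring
    · rw [hac]
      field_simp
      ring

lemma HasQSeries.of_hasSum_fiber {X : Type*} {c : X → ℂ} {d : X → ℕ} {F : ℍ → ℂ}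
    (h : ∀ z : ℍ, HasSum (fun x ↦ c x * nome z ^ d x) (F z)) :
    HasQSeries (fun n ↦ ∑' x : {x // d x = n}, c x) F := fun z ↦ by
  have h1 := (Equiv.sigmaFiberEquiv d).hasSum_iff.2 (h z)
  refine (h1.sigma fun n ↦ (h1.summable.sigma_factor n).hasSum).congr_fun fun n ↦ ?_
  rw [← tsum_mul_right]
  refine tsum_congr fun x ↦ ?_
  simp [x.2]

lemma exists_intCast_eq_tsum {X : Type*} {c : X → ℂ} (h : ∀ x, ∃ n : ℤ, (n : ℂ) = c x) :
    ∃ n : ℤ, (n : ℂ) = ∑' x, c x := by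
  by_cases hs : Summable c
  · have hcl : IsClosed (Set.range ((↑) : ℤ → ℂ)) := Complex.isClosed_range_intCast
    refine hcl.mem_of_tendsto hs.hasSum (Eventually.of_forall fun s ↦ ?_)
    choose n hn using h
    exact ⟨∑ x ∈ s, n x, by simp [hn]⟩
  · exact ⟨0, by rw [tsum_eq_zero_of_not_summable hs]; simp⟩

lemma exists_hasQSeries_weightOne {N : ℕ} (hN : 0 < N) {v : Fin 2 → ℤ}
    (hv : ¬ ((N : ℤ) ∣ v 0 ∧ (N : ℤ) ∣ v 1)) {G : ℍ → ℂ}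
    (hG : ∀ z w : ℍ, (w : ℂ) = N * z → G z = weightOne N v w) :
    ∃ A : ℕ → ℂ, HasQSeries A G ∧ A 0 = weightOneConst N v ∧
      (v 1 = 0 → ∀ n ≠ 0, ∃ k : ℤ, (k : ℂ) = A n) := by
  have hN' : (N : ℂ) ≠ 0 := by exact_mod_cast hN.ne'
  set c : ℝ := v 1 / N with hc
  have hcc : (v 1 / N : ℂ) = c := by simp [hc]
  set F : ℍ → ℂ := fun z ↦ ∑' x : ℤ × ℕ,
      cotCoeff c (v 0 + x.1 * N) x.2 * nome z ^ ((v 0 + x.1 * N).natAbs * (x.2 + 1)) with hF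
  have h1 : HasQSeries _ F := HasQSeries.of_hasSum_fiber fun z ↦
    (summable_cotCoeff c hN (v 0) z).hasSum
  have h2 : ∀ z, G z = weightOneConst N v + F z := by
    intro z
    have him : 0 < ((N : ℂ) * z).im := by
      simpa using mul_pos (by exact_mod_cast hN : (0 : ℝ) < N) z.im_pos
    rw [hG z ⟨N * z, him⟩ rfl]
    have h3 := hasSum_weightOne hN hv ⟨N * z, him⟩
    have h4 := ((summable_cotCoeff c hN (v 0) z).hasSum.prod_fiberwise
      fun m ↦ hasSum_cotCoeff c (v 0 + m * N) z).mono_left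
      (SummationFilter.le_atTop (L := symmetricIcc ℤ))
    have h5 := HasSum.add h4 (hcc ▸ hasSum_cotConst hN v)
    have h6 := h3.unique (HasSum.of_eq h5 (fun m ↦ ?_) rfl)
    · change _ = F z + _ at h6
      linear_combination h6
    · rw [sub_add_cancel, ← hcc]
      congr 4
      simp only [latticeVec]
      push_cast
      field_simp
      ring
  have h3 : HasQSeries (fun n ↦ if n = 0 then weightOneConst N v else 0)
      (fun _ ↦ weightOneConst N v) := fun z ↦ by
    refine (hasSum_ite_eq 0 (weightOneConst N v)).of_eq (fun n ↦ ?_) rfl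
    split_ifs with h <;> simp [h]
  have h4 : HasQSeries _ G := (funext h2 : G = (fun _ ↦ weightOneConst N v) + F) ▸ h3.add h1
  refine ⟨_, h4, ?_, fun hv1 n hn ↦ ?_⟩
  · simp only [Pi.add_apply, if_true, add_eq_left]
    refine (tsum_congr fun x ↦ ?_).trans tsum_zero
    have := x.2
    simp only [mul_eq_zero, Int.natAbs_eq_zero, Nat.add_eq_zero_iff, one_ne_zero, and_false,
      or_false] at this
    rw [this]
    simp [cotCoeff]
  · simp only [Pi.add_apply, if_neg hn, zero_add]
    refine exists_intCast_eq_tsum fun x ↦ ⟨-Int.sign (v 0 + x.1.1 * N), ?_⟩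
    simp [cotCoeff, hc, hv1, nome]

end WeightOneQSeries

noncomputable section Triangular

open UpperHalfPlane Filter Topology ModularForm
open scoped Matrix MatrixGroups

/-- The upper triangular matrix `(α, k; 0, δ)`. -/
def tri (α δ : ℕ) [NeZero α] [NeZero δ] (k : ℤ) : GL (Fin 2) ℝ :=
  Matrix.GeneralLinearGroup.mkOfDetNeZero !![(α : ℝ), k; 0, δ]
    (by simp [Matrix.det_fin_two, NeZero.ne])

variable (α δ m : ℕ) [NeZero α] [NeZero δ] [NeZero m] (k : ℤ)

lemma val_tri : (tri α δ k : Matrix (Fin 2) (Fin 2) ℝ) = !![(α : ℝ), k; 0, δ] := rfl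

lemma det_tri : (tri α δ k).det.val = α * δ := by
  rw [Matrix.GeneralLinearGroup.val_det_apply, val_tri, Matrix.det_fin_two]; simp

lemma det_tri_pos : 0 < (tri α δ k).det.val := by
  rw [det_tri]
  have := NeZero.pos α
  have := NeZero.pos δ
  positivity

lemma coe_tri_smul (z : ℍ) : ((tri α δ k • z : ℍ) : ℂ) = (α * z + k) / δ := by
  rw [coe_smul_of_det_pos (det_tri_pos α δ k)]
  simp [num, denom, val_tri]

lemma denom_tri (z : ℍ) : denom (tri α δ k) z = δ := by
  simp [denom, val_tri]

lemma slash_tri_apply (w : ℤ) (F : ℍ → ℂ) (z : ℍ) :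
    (F ∣[w] tri α δ k) z = F (tri α δ k • z) * (α * δ : ℂ) ^ (w - 1) * (δ : ℂ) ^ (-w) := by
  rw [slash_apply, denom_tri, det_tri]
  have h : |(α : ℝ) * δ| = α * δ := abs_of_nonneg (by positivity)
  rw [σ, if_pos (det_tri_pos α δ k), h]
  simp

lemma slash_one_tri_apply (F : ℍ → ℂ) (z : ℍ) :
    (F ∣[(1 : ℤ)] tri α δ k) z = (δ : ℂ)⁻¹ * F (tri α δ k • z) := by
  rw [slash_tri_apply]; simp [mul_comm]

lemma slash_two_tri_apply (F : ℍ → ℂ) (z : ℍ) :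
    (F ∣[(2 : ℤ)] tri α δ k) z = α / δ * F (tri α δ k • z) := by
  have : (δ : ℂ) ≠ 0 := NeZero.ne _
  rw [slash_tri_apply]
  have h : (δ : ℂ) ^ (-2 : ℤ) = (δ * δ : ℂ)⁻¹ := by
    rw [zpow_neg, zpow_ofNat, sq]
  rw [h]; norm_num
  field_simp

lemma tri_one_zero : tri α δ k 1 0 = 0 := by simp [val_tri]

variable {α δ k} in
lemma tendsto_tri_smul : Tendsto (fun z : ℍ ↦ tri α δ k • z) atImInfty atImInfty :=
  tendsto_smul_atImInfty (tri_one_zero α δ k)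

variable {α δ m k} in
lemma tendsto_slash_one_tri {F : ℍ → ℂ} {c : ℂ} (h : Tendsto F atImInfty (𝓝 c)) :
    Tendsto (F ∣[(1 : ℤ)] tri α δ k) atImInfty (𝓝 ((δ : ℂ)⁻¹ * c)) :=
  ((h.comp tendsto_tri_smul).const_mul _).congr fun z ↦ (slash_one_tri_apply α δ k F z).symm

variable {α δ m k} in
lemma tendsto_slash_two_tri {F : ℍ → ℂ} {c : ℂ} (h : Tendsto F atImInfty (𝓝 c)) :
    Tendsto (F ∣[(2 : ℤ)] tri α δ k) atImInfty (𝓝 (α / δ * c)) :=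
  ((h.comp tendsto_tri_smul).const_mul _).congr fun z ↦ (slash_two_tri_apply α δ k F z).symm

variable {α δ k} in
lemma tri_mul_mapGL {α' δ' : ℕ} [NeZero α'] [NeZero δ'] {k' : ℤ} {γ γ' : SL(2, ℤ)}
    (h : !![(α : ℤ), k; 0, δ] * (γ : Matrix (Fin 2) (Fin 2) ℤ)
      = (γ' : Matrix (Fin 2) (Fin 2) ℤ) * !![(α' : ℤ), k'; 0, δ']) :
    tri α δ k * (γ : GL (Fin 2) ℝ) = (γ' : GL (Fin 2) ℝ) * tri α' δ' k' := by
  have h' := congrArg (fun M : Matrix (Fin 2) (Fin 2) ℤ ↦ M.map (Int.cast : ℤ → ℝ)) h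
  apply Units.ext
  rw [Units.val_mul, Units.val_mul, val_tri, val_tri]
  ext i j
  have hij := congrFun (congrFun h' i) j
  fin_cases i <;> fin_cases j <;>
    simpa [Matrix.mul_apply, Matrix.vecMul, dotProduct, Fin.sum_univ_two] using hij

variable {α δ k} in
/-- Moving a triangular matrix past an element of `SL(2, ℤ)`. -/
lemma slash_tri_slash {α' δ' : ℕ} [NeZero α'] [NeZero δ'] {k' : ℤ} {γ γ' : SL(2, ℤ)}
    (h : !![(α : ℤ), k; 0, δ] * (γ : Matrix (Fin 2) (Fin 2) ℤ)
      = (γ' : Matrix (Fin 2) (Fin 2) ℤ) * !![(α' : ℤ), k'; 0, δ']) (w : ℤ) (F : ℍ → ℂ) :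
    (F ∣[w] tri α δ k) ∣[w] γ = (F ∣[w] γ') ∣[w] tri α' δ' k' := by
  rw [SL_slash, SL_slash, ← SlashAction.slash_mul, ← SlashAction.slash_mul, tri_mul_mapGL h]

end Triangular

noncomputable section WeightOneLimits

open UpperHalfPlane Filter Topology ModularForm
open scoped Matrix MatrixGroups

lemma weightOne_slash (N : ℕ) (v : Fin 2 → ℤ) (γ : SL(2, ℤ)) :
    weightOne N v ∣[(1 : ℤ)] γ = weightOne N (v ᵥ* (γ : Matrix (Fin 2) (Fin 2) ℤ)) := by
  ext z
  rw [SL_slash_apply, weightOne_smul, zpow_neg_one]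
  field_simp [denom_ne_zero]

lemma tendsto_weightOne {N : ℕ} [NeZero N] {v : Fin 2 → ℤ}
    (hv : ¬ ((N : ℤ) ∣ v 0 ∧ (N : ℤ) ∣ v 1)) :
    Tendsto (weightOne N v) atImInfty (𝓝 (weightOneConst N v)) := by
  have hN : (N : ℂ) ≠ 0 := NeZero.ne _
  obtain ⟨A, hA, hA0, -⟩ := exists_hasQSeries_weightOne (NeZero.pos N) hv
    (G := fun z ↦ weightOne N v (tri N 1 0 • z)) fun z w hw ↦ by
      congr 1; ext1; rw [coe_tri_smul, hw]; simp
  rw [← hA0]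
  refine (hA.tendsto.comp (tendsto_tri_smul (α := 1) (δ := N) (k := 0))).congr fun z ↦ ?_
  simp only [Function.comp_apply]
  congr 1; ext1
  rw [coe_tri_smul, coe_tri_smul]; simp; field_simp

lemma cot_pi_mul_add_intCast (x : ℂ) (k : ℤ) :
    Complex.cot (Real.pi * (x + k)) = Complex.cot (Real.pi * x) := by
  rw [Complex.cot_pi_eq_exp_ratio, Complex.cot_pi_eq_exp_ratio]
  have h := nome_add_intCast x k
  simp only [nome] at h
  rw [h]

lemma weightOne_add_snd {N : ℕ} (hN : 0 < N) {v v' : Fin 2 → ℤ}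
    (hv : ¬ ((N : ℤ) ∣ v 0 ∧ (N : ℤ) ∣ v 1)) (h0 : v' 0 = v 0) {k : ℤ} (h1 : v' 1 = v 1 + N * k) :
    weightOne N v' = weightOne N v := by
  ext z
  have hv' : ¬ ((N : ℤ) ∣ v' 0 ∧ (N : ℤ) ∣ v' 1) := by
    rw [h0, h1, dvd_add_left (Dvd.intro _ rfl)]; exact hv
  have h := hasSum_weightOne hN hv z
  have h' := hasSum_weightOne hN hv' z
  have h2 := h'.unique (h.of_eq (fun m ↦ ?_) rfl)
  · rw [h0] at h2; exact sub_left_injective h2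
  have hN' : (N : ℂ) ≠ 0 := by exact_mod_cast hN.ne'
  have : latticeVec v' z / N + m * z = latticeVec v z / N + m * z + k := by
    simp only [latticeVec, h0, h1]; push_cast; field_simp; ring
  rw [this, cot_pi_mul_add_intCast]

lemma weightOne_congr {N : ℕ} (hN : 0 < N) {v v' : Fin 2 → ℤ}
    (hv : ¬ ((N : ℤ) ∣ v 0 ∧ (N : ℤ) ∣ v 1)) (h : ∀ i, v' i ≡ v i [ZMOD N]) :
    weightOne N v' = weightOne N v := by
  have key : weightOne N ![v' 0, v 1] = weightOne N v := by
    have h1 : weightOne N (![v' 0, v 1] ᵥ* (ModularGroup.S : Matrix (Fin 2) (Fin 2) ℤ))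
        = weightOne N (v ᵥ* (ModularGroup.S : Matrix (Fin 2) (Fin 2) ℤ)) := by
      obtain ⟨k, hk⟩ := (h 0).symm.dvd
      refine weightOne_add_snd hN (k := -k) ?_ ?_ ?_
      · simp [Matrix.vecMul, dotProduct, Fin.sum_univ_two, ModularGroup.S]
        intro h1 h2; exact hv ⟨h2, h1⟩
      · simp [Matrix.vecMul, dotProduct, Fin.sum_univ_two, ModularGroup.S]
      · simp [Matrix.vecMul, dotProduct, Fin.sum_univ_two, ModularGroup.S]
        linarith
    rw [← weightOne_slash, ← weightOne_slash] at h1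
    have h2 := congrArg (· ∣[(1 : ℤ)] ModularGroup.S⁻¹) h1
    simpa [← SlashAction.slash_mul] using h2
  rw [← key]
  obtain ⟨k, hk⟩ := (h 1).symm.dvd
  refine weightOne_add_snd hN (k := k) ?_ (by simp) (by simp; linarith)
  simp only [Matrix.cons_val_zero, Matrix.cons_val_one]
  rwa [(h 0).dvd_iff]

end WeightOneLimits

noncomputable section Constants

variable (N : ℕ) [NeZero N]

/-- The sawtooth function on `ℤ/N`. -/
def sawtooth (x : ZMod N) : ℂ := if x = 0 then 0 else x.val / N - 1 / 2

/-- The cotangent function on `ℤ/N`. -/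
def cotSum (x : ZMod N) : ℂ := ∑ t, sawtooth N t * ZMod.stdAddChar (t * x)

variable {N}

lemma sawtooth_neg (x : ZMod N) : sawtooth N (-x) = -sawtooth N x := by
  have : (N : ℂ) ≠ 0 := NeZero.ne _
  rcases eq_or_ne x 0 with rfl | hx
  · simp [sawtooth]
  · rw [sawtooth, sawtooth, if_neg hx, if_neg (neg_ne_zero.2 hx)]
    have : NeZero x := ⟨hx⟩
    rw [ZMod.val_neg_of_ne_zero, Nat.cast_sub x.val_lt.le]
    field_simp; ring

lemma cotSum_neg (x : ZMod N) : cotSum N (-x) = -cotSum N x := by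
  rw [cotSum, cotSum, ← Finset.sum_neg_distrib]
  refine Fintype.sum_equiv (Equiv.neg _) _ _ fun t ↦ ?_
  rw [Equiv.neg_apply, sawtooth_neg]
  simp

lemma cotSum_zero : cotSum N 0 = 0 := by
  have h := cotSum_neg (N := N) 0
  rw [neg_zero] at h
  exact self_eq_neg.1 h

lemma sum_cotSum_sq : ∑ x, cotSum N x ^ 2 = -N * ∑ x, sawtooth N x ^ 2 := by
  have h (x : ZMod N) : cotSum N x ^ 2
      = -∑ t, ∑ u, sawtooth N t * sawtooth N u * ZMod.stdAddChar (x * (t - u)) := by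
    rw [sq, ← neg_neg (cotSum N x * _), ← mul_neg, ← cotSum_neg, cotSum, cotSum,
      Finset.sum_mul_sum]
    congr 1
    refine Finset.sum_congr rfl fun t _ ↦ Finset.sum_congr rfl fun u _ ↦ ?_
    rw [show x * (t - u) = t * x + u * -x by ring, AddChar.map_add_eq_mul]
    ring
  simp only [h, Finset.sum_neg_distrib]
  rw [neg_mul, Finset.sum_comm]
  congr 1
  rw [Finset.mul_sum]
  refine Finset.sum_congr rfl fun t _ ↦ ?_
  rw [Finset.sum_comm, Finset.sum_eq_single t]
  · simp [ZMod.card, sq, mul_comm]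
  · intro u _ hu
    rw [← Finset.mul_sum, AddChar.sum_mulShift _ (ZMod.isPrimitive_stdAddChar N),
      if_neg (sub_ne_zero.2 hu.symm)]
    simp
  · simp

lemma sum_sawtooth_sq :
    ∑ x, sawtooth N x ^ 2 = ((N : ℂ) - 1) * (N - 2) / (12 * N) := by
  have hN0 : (N : ℂ) ≠ 0 := NeZero.ne _
  have h1 : ∀ M : ℕ, ∑ t ∈ Finset.range M, ((t : ℂ) / N - 1 / 2) ^ 2
      = (M * (M - 1) * (2 * M - 1) / 6) / (N : ℂ) ^ 2 - (M * (M - 1) / 2) / N + (M : ℂ) / 4 := by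
    intro M
    induction M with
    | zero => simp
    | succ M ih => rw [Finset.sum_range_succ, ih]; push_cast; field_simp; ring
  have h2 : ∑ x : ZMod N, sawtooth N x ^ 2
      = ∑ x : ZMod N, ((x.val : ℂ) / N - 1 / 2) ^ 2 - 1 / 4 := by
    rw [eq_sub_iff_add_eq, ← Finset.add_sum_erase _ _ (Finset.mem_univ 0),
      ← Finset.add_sum_erase _ _ (Finset.mem_univ 0)]
    rw [Finset.sum_congr rfl fun x hx ↦ by rw [sawtooth, if_neg (Finset.ne_of_mem_erase hx)]]
    simp [sawtooth]; ring
  have h3 : ∑ x : ZMod N, ((x.val : ℂ) / N - 1 / 2) ^ 2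
      = ∑ t ∈ Finset.range N, ((t : ℂ) / N - 1 / 2) ^ 2 := by
    refine Finset.sum_bij (fun x _ ↦ x.val) (fun x _ ↦ Finset.mem_range.2 x.val_lt)
      (fun x _ y _ h ↦ ZMod.val_injective N h) (fun t ht ↦ ⟨t, Finset.mem_univ _,
        ZMod.val_cast_of_lt (Finset.mem_range.1 ht)⟩) fun _ _ ↦ rfl
  rw [h2, h3, h1]
  field_simp
  ring

omit [NeZero N] in
lemma sum_range_mul_pow_of_root {ζ : ℂ} (h1 : ζ ≠ 1) (hζ : ζ ^ N = 1) :
    ∑ t ∈ Finset.range N, (t : ℂ) * ζ ^ t = N / (ζ - 1) := by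
  have h : ∀ M : ℕ, (∑ t ∈ Finset.range M, (t : ℂ) * ζ ^ t) * (ζ - 1) ^ 2
      = M * ζ ^ M * (ζ - 1) - ζ * (ζ ^ M - 1) := by
    intro M
    induction M with
    | zero => simp
    | succ M ih => rw [Finset.sum_range_succ, add_mul, ih]; push_cast; ring
  have h2 := h N
  have h3 : ζ - 1 ≠ 0 := sub_ne_zero.2 h1
  rw [hζ] at h2
  rw [eq_div_iff h3]
  apply mul_right_cancel₀ h3
  linear_combination h2

lemma stdAddChar_intCast (b : ℤ) :
    (ZMod.stdAddChar (b : ZMod N) : ℂ) = nome (b / N) := by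
  rw [ZMod.stdAddChar_coe, nome]; ring_nf

lemma cotSum_intCast {b : ℤ} (hb : ¬ (N : ℤ) ∣ b) :
    cotSum N b = (2 * Real.pi * Complex.I)⁻¹ * (Real.pi * Complex.cot (Real.pi * (b / N))) := by
  have hN0 : (N : ℂ) ≠ 0 := NeZero.ne _
  set ζ : ℂ := ZMod.stdAddChar (b : ZMod N) with hζd
  have hb' : (b : ZMod N) ≠ 0 := by rwa [Ne, ZMod.intCast_zmod_eq_zero_iff_dvd]
  have hζ1 : ζ ≠ 1 := by
    rw [hζd, ← AddChar.map_zero_eq_one (ZMod.stdAddChar (N := N)), ZMod.injective_stdAddChar.ne_iff]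
    exact hb'
  have hζN : ζ ^ N = 1 := by
    rw [hζd, ← AddChar.map_nsmul_eq_pow]; simp
  have h1 : cotSum N b = ∑ t ∈ Finset.range N, ((t : ℂ) / N - 1 / 2) * ζ ^ t + 1 / 2 := by
    have h2 : cotSum N b = ∑ x : ZMod N, ((x.val : ℂ) / N - 1 / 2) * ζ ^ x.val + 1 / 2 := by
      rw [← sub_eq_iff_eq_add, eq_comm, eq_sub_iff_add_eq, cotSum,
        ← Finset.add_sum_erase _ _ (Finset.mem_univ 0),
        ← Finset.add_sum_erase (a := (0 : ZMod N)) _ _ (Finset.mem_univ 0)]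
      simp only [ZMod.val_zero, sawtooth, if_true]
      rw [add_right_comm]
      congr 1
      · simp
      · refine Finset.sum_congr rfl fun x hx ↦ ?_
        rw [if_neg (Finset.ne_of_mem_erase hx), hζd, ← AddChar.map_nsmul_eq_pow]
        congr 2
        simp
    rw [h2]
    congr 1
    refine Finset.sum_bij (fun x _ ↦ x.val) (fun x _ ↦ Finset.mem_range.2 x.val_lt)
      (fun x _ y _ h ↦ ZMod.val_injective N h) (fun t ht ↦ ⟨t, Finset.mem_univ _,
        ZMod.val_cast_of_lt (Finset.mem_range.1 ht)⟩) fun _ _ ↦ rfl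
  have h4 : ∑ t ∈ Finset.range N, ((t : ℂ) / N - 1 / 2) * ζ ^ t = 1 / (ζ - 1) := by
    have h5 : ∑ t ∈ Finset.range N, ζ ^ t = 0 := by
      rw [geom_sum_eq hζ1, hζN]; simp
    have h6 := sum_range_mul_pow_of_root (N := N) hζ1 hζN
    have : ∀ t : ℕ, ((t : ℂ) / N - 1 / 2) * ζ ^ t = (N : ℂ)⁻¹ * (t * ζ ^ t) - 1 / 2 * ζ ^ t :=
      fun t ↦ by ring
    simp only [this]
    rw [Finset.sum_sub_distrib, ← Finset.mul_sum, ← Finset.mul_sum, h5, h6]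
    field_simp; ring
  have hz : ζ = Complex.exp (2 * Real.pi * Complex.I * (b / N)) := by
    rw [hζd, stdAddChar_intCast, nome]
  have h3 : ζ - 1 ≠ 0 := sub_ne_zero.2 hζ1
  rw [h1, h4, Complex.cot_pi_eq_exp_ratio, ← hz]
  have hpi : (Real.pi : ℂ) ≠ 0 := by exact_mod_cast Real.pi_ne_zero
  have hI := Complex.I_ne_zero
  have h7 : Complex.I * (1 - ζ) ≠ 0 := mul_ne_zero hI (by rw [← neg_sub]; exact neg_ne_zero.2 h3)
  have h8 : 1 - ζ ≠ 0 := right_ne_zero_of_mul h7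
  field_simp
  rw [Complex.I_sq]
  ring

lemma weightOneConst_of_dvd {v : Fin 2 → ℤ} (h0 : (N : ℤ) ∣ v 0) (h1 : ¬ (N : ℤ) ∣ v 1) :
    weightOneConst N v = cotSum N (v 1) := by
  rw [weightOneConst, if_pos h0, cotSum_intCast h1]

lemma weightOneConst_of_not_dvd {v : Fin 2 → ℤ} (h0 : ¬ (N : ℤ) ∣ v 0) :
    weightOneConst N v = sawtooth N (v 0) := by
  have : ((v 0 : ℤ) : ZMod N) ≠ 0 := by rwa [Ne, ZMod.intCast_zmod_eq_zero_iff_dvd]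
  rw [weightOneConst, if_neg h0, sawtooth, if_neg this, ← ZMod.val_intCast]
  simp

end Constants

noncomputable section TorsionEisenstein

open UpperHalfPlane Filter Topology ModularForm
open scoped Matrix MatrixGroups

variable {N : ℕ} [NeZero N]

variable (N) in
/-- The weight one Eisenstein series attached to a point of `(ℤ/N)²`. -/
def torsEis (x y : ZMod N) : ℍ → ℂ := weightOne N ![(x.val : ℤ), (y.val : ℤ)]

lemma intCast_dvd_val_iff (x : ZMod N) : (N : ℤ) ∣ (x.val : ℤ) ↔ x = 0 := by
  rw [← ZMod.intCast_zmod_eq_zero_iff_dvd]; simp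

omit [NeZero N] in
lemma torsEis_zero : torsEis N 0 0 = 0 := by
  ext z
  have : ∀ ω : ℂ, zetaTerm 0 ω = 0 := fun ω ↦ by simp [zetaTerm]
  simp [torsEis, weightOne, latticeVec, this]

lemma torsEis_slash (x y : ZMod N) (γ : SL(2, ℤ)) :
    torsEis N x y ∣[(1 : ℤ)] γ
      = torsEis N (x * (γ 0 0 : ℤ) + y * (γ 1 0 : ℤ)) (x * (γ 0 1 : ℤ) + y * (γ 1 1 : ℤ)) := by
  have hdet : ((γ 0 0 : ℤ) : ZMod N) * (γ 1 1 : ℤ) - (γ 0 1 : ℤ) * (γ 1 0 : ℤ) = 1 := by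
    have := congrArg (Int.cast : ℤ → ZMod N) (Matrix.det_fin_two γ.1 ▸ γ.2)
    simpa using this
  by_cases h : x * (γ 0 0 : ℤ) + y * (γ 1 0 : ℤ) = 0 ∧ x * (γ 0 1 : ℤ) + y * (γ 1 1 : ℤ) = 0
  · have hx : x = 0 := by
      linear_combination (γ 1 1 : ℤ) * h.1 - (γ 1 0 : ℤ) * h.2 - x * hdet
    have hy : y = 0 := by
      linear_combination (γ 0 0 : ℤ) * h.2 - (γ 0 1 : ℤ) * h.1 - y * hdet
    simp [hx, hy, torsEis_zero]
  · rw [torsEis, weightOne_slash, torsEis]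
    refine weightOne_congr (NeZero.pos N) (by
      simp only [Matrix.cons_val_zero, Matrix.cons_val_one, intCast_dvd_val_iff]
      exact h) fun i ↦ ?_
    rw [← ZMod.intCast_eq_intCast_iff]
    fin_cases i <;> simp [Matrix.vecMul, dotProduct, Fin.sum_univ_two]

variable (N) in
/-- The value at infinity of `torsEis N x y`. -/
def torsConst (x y : ZMod N) : ℂ := if x = 0 then cotSum N y else sawtooth N x

lemma tendsto_torsEis (x y : ZMod N) :
    Tendsto (torsEis N x y) atImInfty (𝓝 (torsConst N x y)) := by
  by_cases h : x = 0 ∧ y = 0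
  · rw [h.1, h.2, torsEis_zero, torsConst, if_pos rfl, cotSum_zero]
    exact tendsto_const_nhds
  · have hc : torsConst N x y = weightOneConst N ![(x.val : ℤ), (y.val : ℤ)] := by
      rw [torsConst]
      split_ifs with hx
      · rw [weightOneConst_of_dvd (by
          simp only [Matrix.cons_val_zero, intCast_dvd_val_iff]; exact hx)]
        · simp
        · simp only [Matrix.cons_val_zero, Matrix.cons_val_one, intCast_dvd_val_iff]
          exact fun hy ↦ h ⟨hx, hy⟩
      · rw [weightOneConst_of_not_dvd (by
          simp only [Matrix.cons_val_zero, intCast_dvd_val_iff]; exact hx)]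
        simp
    rw [hc]
    exact tendsto_weightOne (by
      simp only [Matrix.cons_val_zero, Matrix.cons_val_one, intCast_dvd_val_iff]; exact h)

variable (N) in
/-- The function `z ↦ torsEis N t 0 (m z)`. -/
def eisMul (m : ℕ) [NeZero m] (t : ZMod N) : ℍ → ℂ := torsEis N t 0 ∣[(1 : ℤ)] tri m 1 0

lemma eisMul_slash {m α δ : ℕ} [NeZero m] [NeZero α] [NeZero δ] {k : ℤ} {γ γ' : SL(2, ℤ)}
    (h : !![(m : ℤ), 0; 0, (1 : ℕ)] * (γ : Matrix (Fin 2) (Fin 2) ℤ)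
      = (γ' : Matrix (Fin 2) (Fin 2) ℤ) * !![(α : ℤ), k; 0, δ]) (t : ZMod N) :
    eisMul N m t ∣[(1 : ℤ)] γ
      = torsEis N (t * (γ' 0 0 : ℤ)) (t * (γ' 0 1 : ℤ)) ∣[(1 : ℤ)] tri α δ k := by
  rw [eisMul, slash_tri_slash h, torsEis_slash]; simp

lemma tendsto_eisMul_slash {m α δ : ℕ} [NeZero m] [NeZero α] [NeZero δ] {k : ℤ} {γ γ' : SL(2, ℤ)}
    (h : !![(m : ℤ), 0; 0, (1 : ℕ)] * (γ : Matrix (Fin 2) (Fin 2) ℤ)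
      = (γ' : Matrix (Fin 2) (Fin 2) ℤ) * !![(α : ℤ), k; 0, δ]) (t : ZMod N) :
    Tendsto (eisMul N m t ∣[(1 : ℤ)] γ) atImInfty
      (𝓝 ((δ : ℂ)⁻¹ * torsConst N (t * (γ' 0 0 : ℤ)) (t * (γ' 0 1 : ℤ)))) := by
  rw [eisMul_slash h]
  exact tendsto_slash_one_tri (tendsto_torsEis _ _)

lemma det_eq_one (γ : SL(2, ℤ)) : γ 0 0 * γ 1 1 - γ 0 1 * γ 1 0 = 1 := by
  have := γ.2
  rwa [Matrix.det_fin_two] at this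

lemma exists_eisMul_matrix_of_dvd {m : ℕ} (γ : SL(2, ℤ)) (h : (m : ℤ) ∣ γ 1 0) :
    ∃ γ' : SL(2, ℤ), γ' 0 0 = γ 0 0 ∧ γ' 0 1 = m * γ 0 1 ∧
      !![(m : ℤ), 0; 0, (1 : ℕ)] * (γ : Matrix (Fin 2) (Fin 2) ℤ)
      = (γ' : Matrix (Fin 2) (Fin 2) ℤ) * !![(m : ℤ), 0; 0, (1 : ℕ)] := by
  obtain ⟨c, hc⟩ := h
  have hd := det_eq_one γ
  refine ⟨⟨!![γ 0 0, m * γ 0 1; c, γ 1 1], ?_⟩, rfl, rfl, ?_⟩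
  · rw [Matrix.det_fin_two_of]; rw [hc] at hd; linear_combination hd
  · ext i j
    fin_cases i <;> fin_cases j <;>
      simp [Matrix.mul_apply, Fin.sum_univ_two, hc, mul_comm]

/-- The matrix decomposition at a cusp whose denominator `C = α c` satisfies
`gcd(m, C) = α` and `m = α δ`. -/
lemma exists_eisMul_matrix {m α δ : ℕ} (hm : m = α * δ) (γ : SL(2, ℤ)) {c : ℤ}
    (hc : γ 1 0 = α * c) (hcδ : IsCoprime c (δ : ℤ)) :
    ∃ (γ' : SL(2, ℤ)) (k : ℤ), γ' 0 0 = δ * γ 0 0 ∧ (∃ d, c * γ' 0 1 = -1 + δ * d) ∧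
      !![(m : ℤ), 0; 0, (1 : ℕ)] * (γ : Matrix (Fin 2) (Fin 2) ℤ)
      = (γ' : Matrix (Fin 2) (Fin 2) ℤ) * !![(α : ℤ), k; 0, δ] := by
  obtain ⟨u, w, huw⟩ := hcδ
  have hd := det_eq_one γ
  refine ⟨⟨!![δ * γ 0 0, α * γ 0 1 - γ 0 0 * (u * γ 1 1); c, w * γ 1 1], ?_⟩, u * γ 1 1, rfl,
    ⟨w * γ 0 0 * γ 1 1, ?_⟩, ?_⟩
  · rw [Matrix.det_fin_two_of]
    rw [hc] at hd
    linear_combination hd + (γ 0 0 * γ 1 1) * huw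
  · change c * (α * γ 0 1 - γ 0 0 * (u * γ 1 1)) = _
    rw [hc] at hd
    linear_combination (-1 : ℤ) * hd - (γ 0 0 * γ 1 1) * huw
  · ext i j
    fin_cases i <;> fin_cases j
    · simp [Matrix.mul_apply, Fin.sum_univ_two, hm]; ring
    · simp [Matrix.mul_apply, Fin.sum_univ_two, hm]; ring
    · simp [Matrix.mul_apply, Fin.sum_univ_two, hc]; ring
    · simp [Matrix.mul_apply, Fin.sum_univ_two]
      linear_combination (-γ 1 1) * huw

end TorsionEisenstein

noncomputable section ProductForm

open UpperHalfPlane Filter Topology ModularForm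
open scoped Matrix MatrixGroups

variable (N : ℕ) [Fact N.Prime]

/-- The sum over `t` of the products of weight one Eisenstein series
`torsEis N t 0 (N z) * torsEis N t 0 (N² z)`. -/
def prodEis : ℍ → ℂ := ∑ t : ZMod N, eisMul N N t * eisMul N (N ^ 2) t

/-- The value of `prodEis` at the irregular cusps. -/
def midConst (x : ZMod N) : ℂ := (N : ℂ)⁻¹ * ∑ u, sawtooth N (u * x) * cotSum N (-u)

variable {N}

lemma midConst_neg (x : ZMod N) : midConst N (-x) = -midConst N x := by
  simp only [midConst, mul_neg, sawtooth_neg, neg_mul, Finset.sum_neg_distrib]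

lemma prodEis_slash_eq (γ : SL(2, ℤ)) : prodEis N ∣[(2 : ℤ)] γ
    = ∑ t : ZMod N, (eisMul N N t ∣[(1 : ℤ)] γ) * (eisMul N (N ^ 2) t ∣[(1 : ℤ)] γ) := by
  rw [prodEis, SlashAction.sum_slash]
  exact Finset.sum_congr rfl fun t _ ↦ mul_slash_SL2 1 1 γ _ _

lemma unit_of_sq_dvd {γ : SL(2, ℤ)} (h : (N : ℤ) ∣ γ 1 0) : ((γ 0 0 : ℤ) : ZMod N) ≠ 0 := by
  intro h0
  have := congrArg (Int.cast : ℤ → ZMod N) (det_eq_one γ)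
  have h1 : ((γ 1 0 : ℤ) : ZMod N) = 0 := by rwa [ZMod.intCast_zmod_eq_zero_iff_dvd]
  push_cast at this
  rw [h0, h1] at this
  simp at this

lemma sum_units_mul {M : Type*} [AddCommMonoid M] (f : ZMod N → M) {a : ZMod N} (ha : a ≠ 0) :
    ∑ t, f (t * a) = ∑ t, f t :=
  Fintype.sum_equiv (Equiv.mulRight₀ a ha) _ _ fun _ ↦ rfl

lemma prodEis_slash {γ : SL(2, ℤ)} (h : (N : ℤ) ^ 2 ∣ γ 1 0) :
    prodEis N ∣[(2 : ℤ)] γ = prodEis N := by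
  have h1 : (N : ℤ) ∣ γ 1 0 := (Dvd.intro_left _ (sq (N : ℤ)).symm).trans h
  rw [prodEis_slash_eq, prodEis,
    ← sum_units_mul (fun t ↦ eisMul N N t * eisMul N (N ^ 2) t) (unit_of_sq_dvd h1)]
  refine Finset.sum_congr rfl fun t _ ↦ ?_
  obtain ⟨γ₁, ha₁, hb₁, e₁⟩ := exists_eisMul_matrix_of_dvd γ h1
  obtain ⟨γ₂, ha₂, hb₂, e₂⟩ := exists_eisMul_matrix_of_dvd (m := N ^ 2) γ (by exact_mod_cast h)
  rw [eisMul_slash e₁, eisMul_slash e₂, ha₁, hb₁, ha₂, hb₂, eisMul, eisMul]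
  simp

lemma tendsto_prodEis_of_sq_dvd {γ : SL(2, ℤ)} (h : (N : ℤ) ^ 2 ∣ γ 1 0) :
    Tendsto (prodEis N ∣[(2 : ℤ)] γ) atImInfty (𝓝 (∑ t, sawtooth N t ^ 2)) := by
  have h1 : (N : ℤ) ∣ γ 1 0 := (Dvd.intro_left _ (sq (N : ℤ)).symm).trans h
  have h0 := unit_of_sq_dvd h1
  rw [prodEis_slash_eq, ← sum_units_mul (fun t ↦ sawtooth N t ^ 2) h0]
  obtain ⟨γ₁, ha₁, hb₁, e₁⟩ := exists_eisMul_matrix_of_dvd γ h1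
  obtain ⟨γ₂, ha₂, hb₂, e₂⟩ := exists_eisMul_matrix_of_dvd (m := N ^ 2) γ (by exact_mod_cast h)
  have key : Tendsto (fun z ↦ ∑ t : ZMod N,
      (eisMul N N t ∣[(1 : ℤ)] γ) z * (eisMul N (N ^ 2) t ∣[(1 : ℤ)] γ) z) atImInfty
      (𝓝 (∑ t, sawtooth N (t * (γ 0 0 : ℤ)) ^ 2)) := by
    refine tendsto_finsetSum _ fun t _ ↦ ?_
    convert! (tendsto_eisMul_slash e₁ t).mul (tendsto_eisMul_slash e₂ t) using 2
    have : torsConst N (t * (γ 0 0 : ℤ)) 0 = sawtooth N (t * (γ 0 0 : ℤ)) := by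
      rw [torsConst]; split_ifs with h
      · rw [h, cotSum_zero]; simp [sawtooth]
      · rfl
    rw [ha₁, hb₁, ha₂, hb₂]
    simp [this, sq]
  exact key.congr fun z ↦ by simp

lemma isCoprime_pow_of_not_dvd {c : ℤ} (h : ¬ (N : ℤ) ∣ c) (n : ℕ) :
    IsCoprime c ((N ^ n : ℕ) : ℤ) := by
  push_cast
  exact (((Nat.prime_iff_prime_int.1 Fact.out).coprime_iff_not_dvd).2 h).symm.pow_right

lemma tendsto_eisMul_slash_of_not_dvd {m α δ : ℕ} [NeZero m] [NeZero α] [NeZero δ]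
    (hm : m = α * δ) {γ : SL(2, ℤ)} {c : ℤ} (hc : γ 1 0 = α * c) (hcN : ¬ (N : ℤ) ∣ c)
    {n : ℕ} (hδ : δ = N ^ (n + 1)) (t : ZMod N) :
    Tendsto (eisMul N m t ∣[(1 : ℤ)] γ) atImInfty
      (𝓝 ((δ : ℂ)⁻¹ * cotSum N (-(t * (c : ZMod N)⁻¹)))) := by
  have hcop : IsCoprime c (δ : ℤ) := hδ ▸ isCoprime_pow_of_not_dvd hcN (n + 1)
  obtain ⟨γ', k, h0, ⟨d, hd⟩, e⟩ := exists_eisMul_matrix hm γ hc hcop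
  convert! tendsto_eisMul_slash e t using 3
  have hδ0 : ((δ : ℕ) : ZMod N) = 0 := by rw [hδ]; simp
  have hc0 : (c : ZMod N) ≠ 0 := by rwa [Ne, ZMod.intCast_zmod_eq_zero_iff_dvd]
  have h2 : ((γ' 0 0 : ℤ) : ZMod N) = 0 := by rw [h0]; simp [hδ0]
  have h3 : ((γ' 0 1 : ℤ) : ZMod N) = -(c : ZMod N)⁻¹ := by
    have := congrArg (Int.cast : ℤ → ZMod N) hd
    push_cast at this
    rw [hδ0] at this
    apply mul_left_cancel₀ hc0
    rw [this, mul_neg, mul_inv_cancel₀ hc0]; ring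
  rw [h2, h3, torsConst, mul_zero, if_pos rfl, mul_neg]

lemma tendsto_prodEis_of_not_dvd {γ : SL(2, ℤ)} (h : ¬ (N : ℤ) ∣ γ 1 0) :
    Tendsto (prodEis N ∣[(2 : ℤ)] γ) atImInfty (𝓝 (-(∑ t, sawtooth N t ^ 2) / N ^ 2)) := by
  have hN : (N : ℂ) ≠ 0 := NeZero.ne _
  have hc0 : -((γ 1 0 : ℤ) : ZMod N)⁻¹ ≠ 0 := by
    simpa [ZMod.intCast_zmod_eq_zero_iff_dvd] using h
  have e : -(∑ t, sawtooth N t ^ 2) / N ^ 2 = ∑ t : ZMod N, ((N : ℂ)⁻¹ *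
      cotSum N (-(t * ((γ 1 0 : ℤ) : ZMod N)⁻¹))) * (((N ^ 2 : ℕ) : ℂ)⁻¹ *
      cotSum N (-(t * ((γ 1 0 : ℤ) : ZMod N)⁻¹))) := by
    have h2 := sum_cotSum_sq (N := N)
    rw [← sum_units_mul _ hc0] at h2
    simp only [mul_neg] at h2
    have h3 : ∑ t, sawtooth N t ^ 2
        = (-N : ℂ)⁻¹ * ∑ t, cotSum N (-(t * ((γ 1 0 : ℤ) : ZMod N)⁻¹)) ^ 2 := by
      rw [h2]; field_simp
    rw [h3, Finset.mul_sum, ← Finset.sum_neg_distrib, Finset.sum_div]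
    refine Finset.sum_congr rfl fun t _ ↦ ?_
    push_cast; field_simp
  rw [prodEis_slash_eq, e]
  have key := tendsto_finsetSum (Finset.univ : Finset (ZMod N)) fun t _ ↦
    (tendsto_eisMul_slash_of_not_dvd (γ := γ) (m := N) (α := 1) (one_mul _).symm (c := γ 1 0)
      (by simp) h (n := 0)
      (by simp) t).mul
    (tendsto_eisMul_slash_of_not_dvd (γ := γ) (m := N ^ 2) (α := 1) (one_mul _).symm (c := γ 1 0)
      (by simp) h (n := 1)
      (by simp) t)
  exact key.congr fun z ↦ by simp

lemma tendsto_prodEis_of_eq_mul {γ : SL(2, ℤ)} {c : ℤ} (hc : γ 1 0 = N * c)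
    (h : ¬ (N : ℤ) ∣ c) :
    Tendsto (prodEis N ∣[(2 : ℤ)] γ) atImInfty (𝓝 (midConst N (γ 0 0 * c : ℤ))) := by
  have hN : (N : ℂ) ≠ 0 := NeZero.ne _
  have hc0 : (c : ZMod N) ≠ 0 := by
    simpa [ZMod.intCast_zmod_eq_zero_iff_dvd] using h
  obtain ⟨γ₁, ha₁, hb₁, e₁⟩ := exists_eisMul_matrix_of_dvd γ (Dvd.intro _ hc.symm)
  have key := tendsto_finsetSum (Finset.univ : Finset (ZMod N)) fun t _ ↦
    (tendsto_eisMul_slash e₁ t).mul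
    (tendsto_eisMul_slash_of_not_dvd (γ := γ) (m := N ^ 2) (α := N) (sq N) hc h (n := 0)
      (by simp) t)
  rw [prodEis_slash_eq]
  have e : midConst N (γ 0 0 * c : ℤ) = ∑ t : ZMod N, (((1 : ℕ) : ℂ)⁻¹ *
      torsConst N (t * (γ₁ 0 0 : ℤ)) (t * (γ₁ 0 1 : ℤ))) *
      ((N : ℂ)⁻¹ * cotSum N (-(t * (c : ZMod N)⁻¹))) := by
    rw [midConst, ← sum_units_mul _ (inv_ne_zero hc0), Finset.mul_sum]
    refine Finset.sum_congr rfl fun t _ ↦ ?_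
    have : torsConst N (t * (γ 0 0 : ℤ)) 0 = sawtooth N (t * (γ 0 0 : ℤ)) := by
      rw [torsConst]; split_ifs with h
      · rw [h, cotSum_zero]; simp [sawtooth]
      · rfl
    rw [ha₁, hb₁]
    push_cast
    rw [CharP.cast_eq_zero (ZMod N) N, zero_mul, mul_zero, this,
      show t * (c : ZMod N)⁻¹ * ((γ 0 0 : ℤ) * c) = t * (γ 0 0 : ℤ) by field_simp]
    ring
  rw [e]
  exact key.congr fun z ↦ by simp

lemma exists_hasQSeries_torsEis (t : ZMod N) :
    ∃ b : ℕ → ℤ, HasQSeries (fun n ↦ (b n : ℂ)) ((2 * N : ℂ) • eisMul N N t) := by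
  have hN : (N : ℂ) ≠ 0 := NeZero.ne _
  by_cases ht : t = 0
  · refine ⟨0, ?_⟩
    have : eisMul N N t = 0 := by rw [ht, eisMul, torsEis_zero, SlashAction.zero_slash]
    rw [this, smul_zero]
    simpa using! HasQSeries.zero
  · have hv : ¬ (N : ℤ) ∣ (![(t.val : ℤ), 0] : Fin 2 → ℤ) 0 := by
      simp only [Matrix.cons_val_zero, intCast_dvd_val_iff]; exact ht
    obtain ⟨A, hA, hA0, hA1⟩ := exists_hasQSeries_weightOne (NeZero.pos N)
      (v := ![(t.val : ℤ), 0]) (fun h ↦ hv h.1)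
      (G := eisMul N N t) fun z w hw ↦ by
        rw [eisMul, slash_one_tri_apply, torsEis]
        simp only [ZMod.val_zero, Nat.cast_zero, Nat.cast_one, inv_one, one_mul]
        congr 1; ext1; rw [coe_tri_smul, hw]; simp
    have h : ∀ n, ∃ b : ℤ, (b : ℂ) = 2 * N * A n := fun n ↦ by
      rcases eq_or_ne n 0 with rfl | hn
      · refine ⟨2 * t.val - N, ?_⟩
        rw [hA0, weightOneConst_of_not_dvd hv, sawtooth, if_neg]
        · simp; field_simp
        · simpa using ht
      · obtain ⟨k, hk⟩ := hA1 (by simp) n hn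
        exact ⟨2 * N * k, by rw [← hk]; push_cast; ring⟩
    choose b hb using h
    refine ⟨b, ?_⟩
    rw [show (fun n ↦ (b n : ℂ)) = (2 * N : ℂ) • A from funext fun n ↦ hb n]
    exact hA.const_mul _

lemma exists_hasQSeries_prodEis :
    ∃ b : ℕ → ℤ, HasQSeries (fun n ↦ (b n : ℂ)) ((4 * N ^ 2 : ℂ) • prodEis N) := by
  choose b hb using exists_hasQSeries_torsEis (N := N)
  have hN : 0 < N := NeZero.pos N
  have h2 (t : ZMod N) := (hb t).dilate hN (G := (2 * N : ℂ) • eisMul N (N ^ 2) t)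
    fun z w hw ↦ by
      simp only [Pi.smul_apply, eisMul, slash_one_tri_apply]
      congr 3; ext1; simp only [coe_tri_smul, hw]; push_cast; ring
  have h3 := HasQSeries.sum Finset.univ fun t _ ↦ (hb t).mul (h2 t)
  refine ⟨fun n ↦ ∑ t, ∑ x ∈ Finset.HasAntidiagonal.antidiagonal n,
    b t x.1 * if N ∣ x.2 then b t (x.2 / N) else 0, ?_⟩
  convert! h3 using 1
  · ext n
    simp only [Finset.sum_apply]
    push_cast
    rfl
  · ext z
    simp only [prodEis, Pi.smul_apply, Finset.sum_apply, Pi.mul_apply, Finset.mul_sum, smul_eq_mul]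
    refine Finset.sum_congr rfl fun t _ ↦ ?_
    ring

end ProductForm

noncomputable section HeckeMatrices

open UpperHalfPlane Filter Topology ModularForm
open scoped Matrix MatrixGroups

/-- Upper left entries of the standard representatives of integral matrices of determinant `ℓ`. -/
def heckeα {ℓ : ℕ} (i : Option (Fin ℓ)) : ℕ := i.elim ℓ fun _ ↦ 1

/-- Lower right entries of the standard representatives of integral matrices of determinant `ℓ`. -/
def heckeδ {ℓ : ℕ} (i : Option (Fin ℓ)) : ℕ := i.elim 1 fun _ ↦ ℓ

/-- Upper right entries of the standard representatives of integral matrices of determinant `ℓ`. -/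
def heckeκ {ℓ : ℕ} (i : Option (Fin ℓ)) : ℤ := i.elim 0 fun j ↦ (j : ℕ)

/-- The standard representatives of integral matrices of determinant `ℓ`. -/
def heckeMat {ℓ : ℕ} (i : Option (Fin ℓ)) : Matrix (Fin 2) (Fin 2) ℤ :=
  !![(heckeα i : ℤ), heckeκ i; 0, heckeδ i]

variable {ℓ : ℕ}

instance [NeZero ℓ] (i : Option (Fin ℓ)) : NeZero (heckeα i) := by
  cases i
  · exact inferInstanceAs (NeZero ℓ)
  · exact inferInstanceAs (NeZero 1)

instance [NeZero ℓ] (i : Option (Fin ℓ)) : NeZero (heckeδ i) := by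
  cases i
  · exact inferInstanceAs (NeZero 1)
  · exact inferInstanceAs (NeZero ℓ)

lemma heckeα_mul_heckeδ (i : Option (Fin ℓ)) : heckeα i * heckeδ i = ℓ := by
  cases i <;> simp [heckeα, heckeδ]

lemma det_heckeMat (i : Option (Fin ℓ)) : (heckeMat i).det = ℓ := by
  rw [heckeMat, Matrix.det_fin_two_of]
  have := heckeα_mul_heckeδ i
  push_cast [← this]
  ring

lemma exists_eq_mul_heckeMat (hℓ : ℓ.Prime) (P : Matrix (Fin 2) (Fin 2) ℤ) (hP : P.det = ℓ) :
    ∃ (i : Option (Fin ℓ)) (γ : SL(2, ℤ)), P = (γ : Matrix (Fin 2) (Fin 2) ℤ) * heckeMat i := by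
  have hℓ0 : (ℓ : ℤ) ≠ 0 := by exact_mod_cast hℓ.ne_zero
  rw [Matrix.det_fin_two] at hP
  by_cases h : (ℓ : ℤ) ∣ P 0 0 ∧ (ℓ : ℤ) ∣ P 1 0
  · obtain ⟨⟨a, ha⟩, c, hc⟩ := h
    refine ⟨none, ⟨!![a, P 0 1; c, P 1 1], ?_⟩, ?_⟩
    · rw [Matrix.det_fin_two_of]
      rw [ha, hc] at hP
      apply mul_left_cancel₀ hℓ0
      linear_combination hP
    · ext i j
      fin_cases i <;> fin_cases j <;>
        simp [heckeMat, heckeα, heckeδ, heckeκ, Matrix.mul_apply, Fin.sum_univ_two, ha, hc,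
          mul_comm]
  · have : Fact ℓ.Prime := ⟨hℓ⟩
    have hP' := congrArg (Int.cast : ℤ → ZMod ℓ) hP
    push_cast at hP'
    rw [CharP.cast_eq_zero (ZMod ℓ) ℓ] at hP'
    obtain ⟨j, hj⟩ : ∃ j : ZMod ℓ, (P 0 1 : ZMod ℓ) = j * P 0 0 ∧ (P 1 1 : ZMod ℓ) = j * P 1 0 := by
      rw [← ZMod.intCast_zmod_eq_zero_iff_dvd, ← ZMod.intCast_zmod_eq_zero_iff_dvd] at h
      by_cases h0 : (P 0 0 : ZMod ℓ) = 0
      · have h1 : (P 1 0 : ZMod ℓ) ≠ 0 := fun h1 ↦ h ⟨h0, h1⟩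
        rw [h0, zero_mul, zero_sub, neg_eq_zero, mul_eq_zero, or_iff_left h1] at hP'
        exact ⟨P 1 1 / P 1 0, by simp [h0, hP'], by field_simp⟩
      · refine ⟨P 0 1 / P 0 0, by field_simp, ?_⟩
        field_simp
        linear_combination hP'
    have hd : ∀ r, (P r 1 : ZMod ℓ) = j * P r 0 → ∃ b, P r 1 - j.val * P r 0 = ℓ * b :=
      fun r hr ↦ by
        refine (ZMod.intCast_zmod_eq_zero_iff_dvd _ _).1 ?_
        push_cast
        rw [hr, ZMod.natCast_zmod_val, sub_self]
    obtain ⟨b, hb⟩ := hd 0 hj.1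
    obtain ⟨d, hd⟩ := hd 1 hj.2
    refine ⟨some ⟨j.val, j.val_lt⟩, ⟨!![P 0 0, b; P 1 0, d], ?_⟩, ?_⟩
    · rw [Matrix.det_fin_two_of]
      apply mul_left_cancel₀ hℓ0
      linear_combination hP - P 0 0 * hd + P 1 0 * hb
    · ext r s
      fin_cases r <;> fin_cases s
      · simp [heckeMat, heckeα, Matrix.mul_apply, Fin.sum_univ_two]
      · simp [heckeMat, heckeδ, heckeκ, Matrix.mul_apply, Fin.sum_univ_two, -ZMod.natCast_val]
        linear_combination hb
      · simp [heckeMat, heckeα, Matrix.mul_apply, Fin.sum_univ_two]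
      · simp [heckeMat, heckeδ, heckeκ, Matrix.mul_apply, Fin.sum_univ_two, -ZMod.natCast_val]
        linear_combination hd

lemma eq_of_heckeMat_eq_mul (hℓ : ℓ.Prime) {i j : Option (Fin ℓ)} {γ : SL(2, ℤ)}
    (h : heckeMat i = (γ : Matrix (Fin 2) (Fin 2) ℤ) * heckeMat j) : i = j := by
  have hu : ∀ x : ℤ, (ℓ : ℤ) * x ≠ 1 := fun x hx ↦
    (Nat.prime_iff_prime_int.1 hℓ).not_isUnit (IsUnit.of_mul_eq_one _ hx)
  have h00 := congrFun (congrFun h 0) 0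
  have h01 := congrFun (congrFun h 0) 1
  have h10 := congrFun (congrFun h 1) 0
  have h11 := congrFun (congrFun h 1) 1
  simp only [heckeMat, Matrix.mul_apply, Fin.sum_univ_two, Matrix.of_apply, Matrix.cons_val',
    Matrix.cons_val_zero, Matrix.cons_val_one, Matrix.cons_val_fin_one] at h00 h01 h10 h11
  rcases i with _ | a <;> rcases j with _ | b
  · rfl
  · simp [heckeα, heckeδ, heckeκ] at h00 h01 h10 h11
    rw [← h10] at h11
    exact absurd (by linear_combination -h11) (hu (γ 1 1))
  · simp [heckeα, heckeδ, heckeκ] at h00 h01 h10 h11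
    exact absurd (by linear_combination -h00) (hu (γ 0 0))
  · simp [heckeα, heckeδ, heckeκ] at h00 h01 h10 h11
    rw [← h00] at h01
    have h2 : ((a : ℕ) : ℤ) ≡ (b : ℕ) [ZMOD ℓ] := (Int.modEq_iff_dvd.2 ⟨γ 0 1, by
      linear_combination h01⟩).symm
    have h3 := Nat.ModEq.eq_of_lt_of_lt (Int.natCast_modEq_iff.1 h2) a.2 b.2
    rw [Fin.ext h3]

lemma exists_perm_heckeMat_mul (hℓ : ℓ.Prime) (γ : SL(2, ℤ)) :
    ∃ (e : Equiv.Perm (Option (Fin ℓ))) (g : Option (Fin ℓ) → SL(2, ℤ)), ∀ i,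
      heckeMat i * (γ : Matrix (Fin 2) (Fin 2) ℤ)
        = (g i : Matrix (Fin 2) (Fin 2) ℤ) * heckeMat (e i) := by
  have h (i : Option (Fin ℓ)) := exists_eq_mul_heckeMat hℓ (heckeMat i * γ.1) (by
    rw [Matrix.det_mul, det_heckeMat, γ.2, mul_one])
  choose e g hg using h
  have hinj : Function.Injective e := fun i j hij ↦ by
    refine eq_of_heckeMat_eq_mul hℓ (γ := g i * (g j)⁻¹) ?_
    have h1 : heckeMat i = ((g i).1 * heckeMat (e i)) * (γ⁻¹).1 := by
      rw [← hg i, mul_assoc, ← Matrix.SpecialLinearGroup.coe_mul, mul_inv_cancel]; simp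
    have h2 : heckeMat (e j) = ((g j)⁻¹).1 * (heckeMat j * γ.1) := by
      rw [hg j, ← mul_assoc, ← Matrix.SpecialLinearGroup.coe_mul, inv_mul_cancel]; simp
    rw [h1, hij, h2, Matrix.SpecialLinearGroup.coe_mul]
    simp only [mul_assoc]
    rw [← Matrix.SpecialLinearGroup.coe_mul γ, mul_inv_cancel]; simp
  exact ⟨Equiv.ofBijective e hinj.bijective_of_finite, g, hg⟩

end HeckeMatrices

noncomputable section HeckeOperator

open UpperHalfPlane Filter Topology ModularForm
open scoped Matrix MatrixGroups

variable (N ℓ : ℕ) [NeZero ℓ]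

/-- The representatives entering the Hecke operator at `ℓ`; for `ℓ = N` one is omitted. -/
def heckeIdx (N ℓ : ℕ) : Finset (Option (Fin ℓ)) :=
  if ℓ = N then Finset.univ.erase none else Finset.univ

/-- The Hecke operator of weight two on functions on the upper half plane. -/
def hecke (F : ℍ → ℂ) : ℍ → ℂ :=
  ∑ i ∈ heckeIdx N ℓ, F ∣[(2 : ℤ)] tri (heckeα i) (heckeδ i) (heckeκ i)

/-- The coefficient of the Hecke polynomial. -/
def heckeε (N ℓ : ℕ) : ℂ := if ℓ = N then 0 else ℓ

/-- The Hecke operator on coefficient sequences. -/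
def heckeSeq (N ℓ : ℕ) (a : ℕ → ℂ) (n : ℕ) : ℂ :=
  a (ℓ * n) + if ℓ ∣ n then heckeε N ℓ * a (n / ℓ) else 0

variable {N ℓ}

lemma tri_some_slash (F : ℍ → ℂ) (z : ℍ) :
    ∑ j : Fin ℓ, (F ∣[(2 : ℤ)] tri (heckeα (some j)) (heckeδ (some j)) (heckeκ (some j))) z
      = (ℓ : ℂ)⁻¹ * ∑ j : Fin ℓ, F (tri 1 ℓ (j : ℕ) • z) := by
  rw [Finset.mul_sum]
  refine Finset.sum_congr rfl fun j _ ↦ ?_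
  change (F ∣[(2 : ℤ)] tri 1 ℓ (j : ℕ)) z = _
  rw [slash_two_tri_apply]; simp

lemma tri_none_slash (F : ℍ → ℂ) :
    F ∣[(2 : ℤ)] tri (heckeα (none : Option (Fin ℓ))) (heckeδ (none : Option (Fin ℓ)))
      (heckeκ (none : Option (Fin ℓ))) = F ∣[(2 : ℤ)] tri ℓ 1 0 := rfl

lemma hecke_apply (F : ℍ → ℂ) (z : ℍ) :
    hecke N ℓ F z = (ℓ : ℂ)⁻¹ * ∑ j : Fin ℓ, F (tri 1 ℓ (j : ℕ) • z)
      + heckeε N ℓ * F (tri ℓ 1 0 • z) := by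
  rw [hecke, Finset.sum_apply, heckeε, heckeIdx, ← tri_some_slash]
  split_ifs with h
  · rw [Finset.sum_erase_eq_sub (Finset.mem_univ _), Fintype.sum_option]; simp
  · rw [Fintype.sum_option, tri_none_slash, slash_two_tri_apply]; simp [add_comm]

lemma HasQSeries.hecke {a : ℕ → ℂ} {F : ℍ → ℂ} (h : HasQSeries a F) :
    HasQSeries (heckeSeq N ℓ a) (hecke N ℓ F) := by
  have hℓ := NeZero.pos ℓ
  have h1 := h.average hℓ (G := fun z ↦ (ℓ : ℂ)⁻¹ * ∑ j : Fin ℓ, F (tri 1 ℓ (j : ℕ) • z))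
    fun z w hw ↦ by
      congr 1
      refine Finset.sum_congr rfl fun j _ ↦ ?_
      congr 1; ext1; rw [coe_tri_smul, hw]; simp
  have h2 := (h.dilate hℓ (G := fun z ↦ F (tri ℓ 1 0 • z)) fun z w hw ↦ by
    congr 1; ext1; rw [coe_tri_smul, hw]; simp).const_mul (heckeε N ℓ)
  convert! h1.add h2 using 1
  · ext n
    simp [heckeSeq]
  · ext z
    rw [hecke_apply]; rfl

lemma hecke_smul (c : ℂ) (F : ℍ → ℂ) : _root_.hecke N ℓ (c • F) = c • hecke N ℓ F := by
  ext z
  simp only [hecke_apply, Pi.smul_apply, smul_eq_mul, ← Finset.mul_sum]; ring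

omit [NeZero ℓ] in
/-- The entries of a matrix identity `β γ = γ' β'` between Hecke representatives. -/
lemma heckeMat_mul_entries {i j : Option (Fin ℓ)} {γ γ' : SL(2, ℤ)}
    (h : heckeMat i * (γ : Matrix (Fin 2) (Fin 2) ℤ)
      = (γ' : Matrix (Fin 2) (Fin 2) ℤ) * heckeMat j) :
    heckeα i * γ 0 0 + heckeκ i * γ 1 0 = γ' 0 0 * heckeα j ∧
    heckeδ i * γ 1 0 = γ' 1 0 * heckeα j := by
  have h00 := congrFun (congrFun h 0) 0
  have h10 := congrFun (congrFun h 1) 0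
  simpa [heckeMat, Matrix.mul_apply, Fin.sum_univ_two] using And.intro h00 h10

lemma hecke_slash_eq {γ : SL(2, ℤ)} {e : Equiv.Perm (Option (Fin ℓ))}
    {g : Option (Fin ℓ) → SL(2, ℤ)} (hg : ∀ i, heckeMat i * (γ : Matrix (Fin 2) (Fin 2) ℤ)
        = (g i : Matrix (Fin 2) (Fin 2) ℤ) * heckeMat (e i)) (F : ℍ → ℂ) :
    hecke N ℓ F ∣[(2 : ℤ)] γ = ∑ i ∈ heckeIdx N ℓ, (F ∣[(2 : ℤ)] g i) ∣[(2 : ℤ)]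
      tri (heckeα (e i)) (heckeδ (e i)) (heckeκ (e i)) := by
  rw [hecke, SlashAction.sum_slash]
  exact Finset.sum_congr rfl fun i _ ↦ slash_tri_slash (hg i) 2 F

omit [NeZero ℓ] in
lemma heckeα_eq (i : Option (Fin ℓ)) : i = none ∧ heckeα i = ℓ ∨ i ≠ none ∧ heckeα i = 1 := by
  cases i <;> simp [heckeα]

lemma hecke_slash (hN : N.Prime) (hℓ : ℓ.Prime) {F : ℍ → ℂ}
    (hF : ∀ γ : SL(2, ℤ), (N : ℤ) ^ 2 ∣ γ 1 0 → F ∣[(2 : ℤ)] γ = F) {γ : SL(2, ℤ)}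
    (hγ : (N : ℤ) ^ 2 ∣ γ 1 0) : hecke N ℓ F ∣[(2 : ℤ)] γ = hecke N ℓ F := by
  obtain ⟨e, g, hg⟩ := exists_perm_heckeMat_mul hℓ γ
  have hNp := Nat.prime_iff_prime_int.1 hN
  have hγ1 : (N : ℤ) ∣ γ 1 0 := (Dvd.intro_left _ (sq (N : ℤ)).symm).trans hγ
  have hA : ¬ (N : ℤ) ∣ γ 0 0 := fun h ↦ hNp.not_isUnit <| isUnit_of_dvd_one <| by
    rw [← det_eq_one γ]
    exact dvd_sub (h.mul_right _) (hγ1.mul_left _)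
  have he : ∀ i ∈ heckeIdx N ℓ, (N : ℤ) ^ 2 ∣ g i 1 0 ∧ e i ∈ heckeIdx N ℓ := by
    intro i hi
    obtain ⟨h00, h10⟩ := heckeMat_mul_entries (hg i)
    by_cases hℓN : ℓ = N
    · subst hℓN
      simp only [heckeIdx, if_true, Finset.mem_erase, Finset.mem_univ, and_true] at hi ⊢
      have hi1 : heckeα i = 1 := ((heckeα_eq i).resolve_left fun h ↦ hi h.1).2
      rcases heckeα_eq (e i) with ⟨h, h'⟩ | ⟨h, h'⟩
      · exfalso
        rw [hi1, h'] at h00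
        refine hA ((dvd_add_left (hγ1.mul_left (heckeκ i))).1 ?_)
        rw [Nat.cast_one, one_mul] at h00
        rw [h00]
        exact Dvd.intro_left _ rfl
      · refine ⟨?_, h⟩
        rw [h', Nat.cast_one, mul_one] at h10
        rw [← h10]
        exact hγ.mul_left _
    · simp only [heckeIdx, hℓN, if_false, Finset.mem_univ, and_true]
      have h1 : (N : ℤ) ^ 2 ∣ g i 1 0 * heckeα (e i) := h10 ▸ hγ.mul_left _
      rcases heckeα_eq (e i) with ⟨-, h'⟩ | ⟨-, h'⟩
      · rw [h'] at h1
        refine IsCoprime.dvd_of_dvd_mul_right ?_ h1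
        exact ((Nat.isCoprime_iff_coprime.2 ((Nat.coprime_primes hN hℓ).2 (Ne.symm hℓN)))).pow_left
      · simpa [h'] using h1
  rw [hecke_slash_eq hg, hecke]
  have hmem : ∀ i, i ∈ heckeIdx N ℓ ↔ e i ∈ heckeIdx N ℓ := fun i ↦ by
    refine ⟨fun h ↦ (he i h).2, fun h ↦ ?_⟩
    have hb : (heckeIdx N ℓ).map e.toEmbedding = heckeIdx N ℓ :=
      Finset.eq_of_subset_of_card_le (fun x hx ↦ by
        obtain ⟨y, hy, rfl⟩ := Finset.mem_map.1 hx
        exact (he y hy).2) (by simp)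
    rw [← hb] at h
    simpa using h
  refine Finset.sum_equiv e hmem fun i hi ↦ ?_
  rw [hF _ (he i hi).1]

lemma tendsto_hecke_slash_zero (hℓ : ℓ.Prime) {F : ℍ → ℂ}
    (hF : ∀ γ : SL(2, ℤ), Tendsto (F ∣[(2 : ℤ)] γ) atImInfty (𝓝 0)) (γ : SL(2, ℤ)) :
    Tendsto (hecke N ℓ F ∣[(2 : ℤ)] γ) atImInfty (𝓝 0) := by
  obtain ⟨e, g, hg⟩ := exists_perm_heckeMat_mul hℓ γ
  rw [hecke_slash_eq hg]
  have h := tendsto_finsetSum (heckeIdx N ℓ) fun i _ ↦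
    tendsto_slash_two_tri (hF (g i)) (α := heckeα (e i)) (δ := heckeδ (e i)) (k := heckeκ (e i))
  simp only [mul_zero, Finset.sum_const_zero] at h
  exact h.congr fun z ↦ by simp

lemma sum_heckeα_div_heckeδ :
    ∑ i : Option (Fin ℓ), (heckeα i : ℂ) / heckeδ i = 1 + ℓ := by
  have : (ℓ : ℂ) ≠ 0 := NeZero.ne _
  rw [Fintype.sum_option]
  simp [heckeα, heckeδ]
  field_simp
  ring

/-- Cusp values of `hecke N ℓ F` for `ℓ ≡ -1 (mod N)`, when the value of `F` at irregular cusps is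
an odd function. -/
lemma tendsto_hecke_slash (hN : N.Prime) (hℓ : ℓ.Prime) (hℓN : (ℓ : ZMod N) = -1) {F : ℍ → ℂ}
    {s t : ℂ} {φ : ZMod N → ℂ} (hφ : ∀ x, φ (-x) = -φ x)
    (h1 : ∀ γ : SL(2, ℤ), (N : ℤ) ^ 2 ∣ γ 1 0 → Tendsto (F ∣[(2 : ℤ)] γ) atImInfty (𝓝 s))
    (h2 : ∀ γ : SL(2, ℤ), ¬ (N : ℤ) ∣ γ 1 0 → Tendsto (F ∣[(2 : ℤ)] γ) atImInfty (𝓝 t))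
    (h3 : ∀ (γ : SL(2, ℤ)) (c : ℤ), γ 1 0 = N * c → ¬ (N : ℤ) ∣ c →
      Tendsto (F ∣[(2 : ℤ)] γ) atImInfty (𝓝 (φ (γ 0 0 * c : ℤ)))) :
    (∀ γ : SL(2, ℤ), (N : ℤ) ^ 2 ∣ γ 1 0 →
      Tendsto (hecke N ℓ F ∣[(2 : ℤ)] γ) atImInfty (𝓝 ((1 + ℓ) * s))) ∧
    (∀ γ : SL(2, ℤ), ¬ (N : ℤ) ∣ γ 1 0 →
      Tendsto (hecke N ℓ F ∣[(2 : ℤ)] γ) atImInfty (𝓝 ((1 + ℓ) * t))) ∧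
    (∀ (γ : SL(2, ℤ)) (c : ℤ), γ 1 0 = N * c → ¬ (N : ℤ) ∣ c →
      Tendsto (hecke N ℓ F ∣[(2 : ℤ)] γ) atImInfty (𝓝 ((1 + ℓ) * -φ (γ 0 0 * c : ℤ)))) := by
  have : Fact N.Prime := ⟨hN⟩
  have hne : ℓ ≠ N := by
    rintro rfl
    rw [CharP.cast_eq_zero] at hℓN
    exact one_ne_zero (neg_eq_zero.1 hℓN.symm)
  have main : ∀ (γ : SL(2, ℤ)) (v : ℂ), (∀ (γ' : SL(2, ℤ)) (i j : Option (Fin ℓ)),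
      heckeMat i * (γ : Matrix (Fin 2) (Fin 2) ℤ) = (γ' : Matrix (Fin 2) (Fin 2) ℤ) * heckeMat j →
      Tendsto (F ∣[(2 : ℤ)] γ') atImInfty (𝓝 v)) →
      Tendsto (hecke N ℓ F ∣[(2 : ℤ)] γ) atImInfty (𝓝 ((1 + ℓ) * v)) := by
    intro γ v h
    obtain ⟨e, g, hg⟩ := exists_perm_heckeMat_mul hℓ γ
    rw [hecke_slash_eq hg]
    have h4 := tendsto_finsetSum (heckeIdx N ℓ) fun i _ ↦
      tendsto_slash_two_tri (h _ _ _ (hg i)) (α := heckeα (e i)) (δ := heckeδ (e i))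
        (k := heckeκ (e i))
    rw [← Finset.sum_mul, heckeIdx, if_neg hne,
      Equiv.sum_comp e (fun i ↦ (heckeα i : ℂ) / heckeδ i),
      sum_heckeα_div_heckeδ] at h4
    refine h4.congr fun z ↦ ?_
    rw [heckeIdx, if_neg hne]; simp
  have hcop : IsCoprime (ℓ : ℤ) N := Nat.isCoprime_iff_coprime.2 ((Nat.coprime_primes hℓ hN).2 hne)
  have hcα (i : Option (Fin ℓ)) : IsCoprime (heckeα i : ℤ) N := by
    rw [← heckeα_mul_heckeδ i] at hcop
    push_cast at hcop
    exact hcop.of_mul_left_left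
  have hcδ (i : Option (Fin ℓ)) : IsCoprime (heckeδ i : ℤ) N := by
    rw [← heckeα_mul_heckeδ i] at hcop
    push_cast at hcop
    exact hcop.of_mul_left_right
  refine ⟨fun γ hγ ↦ main γ s fun γ' i j h ↦ h1 _ ?_, fun γ hγ ↦ main γ t fun γ' i j h ↦ h2 _ ?_,
    fun γ c hc hcN ↦ main γ _ fun γ' i j h ↦ ?_⟩
  · obtain ⟨h00, h10⟩ := heckeMat_mul_entries h
    exact IsCoprime.dvd_of_dvd_mul_right (hcα j).symm.pow_left (h10 ▸ hγ.mul_left _)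
  · obtain ⟨h00, h10⟩ := heckeMat_mul_entries h
    exact fun h5 ↦ hγ (IsCoprime.dvd_of_dvd_mul_left (hcδ i).symm (h10 ▸ h5.mul_right _))
  · obtain ⟨h00, h10⟩ := heckeMat_mul_entries h
    have h6 : (N : ℤ) ∣ γ' 1 0 := IsCoprime.dvd_of_dvd_mul_right (hcα j).symm
      (h10 ▸ (Dvd.intro _ hc.symm).mul_left _)
    obtain ⟨c', hc'⟩ := h6
    have h7 : heckeδ i * c = c' * heckeα j := by
      apply mul_left_cancel₀ (by exact_mod_cast hN.ne_zero : (N : ℤ) ≠ 0)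
      rw [hc, hc'] at h10
      linear_combination h10
    have h8 : ¬ (N : ℤ) ∣ c' := fun h ↦ hcN
      (IsCoprime.dvd_of_dvd_mul_left (hcδ i).symm (h7 ▸ h.mul_right _))
    have hsq : (heckeα j : ZMod N) * heckeα j = 1 := by
      rcases heckeα_eq j with ⟨-, h⟩ | ⟨-, h⟩
      · rw [h, hℓN]; ring
      · rw [h]; simp
    have hαδ : (heckeα i : ZMod N) * heckeδ i = -1 := by
      rw [← hℓN, ← Nat.cast_mul, heckeα_mul_heckeδ]
    have h00' := congrArg (Int.cast : ℤ → ZMod N) h00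
    have h7' := congrArg (Int.cast : ℤ → ZMod N) h7
    rw [hc] at h00'
    push_cast at h00' h7'
    rw [CharP.cast_eq_zero (ZMod N) N] at h00'
    have h9 : ((γ' 0 0 * c' : ℤ) : ZMod N) = -(γ 0 0 * c : ℤ) := by
      push_cast
      linear_combination (-(γ' 0 0 : ZMod N) * c') * hsq - (c' * heckeα j : ZMod N) * h00'
        - (heckeα i * γ 0 0 : ZMod N) * h7' + (γ 0 0 * c : ZMod N) * hαδ
    rw [← hφ, ← h9]
    exact h3 _ _ hc' h8

end HeckeOperator

noncomputable section EisensteinTwo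

open UpperHalfPlane Filter Topology ModularForm EisensteinSeries
open scoped Matrix MatrixGroups ArithmeticFunction.sigma

/-- The coefficients of `E2`. -/
def coeffE2 (n : ℕ) : ℂ := if n = 0 then 1 else -24 * σ 1 n

lemma hasQSeries_E2 : HasQSeries coeffE2 E2 := fun z ↦
  (hasSum_qExpansion_E2 (z := z)).of_eq (fun n ↦ by
    simp [coeffE2, nome]) rfl

/-- The Eisenstein series `E₂(z) - m E₂(m z)` of level `Γ₀(m)`. -/
def eisDiff (m : ℕ) [NeZero m] : ℍ → ℂ := E2 - E2 ∣[(2 : ℤ)] tri m 1 0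

lemma hasQSeries_eisDiff (m : ℕ) [NeZero m] :
    HasQSeries (fun n ↦ coeffE2 n - m * if m ∣ n then coeffE2 (n / m) else 0) (eisDiff m) := by
  have h := (hasQSeries_E2.dilate (NeZero.pos m) (G := fun z ↦ E2 (tri m 1 0 • z)) fun z w hw ↦ by
    congr 1; ext1; rw [coe_tri_smul, hw]; simp).const_mul (-m : ℂ)
  convert! hasQSeries_E2.add h using 1
  · ext n
    simp [sub_eq_add_neg]
  · ext z
    simp [eisDiff, slash_two_tri_apply, sub_eq_add_neg]

lemma D2_slash_tri {m α δ : ℕ} [NeZero m] [NeZero α] [NeZero δ] {k : ℤ} {γ γ' : SL(2, ℤ)}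
    (h : !![(m : ℤ), 0; 0, (1 : ℕ)] * (γ : Matrix (Fin 2) (Fin 2) ℤ)
      = (γ' : Matrix (Fin 2) (Fin 2) ℤ) * !![(α : ℤ), k; 0, δ]) :
    D2 γ' ∣[(2 : ℤ)] tri α δ k = D2 γ := by
  have h10 := congrFun (congrFun h 1) 0
  have h11 := congrFun (congrFun h 1) 1
  simp [Matrix.mul_apply, Fin.sum_univ_two] at h10 h11
  have hδ : (δ : ℂ) ≠ 0 := NeZero.ne _
  ext z
  have hd : denom γ z = δ * denom γ' (tri α δ k • z : ℍ) := by
    rw [ModularGroup.denom_apply, ModularGroup.denom_apply, coe_tri_smul, h10, h11]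
    push_cast
    field_simp
    ring
  rw [slash_two_tri_apply, D2, D2, hd, h10]
  have := denom_ne_zero γ' (tri α δ k • z)
  push_cast
  field_simp

lemma eisDiff_slash {m α δ : ℕ} [NeZero m] [NeZero α] [NeZero δ] {k : ℤ} {γ γ' : SL(2, ℤ)}
    (h : !![(m : ℤ), 0; 0, (1 : ℕ)] * (γ : Matrix (Fin 2) (Fin 2) ℤ)
      = (γ' : Matrix (Fin 2) (Fin 2) ℤ) * !![(α : ℤ), k; 0, δ]) :
    eisDiff m ∣[(2 : ℤ)] γ = E2 - E2 ∣[(2 : ℤ)] tri α δ k := by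
  have h1 : (E2 ∣[(2 : ℤ)] tri m 1 0) ∣[(2 : ℤ)] γ
      = E2 ∣[(2 : ℤ)] tri α δ k - (1 / (2 * riemannZeta 2)) • D2 γ := by
    rw [slash_tri_slash h, E2_slash_action, ← D2_slash_tri h]
    ext z
    simp only [slash_two_tri_apply, Pi.sub_apply, Pi.smul_apply, smul_eq_mul]
    ring
  rw [eisDiff, sub_eq_add_neg, SlashAction.add_slash, SlashAction.neg_slash, h1, E2_slash_action]
  abel

lemma tendsto_E2 : Tendsto E2 atImInfty (𝓝 1) := by
  simpa [coeffE2] using hasQSeries_E2.tendsto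

lemma tendsto_eisDiff_slash {m α δ : ℕ} [NeZero m] [NeZero α] [NeZero δ] (hm : m = α * δ)
    (γ : SL(2, ℤ)) {c : ℤ} (hc : γ 1 0 = α * c) (hcδ : IsCoprime c (δ : ℤ)) :
    Tendsto (eisDiff m ∣[(2 : ℤ)] γ) atImInfty (𝓝 (1 - α / δ)) := by
  obtain ⟨γ', k, -, -, h⟩ := exists_eisMul_matrix hm γ hc hcδ
  rw [eisDiff_slash h]
  have h1 := tendsto_E2.sub (tendsto_slash_two_tri (α := α) (δ := δ) (k := k) tendsto_E2)
  rw [mul_one] at h1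
  exact h1

lemma eisDiff_slash_of_dvd {m : ℕ} [NeZero m] {γ : SL(2, ℤ)} (h : (m : ℤ) ∣ γ 1 0) :
    eisDiff m ∣[(2 : ℤ)] γ = eisDiff m := by
  obtain ⟨γ', -, -, h'⟩ := exists_eisMul_matrix_of_dvd γ h
  exact eisDiff_slash h'

end EisensteinTwo

noncomputable section DivisorSums

open scoped ArithmeticFunction.sigma

lemma sigma_prime_mul {q : ℕ} (hq : q.Prime) (n : ℕ) :
    σ 1 (q * n) + (if q ∣ n then q * σ 1 (n / q) else 0) = (1 + q) * σ 1 n := by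
  rcases eq_or_ne n 0 with rfl | hn
  · simp
  obtain ⟨k, m, hm, rfl⟩ := Nat.exists_eq_pow_mul_and_not_dvd hn q hq.ne_one
  have hmul (j : ℕ) : σ 1 (q ^ j * m) = σ 1 (q ^ j) * σ 1 m :=
    ArithmeticFunction.isMultiplicative_sigma.map_mul_of_coprime
      (((Nat.Prime.coprime_iff_not_dvd hq).2 hm).pow_left j)
  have hsucc (j : ℕ) : σ 1 (q ^ (j + 1)) = 1 + q * σ 1 (q ^ j) := by
    rw [ArithmeticFunction.sigma_one_apply_prime_pow hq,
      ArithmeticFunction.sigma_one_apply_prime_pow hq, Finset.sum_range_succ', Finset.mul_sum]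
    simp [pow_succ', add_comm]
  rw [← mul_assoc, ← pow_succ', hmul, hmul, hsucc]
  cases k with
  | zero => simp [hm]
  | succ k =>
    rw [if_pos (by rw [pow_succ', mul_assoc]; exact Dvd.intro _ rfl), pow_succ', mul_assoc,
      Nat.mul_div_cancel_left _ hq.pos, hmul, ← pow_succ', hsucc]
    ring

/-- The coefficients `σ(n) - m σ(n / m)`. -/
def sigmaDiff (m n : ℕ) : ℤ := σ 1 n - if m ∣ n then m * σ 1 (n / m) else 0

lemma sigmaDiff_prime_mul {m q : ℕ} (hq : q.Prime) (hqm : q.Coprime m) (n : ℕ) :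
    sigmaDiff m (q * n) + (if q ∣ n then q * sigmaDiff m (n / q) else 0)
      = (1 + q) * sigmaDiff m n := by
  have h1 := congrArg (Nat.cast : ℕ → ℤ) (sigma_prime_mul hq n)
  have h2 : m ∣ q * n ↔ m ∣ n := hqm.symm.dvd_mul_left
  unfold sigmaDiff
  simp only [h2]
  push_cast
  push_cast at h1
  by_cases hm : m ∣ n
  · obtain ⟨k, rfl⟩ := hm
    rcases Nat.eq_zero_or_pos m with rfl | hm0
    · simp
    have h3 := congrArg (Nat.cast : ℕ → ℤ) (sigma_prime_mul hq k)
    push_cast at h3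
    have h4 : q ∣ m * k ↔ q ∣ k := hqm.dvd_mul_left
    simp only [h4] at h1 ⊢
    rw [if_pos (Dvd.intro _ rfl), Nat.mul_div_cancel_left _ hm0, mul_left_comm,
      Nat.mul_div_cancel_left _ hm0]
    rw [mul_left_comm] at h1
    by_cases hk : q ∣ k
    · obtain ⟨j, rfl⟩ := hk
      simp only [dvd_mul_right, if_true, Nat.mul_div_cancel_left _ hq.pos] at h1 h3 ⊢
      rw [mul_left_comm m q j] at h1 ⊢
      rw [Nat.mul_div_cancel_left _ hq.pos] at h1 ⊢
      rw [if_pos (Dvd.intro _ rfl), Nat.mul_div_cancel_left _ hm0]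
      linear_combination h1 - m * h3
    · simp only [hk, if_false, dvd_mul_right, if_true] at h1 h3 ⊢
      linear_combination h1 - m * h3
  · have h5 : q ∣ n → ¬ m ∣ n / q := fun hqn h ↦ hm (h.trans (Nat.div_dvd_of_dvd hqn))
    by_cases hqn : q ∣ n
    · simp only [hqn, if_true, hm, if_false, h5 hqn] at h1 ⊢
      linear_combination h1
    · simp only [hqn, if_false, hm] at h1 ⊢
      linear_combination h1

lemma dvd_sigmaDiff_sq {N : ℕ} (hN : N.Prime) (n : ℕ) :
    (1 + N : ℤ) ∣ sigmaDiff (N ^ 2) (N * n) := by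
  have h1 := congrArg (Nat.cast : ℕ → ℤ) (sigma_prime_mul hN n)
  have h2 : N ^ 2 ∣ N * n ↔ N ∣ n := by rw [sq]; exact mul_dvd_mul_iff_left hN.ne_zero
  unfold sigmaDiff
  simp only [h2]
  push_cast
  push_cast at h1
  by_cases hn : N ∣ n
  · obtain ⟨k, rfl⟩ := hn
    rw [if_pos (Dvd.intro _ rfl), Nat.mul_div_cancel_left _ hN.pos] at h1
    rw [if_pos (Dvd.intro _ rfl), ← mul_assoc N N k, ← sq,
      Nat.mul_div_cancel_left _ (pow_pos hN.pos 2)]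
    rw [← mul_assoc N N k, ← sq] at h1
    exact ⟨σ 1 (N * k) - N * σ 1 k, by linear_combination h1⟩
  · rw [if_neg hn] at h1 ⊢
    exact ⟨σ 1 n, by linear_combination h1⟩

end DivisorSums

noncomputable section CongruenceForm

open UpperHalfPlane Filter Topology ModularForm
open scoped Matrix MatrixGroups

/-- Invariance under `Γ₀(N²)` in weight two together with vanishing at all cusps. -/
def IsCuspidal (N : ℕ) (F : ℍ → ℂ) : Prop :=
  (∀ γ : SL(2, ℤ), (N : ℤ) ^ 2 ∣ γ 1 0 → F ∣[(2 : ℤ)] γ = F) ∧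
    ∀ γ : SL(2, ℤ), Tendsto (F ∣[(2 : ℤ)] γ) atImInfty (𝓝 0)

lemma smul_add_smul_slash (a b : ℂ) (F G : ℍ → ℂ) (γ : SL(2, ℤ)) :
    (a • F + b • G) ∣[(2 : ℤ)] γ = a • F ∣[(2 : ℤ)] γ + b • G ∣[(2 : ℤ)] γ := by
  rw [SL_slash, SlashAction.add_slash, ← SL_slash, ← SL_slash, SL_smul_slash, SL_smul_slash]

lemma Filter.Tendsto.smul_add_smul_slash {F G : ℍ → ℂ} {γ : SL(2, ℤ)} {x y : ℂ} (a b : ℂ)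
    (hF : Tendsto (F ∣[(2 : ℤ)] γ) atImInfty (𝓝 x))
    (hG : Tendsto (G ∣[(2 : ℤ)] γ) atImInfty (𝓝 y)) :
    Tendsto ((a • F + b • G) ∣[(2 : ℤ)] γ) atImInfty (𝓝 (a * x + b * y)) := by
  rw [_root_.smul_add_smul_slash]
  exact (hF.const_mul a).add (hG.const_mul b)

lemma IsCuspidal.apply_zero {N : ℕ} {F : ℍ → ℂ} (hF : IsCuspidal N F) {a : ℕ → ℂ}
    (h : HasQSeries a F) : a 0 = 0 := by
  have h1 := hF.2 1
  rw [SlashAction.slash_one] at h1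
  exact tendsto_nhds_unique h.tendsto h1

/-- A linear combination of Eisenstein series of weight two with controlled coefficients that is
a cusp form. -/
lemma exists_isCuspidal_eisenstein {N ℓ : ℕ} [Fact N.Prime] (hℓ : ℓ.Prime)
    (hℓN : (ℓ : ZMod N) = -1) :
    ∃ (F : ℍ → ℂ) (b : ℕ → ℤ), IsCuspidal N F ∧
      HasQSeries (fun n ↦ if n = 0 then 0 else
        (((8 * N ^ 2 * (1 + ℓ) * (N - 1) * (N - 2)) * (-24 * sigmaDiff (N ^ 2) n)
          + (N ^ 2 - 1) * b n : ℤ) : ℂ)) F := by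
  have hN : N.Prime := Fact.out
  have hN0 : (N : ℂ) ≠ 0 := by exact_mod_cast hN.ne_zero
  have : NeZero ℓ := ⟨hℓ.ne_zero⟩
  obtain ⟨b, hb⟩ := exists_hasQSeries_prodEis (N := N)
  have hne : ℓ ≠ N := by
    rintro rfl
    rw [CharP.cast_eq_zero] at hℓN
    exact one_ne_zero (neg_eq_zero.1 hℓN.symm)
  obtain ⟨t1, t2, t3⟩ := tendsto_hecke_slash hN hℓ hℓN (F := prodEis N) (φ := midConst N)
    midConst_neg (fun γ h ↦ tendsto_prodEis_of_sq_dvd h) (fun γ h ↦ tendsto_prodEis_of_not_dvd h)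
    (fun γ c hc h ↦ tendsto_prodEis_of_eq_mul hc h)
  rw [sum_sawtooth_sq] at t1 t2
  set G : ℍ → ℂ := (1 : ℂ) • hecke N ℓ (prodEis N) + (1 + ℓ : ℂ) • prodEis N with hG
  set c₁ : ℂ := 8 * N ^ 2 * (1 + ℓ) * (N - 1) * (N - 2) with hc₁
  set c₂ : ℂ := (N ^ 2 - 1) * (12 * N) * (4 * N ^ 2) with hc₂
  have hcusp : IsCuspidal N (c₁ • eisDiff (N ^ 2) + c₂ • G) := by
    refine ⟨fun γ h ↦ ?_, fun γ ↦ ?_⟩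
    · rw [smul_add_smul_slash, hG, smul_add_smul_slash, prodEis_slash h,
        eisDiff_slash_of_dvd (by exact_mod_cast h), hecke_slash hN hℓ (fun γ ↦ prodEis_slash) h]
    · by_cases h1 : (N : ℤ) ^ 2 ∣ γ 1 0
      · obtain ⟨c, hc⟩ := id h1
        have e1 := tendsto_eisDiff_slash (m := N ^ 2) (α := N ^ 2) (δ := 1) (by simp) γ (c := c)
          (by exact_mod_cast hc) (by simpa using isCoprime_one_right)
        have e2 := (t1 γ h1).smul_add_smul_slash 1 (1 + ℓ) (tendsto_prodEis_of_sq_dvd h1)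
        rw [sum_sawtooth_sq] at e2
        have e3 := e1.smul_add_smul_slash c₁ c₂ e2
        convert e3 using 2
        rw [hc₁, hc₂]; push_cast; field_simp; ring
      · by_cases h2 : (N : ℤ) ∣ γ 1 0
        · obtain ⟨c, hc⟩ := h2
          have hcN : ¬ (N : ℤ) ∣ c := fun h ↦ h1 (by rw [hc, sq]; exact mul_dvd_mul_left _ h)
          have e1 := tendsto_eisDiff_slash (m := N ^ 2) (α := N) (δ := N) (sq N) γ (c := c) hc
            ((Prime.coprime_iff_not_dvd (Nat.prime_iff_prime_int.1 hN)).2 hcN).symm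
          have e2 := (t3 γ c hc hcN).smul_add_smul_slash 1 (1 + ℓ) (tendsto_prodEis_of_eq_mul hc hcN)
          have e3 := e1.smul_add_smul_slash c₁ c₂ e2
          convert e3 using 2
          field_simp; ring
        · have e1 := tendsto_eisDiff_slash (m := N ^ 2) (α := 1) (δ := N ^ 2) (by simp) γ
            (c := γ 1 0) (by simp) (by
              push_cast
              exact ((Prime.coprime_iff_not_dvd (Nat.prime_iff_prime_int.1 hN)).2 h2).symm.pow_right)
          have e2 := (t2 γ h2).smul_add_smul_slash 1 (1 + ℓ) (tendsto_prodEis_of_not_dvd h2)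
          rw [sum_sawtooth_sq] at e2
          have e3 := e1.smul_add_smul_slash c₁ c₂ e2
          convert e3 using 2
          rw [hc₁, hc₂]; push_cast; field_simp; ring
  refine ⟨_, fun n ↦ 12 * N * ((b (ℓ * n) + if ℓ ∣ n then ℓ * b (n / ℓ) else 0) + (1 + ℓ) * b n),
    hcusp, ?_⟩
  have q1 : HasQSeries (heckeSeq N ℓ (fun n ↦ (b n : ℂ)) + (1 + ℓ : ℂ) • fun n ↦ (b n : ℂ))
      ((4 * N ^ 2 : ℂ) • G) := by
    have := (hb.hecke (N := N) (ℓ := ℓ)).add (hb.const_mul (1 + ℓ))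
    rw [hecke_smul] at this
    convert! this using 1
    rw [hG, smul_add, one_smul, smul_comm]
  have q2 := ((hasQSeries_eisDiff (N ^ 2)).const_mul c₁).add
    (q1.const_mul (((N : ℂ) ^ 2 - 1) * (12 * N)))
  rw [smul_smul, ← hc₂] at q2
  convert! q2 using 1
  ext n
  split_ifs with hn
  · rw [hn]; exact (hcusp.apply_zero q2).symm
  · have hs : coeffE2 n - (N ^ 2 : ℕ) * (if N ^ 2 ∣ n then coeffE2 (n / N ^ 2) else 0)
        = -24 * sigmaDiff (N ^ 2) n := by
      rw [coeffE2, if_neg hn, sigmaDiff]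
      split_ifs with h
      · have : n / N ^ 2 ≠ 0 := by
          rw [Nat.div_ne_zero_iff_of_dvd h]; exact ⟨hn, pow_ne_zero 2 hN.ne_zero⟩
        rw [coeffE2, if_neg this]; push_cast; ring
      · push_cast; ring
    simp only [Pi.add_apply, Pi.smul_apply, smul_eq_mul, hs, heckeSeq, heckeε, if_neg hne, hc₁]
    split_ifs <;> push_cast <;> ring

end CongruenceForm

noncomputable section CongruenceForm

lemma exists_prime_eq_neg_one_and_eq_one {N p : ℕ} [NeZero N] [NeZero p] (h : N.Coprime p) :
    ∃ ℓ : ℕ, ℓ.Prime ∧ (ℓ : ZMod N) = -1 ∧ (ℓ : ZMod p) = 1 := by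
  let e := ZMod.chineseRemainder h
  have hu : IsUnit (e.symm (-1, 1)) :=
    (Prod.isUnit_iff.2 ⟨isUnit_one.neg, isUnit_one⟩ : IsUnit ((-1, 1) : ZMod N × ZMod p)).map e.symm
  obtain ⟨ℓ, -, hℓ, hℓe⟩ := Nat.forall_exists_prime_gt_and_eq_mod hu 0
  have h1 : e (ℓ : ZMod (N * p)) = (-1, 1) := by rw [hℓe, RingEquiv.apply_symm_apply]
  rw [map_natCast] at h1
  exact ⟨ℓ, hℓ, by simpa using congrArg Prod.fst h1, by simpa using congrArg Prod.snd h1⟩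

/-- There is a cusp form of level `Γ₀(N²)` with integral coefficients which modulo `p` is a nonzero
eigenform with the eigenvalues `1 + ℓ`. -/
lemma exists_isCuspidal_congruence {N p : ℕ} (hN : N.Prime) (hp : p.Prime) (hp5 : 5 ≤ p)
    (hcong : (N : ZMod p) = -1) :
    ∃ (F : UpperHalfPlane → ℂ) (x : ℕ → ℤ), IsCuspidal N F ∧ HasQSeries (fun n ↦ (x n : ℂ)) F ∧
      ¬ (p : ℤ) ∣ x 1 ∧ ∀ ℓ : ℕ, ℓ.Prime → ∀ n, (p : ℤ) ∣ x (ℓ * n)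
        + (if ℓ ∣ n then (if ℓ = N then 0 else (ℓ : ℤ)) * x (n / ℓ) else 0) - (1 + ℓ) * x n := by
  have : Fact N.Prime := ⟨hN⟩
  have : Fact p.Prime := ⟨hp⟩
  have hNp : N ≠ p := by
    rintro rfl
    rw [CharP.cast_eq_zero] at hcong
    exact one_ne_zero (neg_eq_zero.1 hcong.symm)
  obtain ⟨ℓ₀, hℓ₀, h1, h2⟩ :=
    exists_prime_eq_neg_one_and_eq_one ((Nat.coprime_primes hN hp).2 hNp)
  obtain ⟨F, b, hF, hq⟩ := exists_isCuspidal_eisenstein hℓ₀ h1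
  set x : ℕ → ℤ := fun n ↦ if n = 0 then 0 else
    8 * N ^ 2 * (1 + ℓ₀) * (N - 1) * (N - 2) * (-24 * sigmaDiff (N ^ 2) n)
      + (N ^ 2 - 1) * b n with hx
  have hxmod (n : ℕ) : (x n : ZMod p) = -2304 * (sigmaDiff (N ^ 2) n : ZMod p) := by
    simp only [hx]
    split_ifs with hn
    · simp [hn, sigmaDiff]
    · push_cast
      rw [hcong, h2]
      ring
  refine ⟨F, x, hF, ?_, ?_, fun ℓ hℓ n ↦ ?_⟩
  · convert! hq using 1
    ext n
    simp only [hx]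
    split_ifs <;> simp
  · rw [← ZMod.intCast_zmod_eq_zero_iff_dvd, hxmod]
    have hs : sigmaDiff (N ^ 2) 1 = 1 := by
      have : ¬ N ^ 2 ∣ 1 := by simpa using hN.ne_one
      rw [sigmaDiff, if_neg this]; simp
    have hunit (q : ℕ) (hq : q.Prime) (hqp : q < 5) : ((q : ℕ) : ZMod p) ≠ 0 := by
      rw [Ne, ZMod.natCast_eq_zero_iff, Nat.prime_dvd_prime_iff_eq hp hq]
      omega
    have e2 := hunit 2 Nat.prime_two (by norm_num)
    have e3 := hunit 3 Nat.prime_three (by norm_num)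
    rw [hs, show (-2304 : ZMod p) = -((2 : ℕ) ^ 8 * (3 : ℕ) ^ 2) by norm_num]
    simpa using ⟨e2, e3⟩
  · rw [← ZMod.intCast_zmod_eq_zero_iff_dvd]
    by_cases hℓN : ℓ = N
    · subst hℓN
      obtain ⟨d, hd⟩ := dvd_sigmaDiff_sq hℓ n
      have h3 := hxmod (ℓ * n)
      rw [hd] at h3
      simp only [if_true, zero_mul, ite_self, add_zero]
      push_cast at h3 ⊢
      rw [h3, hcong]
      ring
    · have h3 := congrArg (Int.cast : ℤ → ZMod p)
        (sigmaDiff_prime_mul hℓ (((Nat.coprime_primes hℓ hN).2 hℓN).pow_right 2) n)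
      simp only [if_neg hℓN]
      split_ifs at h3 ⊢
      · push_cast at h3 ⊢
        rw [hxmod, hxmod, hxmod]
        linear_combination (-2304 : ZMod p) * h3
      · push_cast at h3 ⊢
        rw [hxmod, hxmod]
        linear_combination (-2304 : ZMod p) * h3

end CongruenceForm

noncomputable section SturmBound

open UpperHalfPlane Filter Topology ModularForm CongruenceSubgroup
open scoped MatrixGroups Manifold

lemma HasQSeries.shift {c : ℕ → ℂ} {F : ℍ → ℂ} (h : HasQSeries c F) {n : ℕ}
    (hc : ∀ m < n, c m = 0) : HasQSeries (fun k ↦ c (k + n)) (fun z ↦ F z / nome z ^ n) := fun z ↦ by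
  have h1 := (hasSum_nat_add_iff' n).2 (h z)
  rw [Finset.sum_eq_zero (fun i hi ↦ by rw [hc i (Finset.mem_range.1 hi), zero_mul]), sub_zero] at h1
  have hz : nome z ^ n ≠ 0 := pow_ne_zero n (nome_ne_zero z)
  exact (h1.div_const (nome z ^ n)).of_eq (fun k ↦ by rw [pow_add]; field_simp) rfl

lemma HasQSeries.coeff_eq_zero {c : ℕ → ℂ} {F : ℍ → ℂ} (h : HasQSeries c F) {B : ℕ}
    (hF : ∀ n < B, Tendsto (fun z ↦ F z / nome z ^ n) atImInfty (𝓝 0)) : ∀ n < B, c n = 0 := by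
  intro n
  induction n using Nat.strong_induction_on with
  | _ n ih =>
    intro hn
    have h1 := (h.shift fun m hm ↦ ih m hm (hm.trans hn)).tendsto
    rw [zero_add] at h1
    exact tendsto_nhds_unique h1 (hF n hn)

lemma HasQSeries.tendsto_div_zero {c : ℕ → ℂ} {F : ℍ → ℂ} (h : HasQSeries c F) {B : ℕ}
    (hc : ∀ n < B, c n = 0) {n : ℕ} (hn : n < B) :
    Tendsto (fun z ↦ F z / nome z ^ n) atImInfty (𝓝 0) := by
  have h1 := (h.shift fun m hm ↦ hc m (hm.trans hn)).tendsto
  rwa [zero_add, hc n hn] at h1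

lemma hasQSeries_qExpansion {Γ : Subgroup (GL (Fin 2) ℝ)} [Fact (IsCusp OnePoint.infty Γ)] {k : ℤ}
    (hΓ : 1 ∈ Γ.strictPeriods) (f : ModularForm Γ k) :
    HasQSeries (fun n ↦ (qExpansion 1 f).coeff n) f := fun z ↦
  (ModularForm.hasSum_qExpansion f one_pos hΓ z).of_eq (fun n ↦ by
    simp [nome, Function.Periodic.qParam]) rfl

lemma tendsto_quotientFunc {Γ : Subgroup (GL (Fin 2) ℝ)} [Γ.IsArithmetic] {k : ℤ}
    (f : ModularForm Γ k) (q : 𝒮ℒ ⧸ Γ.subgroupOf 𝒮ℒ) :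
    IsBoundedAtImInfty (SlashInvariantForm.quotientFunc f q) := by
  induction q using Quotient.inductionOn with
  | h r =>
    obtain ⟨_, γ, rfl⟩ := r
    rw [SlashInvariantForm.quotientFunc_mk]
    have := ModularFormClass.bdd_at_infty_slash f γ⁻¹
    rw [SL_slash] at this
    change IsBoundedAtImInfty (f ∣[k] (Matrix.SpecialLinearGroup.mapGL ℝ γ)⁻¹)
    rw [← map_inv]
    exact this

/-- A Sturm type bound for arithmetic subgroups. -/
lemma exists_sturm_bound (Γ : Subgroup (GL (Fin 2) ℝ)) [Γ.IsArithmetic] (k : ℤ) :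
    ∃ B : ℕ, ∀ (f : ModularForm Γ k) (a : ℕ → ℂ), HasQSeries a f → (∀ n < B, a n = 0) →
      f = 0 := by
  classical
  refine ⟨(k * Nat.card (𝒮ℒ ⧸ Γ.subgroupOf 𝒮ℒ)).toNat / 12 + 1, fun f a ha h0 ↦ ?_⟩
  set B := (k * Nat.card (𝒮ℒ ⧸ Γ.subgroupOf 𝒮ℒ)).toNat / 12 + 1
  have h1 : ModularForm.norm 𝒮ℒ f = 0 := by
    apply ModularForm.sturm_bound_levelOne
    have hq := hasQSeries_qExpansion one_mem_strictPeriods_SL (ModularForm.norm 𝒮ℒ f)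
    have hc := hq.coeff_eq_zero (B := B) fun n hn ↦ ?_
    · refine lt_of_lt_of_le ?_ (PowerSeries.le_order _ B fun i hi ↦ hc i (by exact_mod_cast hi))
      exact_mod_cast Nat.lt_succ_self _
    · let := Fintype.ofFinite (𝒮ℒ ⧸ Γ.subgroupOf 𝒮ℒ)
      have hone : SlashInvariantForm.quotientFunc f
          ((⟦1⟧ : 𝒮ℒ ⧸ Γ.subgroupOf 𝒮ℒ)) = f := by
        rw [SlashInvariantForm.quotientFunc_mk]; simp
      have hprod (z : ℍ) : ModularForm.norm 𝒮ℒ f z = f z *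
          ∏ q ∈ Finset.univ.erase (⟦1⟧ : 𝒮ℒ ⧸ Γ.subgroupOf 𝒮ℒ),
            SlashInvariantForm.quotientFunc f q z := by
        have := (Finset.mul_prod_erase Finset.univ
          (fun q ↦ SlashInvariantForm.quotientFunc f q z)
          (Finset.mem_univ (⟦1⟧ : 𝒮ℒ ⧸ Γ.subgroupOf 𝒮ℒ))).symm
        rw [hone] at this
        rw [ModularForm.coe_norm, Finset.prod_apply]
        convert! this
      have hb : (fun z ↦ ∏ q ∈ Finset.univ.erase (⟦1⟧ : 𝒮ℒ ⧸ Γ.subgroupOf 𝒮ℒ),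
          SlashInvariantForm.quotientFunc f q z) =O[atImInfty] fun _ ↦ (1 : ℝ) := by
        have := Asymptotics.IsBigO.finsetProd
          (s := Finset.univ.erase (⟦1⟧ : 𝒮ℒ ⧸ Γ.subgroupOf 𝒮ℒ)) (l := atImInfty)
          fun q _ ↦ tendsto_quotientFunc f q
        simpa using this
      have ht := ha.tendsto_div_zero h0 hn
      have := (Asymptotics.isLittleO_one_iff ℝ).2 ht
      have h2 := this.mul_isBigO hb
      simp only [mul_one] at h2
      refine ((Asymptotics.isLittleO_one_iff ℝ).1 h2).congr fun z ↦ ?_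
      rw [hprod]; ring
  exact DFunLike.coe_injective ((ModularForm.norm_eq_zero_iff 𝒮ℒ f).1 h1)

end SturmBound

section DeligneSerreSpan

/-- A version of the Deligne-Serre lifting lemma in which the lattice need not span. -/
theorem exists_eigenvector_of_eigenvector_mod' {W : Type} {ι : Type} [AddCommGroup W] [Module ℂ W]
    (T : ι → Module.End ℂ W) (hcomm : ∀ i j, T i * T j = T j * T i)
    (L : Submodule ℤ W) (hfg : L.FG)
    (hL : ∀ i, ∀ x ∈ L, T i x ∈ L) (p : ℕ) (hp : p.Prime) (f₀ : W) (hf₀ : f₀ ∈ L)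
    (hf₀p : ∀ g ∈ L, f₀ ≠ (p : ℤ) • g) (c : ι → ℤ)
    (hc : ∀ i, ∃ g ∈ L, T i f₀ - c i • f₀ = (p : ℤ) • g) :
    ∃ (A : Type) (_ : CommRing A) (_ : Module.Finite ℤ A) (t : ι → A)
      (χ : A →+* ℂ) (I : Ideal A), I.IsPrime ∧ RingHom.ker χ ≤ I ∧ (p : A) ∈ I ∧
        (∀ i, t i - (c i : A) ∈ I) ∧ (∀ S : Subring A, (∀ i, t i ∈ S) → ∀ x, x ∈ S) ∧
        ∃ y ∈ Submodule.span ℂ (L : Set W), y ≠ 0 ∧ ∀ i, T i y = χ (t i) • y := by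
  set V := Submodule.span ℂ (L : Set W) with hV
  have hLV : ∀ x ∈ L, x ∈ V := fun x hx ↦ Submodule.subset_span hx
  have hTV : ∀ i, ∀ x ∈ V, T i x ∈ V := fun i x hx ↦ by
    have : V ≤ V.comap (T i) := by
      rw [hV, Submodule.span_le]
      exact fun x hx ↦ Submodule.subset_span (hL i x hx)
    exact this hx
  let j : V →ₗ[ℤ] W := V.subtype.restrictScalars ℤ
  have hj : Function.Injective j := Subtype.val_injective
  have hmap : (L.comap j).map j = L := by
    rw [Submodule.map_comap_eq, inf_eq_right]
    exact fun x hx ↦ ⟨⟨x, hLV x hx⟩, rfl⟩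
  obtain ⟨A, i1, i2, t, χ, I, hI, hker, hpI, htI, hgen, y, hy, hTy⟩ :=
    exists_eigenvector_of_eigenvector_mod (fun i ↦ (T i).restrict (hTV i))
      (fun i k ↦ LinearMap.ext fun x ↦ Subtype.ext (LinearMap.congr_fun (hcomm i k) x))
      (L.comap j) (Submodule.fg_of_fg_map_injective j hj (by rwa [hmap]))
      (by
        rw [eq_top_iff]
        rintro ⟨x, hx⟩ -
        have := Submodule.span_preimage_eq (f := V.subtype) (s := (L : Set W))
          ⟨0, L.zero_mem⟩ (fun x hx ↦ ⟨⟨x, hLV x hx⟩, rfl⟩)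
        change _ ∈ Submodule.span ℂ (V.subtype ⁻¹' (L : Set W))
        rw [this]
        exact hx)
      (fun i x hx ↦ hL i x hx) p hp ⟨f₀, hLV f₀ hf₀⟩ hf₀
      (fun g hg h ↦ hf₀p g hg (congrArg j h)) c
      (fun i ↦ by
        obtain ⟨g, hg, h⟩ := hc i
        exact ⟨⟨g, hLV g hg⟩, hg, Subtype.ext h⟩)
  exact ⟨A, i1, i2, t, χ, I, hI, hker, hpI, htI, hgen, y, y.2, fun h ↦ hy (Subtype.ext h),
    fun i ↦ congrArg Subtype.val (hTy i)⟩

end DeligneSerreSpan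

noncomputable section CuspidalSequences

open UpperHalfPlane Filter Topology ModularForm CongruenceSubgroup
open scoped MatrixGroups Manifold

/-- The cusp form attached to a cuspidal function with a `q`-expansion. -/
def IsCuspidal.toCuspForm {N : ℕ} [NeZero N] {F : ℍ → ℂ} (hF : IsCuspidal N F) {a : ℕ → ℂ}
    (ha : HasQSeries a F) : CuspForm (Gamma0 (N ^ 2)) 2 where
  toFun := F
  slash_action_eq' := by
    rintro _ ⟨γ, hγ, rfl⟩
    change F ∣[(2 : ℤ)] γ = F
    refine hF.1 γ ?_
    have := Gamma0_mem.1 hγ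
    rw [ZMod.intCast_zmod_eq_zero_iff_dvd] at this
    exact_mod_cast this
  holo' := ha.mdifferentiable
  zero_at_cusps' := fun {c} hc ↦ by
    rw [Subgroup.IsArithmetic.isCusp_iff_isCusp_SL2Z] at hc
    rw [OnePoint.isZeroAt_iff_forall_SL2Z hc]
    intro γ _
    exact hF.2 γ

lemma IsCuspidal.exists_sturm_bound (N : ℕ) [NeZero N] : ∃ B : ℕ, ∀ (F : ℍ → ℂ) (a : ℕ → ℂ),
    IsCuspidal N F → HasQSeries a F → (∀ n < B, a n = 0) → a = 0 := by
  obtain ⟨B, hB⟩ := _root_.exists_sturm_bound (Gamma0 (N ^ 2)) 2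
  refine ⟨B, fun F a hF ha h0 ↦ ?_⟩
  let f := hF.toCuspForm ha
  let g : ModularForm (Gamma0 (N ^ 2)) 2 :=
    { toFun := F
      slash_action_eq' := f.slash_action_eq'
      holo' := f.holo'
      bdd_at_cusps' := fun {c} hc γ hγ ↦ (f.zero_at_cusps' hc γ hγ).boundedAtFilter }
  have hg := hB g a ha h0
  have hF0 : F = 0 := congrArg (fun g : ModularForm (Gamma0 (N ^ 2)) 2 ↦ (g : ℍ → ℂ)) hg
  subst hF0
  exact ha.unique .zero

/-- The space of `q`-expansions of cusp forms of weight two and level `Γ₀(N²)`. -/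
def cuspidalSeq (N : ℕ) : Submodule ℂ (ℕ → ℂ) where
  carrier := {a | ∃ F, IsCuspidal N F ∧ HasQSeries a F}
  zero_mem' := ⟨0, ⟨fun γ _ ↦ SlashAction.zero_slash 2 γ, fun γ ↦ by
    rw [SlashAction.zero_slash]; exact tendsto_const_nhds⟩, .zero⟩
  add_mem' := by
    rintro a b ⟨F, hF, ha⟩ ⟨G, hG, hb⟩
    refine ⟨F + G, ⟨fun γ hγ ↦ ?_, fun γ ↦ ?_⟩, ha.add hb⟩
    · rw [SL_slash, SlashAction.add_slash, ← SL_slash, ← SL_slash, hF.1 γ hγ, hG.1 γ hγ]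
    · simpa using (hF.2 γ).smul_add_smul_slash 1 1 (hG.2 γ)
  smul_mem' := by
    rintro c a ⟨F, hF, ha⟩
    refine ⟨c • F, ⟨fun γ hγ ↦ ?_, fun γ ↦ ?_⟩, ha.const_mul c⟩
    · rw [SL_smul_slash, hF.1 γ hγ]
    · simpa using (hF.2 γ).smul_add_smul_slash c 0 (hF.2 γ)

/-- The Hecke operator on sequences as a linear map. -/
def heckeEnd (N ℓ : ℕ) : Module.End ℂ (ℕ → ℂ) where
  toFun := heckeSeq N ℓ
  map_add' a b := by
    funext n
    simp only [heckeSeq, Pi.add_apply]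
    split_ifs <;> ring
  map_smul' c a := by
    funext n
    simp only [heckeSeq, Pi.smul_apply, smul_eq_mul, RingHom.id_apply]
    split_ifs <;> ring

lemma heckeEnd_mem_cuspidalSeq {N ℓ : ℕ} (hN : N.Prime) (hℓ : ℓ.Prime) {a : ℕ → ℂ}
    (ha : a ∈ cuspidalSeq N) : heckeEnd N ℓ a ∈ cuspidalSeq N := by
  obtain ⟨F, hF, ha⟩ := ha
  have : NeZero ℓ := ⟨hℓ.ne_zero⟩
  exact ⟨hecke N ℓ F, ⟨fun γ hγ ↦ hecke_slash hN hℓ hF.1 hγ, tendsto_hecke_slash_zero hℓ hF.2⟩,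
    ha.hecke⟩

lemma heckeEnd_commute (N : ℕ) {ℓ r : ℕ} (hℓ : ℓ.Prime) (hr : r.Prime) :
    heckeEnd N ℓ * heckeEnd N r = heckeEnd N r * heckeEnd N ℓ := by
  rcases eq_or_ne ℓ r with rfl | hne
  · rfl
  have hc : Nat.Coprime ℓ r := (Nat.coprime_primes hℓ hr).2 hne
  refine LinearMap.ext fun a ↦ funext fun n ↦ ?_
  change heckeSeq N ℓ (heckeSeq N r a) n = heckeSeq N r (heckeSeq N ℓ a) n
  have hd1 : r ∣ ℓ * n ↔ r ∣ n := ⟨hc.symm.dvd_of_dvd_mul_left, fun h ↦ h.mul_left ℓ⟩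
  have hd2 : ℓ ∣ r * n ↔ ℓ ∣ n := ⟨hc.dvd_of_dvd_mul_left, fun h ↦ h.mul_left r⟩
  have hq {ℓ r : ℕ} (hℓ : ℓ.Prime) (hc : Nat.Coprime ℓ r) (h : ℓ ∣ n) :
      (r ∣ n / ℓ ↔ r ∣ n) ∧ r * (n / ℓ) = r * n / ℓ := by
    obtain ⟨m, rfl⟩ := h
    rw [Nat.mul_div_cancel_left _ hℓ.pos, mul_left_comm, Nat.mul_div_cancel_left _ hℓ.pos]
    exact ⟨⟨fun h ↦ h.mul_left ℓ, hc.symm.dvd_of_dvd_mul_left⟩, rfl⟩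
  by_cases h1 : ℓ ∣ n <;> by_cases h2 : r ∣ n
  · simp only [heckeSeq, hd1, hd2, h1, h2, (hq hℓ hc h1).1, (hq hr hc.symm h2).1, if_true,
      (hq hℓ hc h1).2, (hq hr hc.symm h2).2, mul_left_comm r ℓ n, Nat.div_div_eq_div_mul,
      mul_comm r ℓ]
    ring
  · simp only [heckeSeq, hd1, hd2, h1, h2, (hq hℓ hc h1).1, if_true, if_false,
      (hq hℓ hc h1).2, mul_left_comm r ℓ n]
    ring
  · simp only [heckeSeq, hd1, hd2, h1, h2, (hq hr hc.symm h2).1, if_true, if_false,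
      (hq hr hc.symm h2).2, mul_left_comm r ℓ n]
    ring
  · simp only [heckeSeq, hd1, hd2, h1, h2, if_false, mul_left_comm r ℓ n]

/-- Coercion of integer sequences. -/
def intSeqCast : (ℕ → ℤ) →ₗ[ℤ] (ℕ → ℂ) where
  toFun x n := x n
  map_add' x y := by ext; simp
  map_smul' c x := by ext; simp

/-- The `q`-expansions of cusp forms with integer coefficients. -/
def intCuspidalSeq (N : ℕ) : Submodule ℤ (ℕ → ℂ) :=
  (((cuspidalSeq N).restrictScalars ℤ).comap intSeqCast).map intSeqCast

lemma intCuspidalSeq_fg (N : ℕ) [NeZero N] : (intCuspidalSeq N).FG := by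
  obtain ⟨B, hB⟩ := IsCuspidal.exists_sturm_bound N
  refine Submodule.FG.map _ (Module.Finite.iff_fg.1 ?_)
  refine Module.Finite.of_injective
    ((LinearMap.funLeft ℤ ℤ (Fin.val : Fin B → ℕ)).domRestrict _)
    ((injective_iff_map_eq_zero _).2 fun ⟨x, F, hF, hx⟩ h ↦ Subtype.ext (funext fun n ↦ ?_))
  have := hB F _ hF hx fun n hn ↦ by
    have : x n = 0 := congrFun h ⟨n, hn⟩
    change (x n : ℂ) = 0
    rw [this, Int.cast_zero]
  have := congrFun this n
  exact Int.cast_injective (α := ℂ) (this.trans Int.cast_zero.symm)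

lemma heckeEnd_mem_intCuspidalSeq {N ℓ : ℕ} (hN : N.Prime) (hℓ : ℓ.Prime) {a : ℕ → ℂ}
    (ha : a ∈ intCuspidalSeq N) : heckeEnd N ℓ a ∈ intCuspidalSeq N := by
  obtain ⟨x, hx, rfl⟩ := ha
  have h : intSeqCast (fun n ↦ x (ℓ * n) +
      if ℓ ∣ n then (if ℓ = N then 0 else (ℓ : ℤ)) * x (n / ℓ) else 0) =
      heckeEnd N ℓ (intSeqCast x) := by
    funext n
    simp [intSeqCast, heckeEnd, heckeSeq, heckeε]
  refine ⟨_, ?_, h⟩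
  change intSeqCast _ ∈ cuspidalSeq N
  rw [h]
  exact heckeEnd_mem_cuspidalSeq hN hℓ hx

end CuspidalSequences

open Complex CongruenceSubgroup NumberField

lemma heckeEnd_intSeqCast_congr {N p ℓ : ℕ} (hN : N.Prime) (hp : p.Prime) (hℓ : ℓ.Prime)
    {x : ℕ → ℤ} (hx : intSeqCast x ∈ cuspidalSeq N)
    (h : ∀ n, (p : ℤ) ∣ x (ℓ * n) +
      (if ℓ ∣ n then (if ℓ = N then 0 else (ℓ : ℤ)) * x (n / ℓ) else 0) - (1 + ℓ) * x n) :
    ∃ g ∈ intCuspidalSeq N, heckeEnd N ℓ (intSeqCast x) - (1 + ℓ : ℤ) • intSeqCast x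
      = (p : ℤ) • g := by
  choose y hy using h
  have hp0 : (p : ℂ) ≠ 0 := Nat.cast_ne_zero.2 hp.ne_zero
  have e : heckeEnd N ℓ (intSeqCast x) - (1 + ℓ : ℤ) • intSeqCast x
      = (p : ℤ) • intSeqCast y := by
    funext n
    have := congrArg (Int.cast : ℤ → ℂ) (hy n)
    push_cast at this
    simp only [heckeEnd, intSeqCast, heckeSeq, heckeε, LinearMap.coe_mk, AddHom.coe_mk,
      Pi.sub_apply, Pi.smul_apply, zsmul_eq_mul]
    push_cast
    exact this
  refine ⟨_, ⟨y, ?_, rfl⟩, e⟩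
  change intSeqCast y ∈ cuspidalSeq N
  have e2 : intSeqCast y = (p : ℂ)⁻¹ •
      (heckeEnd N ℓ (intSeqCast x) - ((1 + ℓ : ℤ) : ℂ) • intSeqCast x) := by
    rw [Int.cast_smul_eq_zsmul, e, ← Int.cast_smul_eq_zsmul ℂ (p : ℤ), Int.cast_natCast,
      inv_smul_smul₀ hp0]
  rw [e2]
  exact Submodule.smul_mem _ _
    (sub_mem (heckeEnd_mem_cuspidalSeq hN hℓ hx) (Submodule.smul_mem _ _ hx))

/-- For primes `N, p` with `p ≥ 5` and `N ≡ -1 (mod p)`, there is a normalized cuspidal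
Hecke eigenform `f = ∑_{n ≥ 1} a_n q^n` of weight `2` and level `Γ₀(N²)` whose Fourier
coefficients are algebraic integers generating a number field `K_f`, together with a prime
ideal `𝔭` of the ring of integers of `K_f` lying over `p`, such that
`a_ℓ ≡ 1 + ℓ (mod 𝔭)` for every prime `ℓ` (including `ℓ = N`). -/
theorem exists_eigenform_eisenstein_congruence
    (N p : ℕ) (hN : N.Prime) (hp : p.Prime) (hp5 : 5 ≤ p)
    (hcong : (N : ZMod p) = -1) :
    ∃ (f : CuspForm (Gamma0 (N ^ 2)) 2) (a : ℕ → ℂ),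
      f ≠ 0 ∧
      a 0 = 0 ∧
      (∀ z : UpperHalfPlane,
        f z = ∑' n : ℕ, a n * Complex.exp (2 * Real.pi * Complex.I * n * z)) ∧
      a 1 = 1 ∧
      (∀ m n : ℕ, Nat.Coprime m n → a (m * n) = a m * a n) ∧
      (∀ ℓ : ℕ, ℓ.Prime → ℓ ≠ N → ∀ k : ℕ, 1 ≤ k →
        a (ℓ ^ (k + 1)) = a ℓ * a (ℓ ^ k) - (ℓ : ℂ) * a (ℓ ^ (k - 1))) ∧
      (∀ k : ℕ, 1 ≤ k → a (N ^ k) = a N ^ k) ∧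
      (∀ n, IsIntegral ℤ (a n)) ∧
      FiniteDimensional ℚ (IntermediateField.adjoin ℚ (Set.range a)) ∧
      ∃ 𝔭 : Ideal (𝓞 (IntermediateField.adjoin ℚ (Set.range a))),
        𝔭.IsPrime ∧ (p : 𝓞 (IntermediateField.adjoin ℚ (Set.range a))) ∈ 𝔭 ∧
        ∀ ℓ : ℕ, ℓ.Prime →
          ∃ b : 𝓞 (IntermediateField.adjoin ℚ (Set.range a)),
            algebraMap (𝓞 (IntermediateField.adjoin ℚ (Set.range a))) ℂ b = a ℓ ∧
            b - ((ℓ : 𝓞 (IntermediateField.adjoin ℚ (Set.range a))) + 1) ∈ 𝔭 := by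
  have : NeZero N := ⟨hN.ne_zero⟩
  obtain ⟨F₀, x, hF₀, hx, hx1, hxcong⟩ := exists_isCuspidal_congruence hN hp hp5 hcong
  have hxX : intSeqCast x ∈ cuspidalSeq N := ⟨F₀, hF₀, hx⟩
  obtain ⟨A, _, _, t, χ, I, hI, hker, hpI, htI, hgen, y, hy, hy0, hTy⟩ :=
    exists_eigenvector_of_eigenvector_mod' (fun ℓ : Nat.Primes ↦ heckeEnd N ℓ)
      (fun ℓ r ↦ heckeEnd_commute N ℓ.2 r.2) (intCuspidalSeq N) (intCuspidalSeq_fg N)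
      (fun ℓ _ ↦ heckeEnd_mem_intCuspidalSeq hN ℓ.2) p hp (intSeqCast x) ⟨x, hxX, rfl⟩
      (by
        rintro _ ⟨g, -, rfl⟩ h
        refine hx1 ⟨g 1, Int.cast_injective (α := ℂ) ?_⟩
        simpa [intSeqCast] using congrFun h 1)
      (fun ℓ ↦ 1 + ℓ)
      (fun ℓ ↦ heckeEnd_intSeqCast_congr hN hp ℓ.2 hxX (hxcong ℓ ℓ.2))
  have hyX : y ∈ cuspidalSeq N := Submodule.span_le.2
    (by rintro _ ⟨g, hg, rfl⟩; exact hg : (intCuspidalSeq N : Set (ℕ → ℂ)) ⊆ cuspidalSeq N) hy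
  have hy00 : y 0 = 0 := by
    obtain ⟨F, hF, hyF⟩ := hyX
    exact hF.apply_zero hyF
  classical
  let lam : ℕ → ℂ := fun ℓ ↦ if h : ℓ.Prime then χ (t ⟨ℓ, h⟩) else 0
  have hlam (ℓ : Nat.Primes) : lam ℓ = χ (t ℓ) := dif_pos ℓ.2
  have hyH : IsHeckeSeq (heckeε N) lam y := fun ℓ hℓ m ↦ by
    rw [hlam ⟨ℓ, hℓ⟩]
    exact congrFun (hTy ⟨ℓ, hℓ⟩) m
  have hy1 := hyH.apply_one_ne_zero hy00 hy0
  set a : ℕ → ℂ := fun n ↦ y n / y 1 with ha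
  have haH : IsHeckeSeq (heckeε N) lam a := hyH.div (y 1)
  have ha0 : a 0 = 0 := by simp [ha, hy00]
  have ha1 : a 1 = 1 := div_self hy1
  have haX : a ∈ cuspidalSeq N := by
    have : a = (y 1)⁻¹ • y := by funext n; simp [ha, div_eq_inv_mul]
    exact this ▸ Submodule.smul_mem _ _ hyX
  obtain ⟨F, hF, haF⟩ := haX
  have hapr (ℓ : Nat.Primes) : χ (t ℓ) = a ℓ := by rw [haH.apply_prime ha1 ℓ.2, hlam]
  have hrange (n : ℕ) : a n ∈ χ.range := haH.mem_subring ha0 ha1 χ.range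
    (fun ℓ hℓ ↦ ⟨_, (hlam ⟨ℓ, hℓ⟩).symm⟩)
    (fun ℓ _ ↦ by rw [heckeε]; split_ifs; exacts [zero_mem _, natCast_mem _ _]) n
  obtain ⟨hfin, φ, P, hP, hPI, hφ⟩ := exists_prime_ringOfIntegers_of_character t hgen χ I hker
    (Set.range a) (fun ℓ ↦ ⟨ℓ, (hapr ℓ).symm⟩) (by rintro _ ⟨n, rfl⟩; exact hrange n)
  refine ⟨hF.toCuspForm haF, a, fun h ↦ ?_, ha0, fun z ↦ ?_, ha1, haH.apply_mul ha0 ha1,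
    fun ℓ hℓ hne k hk ↦ ?_, fun k hk ↦ ?_, fun n ↦ ?_, hfin, P, hP, ?_, fun ℓ hℓ ↦ ?_⟩
  · have hF0 : F = 0 := congrArg (fun g : CuspForm (Gamma0 (N ^ 2)) 2 ↦ (g : UpperHalfPlane → ℂ)) h
    subst hF0
    have := congrFun (haF.unique .zero) 1
    exact one_ne_zero (ha1.symm.trans this)
  · refine (haF.eq_tsum z).trans (tsum_congr fun n ↦ ?_)
    rw [nome, ← Complex.exp_nat_mul]
    congr 2
    ring
  · rw [haH.apply_pow ha1 hℓ k hk, heckeε, if_neg hne]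
  · induction k, hk using Nat.le_induction with
    | base => simp
    | succ k hk ih =>
      rw [haH.apply_pow ha1 hN k hk, heckeε, if_pos rfl, ih]
      ring
  · obtain ⟨u, hu⟩ := hrange n
    rw [← hu]
    exact (Algebra.IsIntegral.isIntegral (R := ℤ) u).map χ.toIntAlgHom
  · have : (p : A) ∈ P.comap φ := hPI ▸ hpI
    simpa using this
  · refine ⟨φ (t ⟨ℓ, hℓ⟩), (hφ _).trans (hapr ⟨ℓ, hℓ⟩), ?_⟩
    have : t ⟨ℓ, hℓ⟩ - ((1 + ℓ : ℤ) : A) ∈ P.comap φ := hPI ▸ htI ⟨ℓ, hℓ⟩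
    rw [Ideal.mem_comap, map_sub, map_intCast] at this
    push_cast at this
    rwa [add_comm] at this
end

section
/- Let N and p be primes with p ≥ 5 and N ≡ 1 (mod p). Then p divides the class number of Q(N^{1/p}). -/
open Polynomial NumberField

/-- The norm of `a + m * x` is congruent to `a ^ n` modulo `m`, where `n` is the rank. -/
theorem Algebra.intCast_norm_intCast_add_mul {S : Type*} [CommRing S] [Module.Free ℤ S]
    [Module.Finite ℤ S] (a : ℤ) (m : ℕ) (x : S) :
    ((Algebra.norm ℤ ((a : S) + m * x) : ℤ) : ZMod m) = (a : ZMod m) ^ Module.finrank ℤ S := by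
  classical
  let b := Module.Free.chooseBasis ℤ S
  have h : Algebra.leftMulMatrix b ((a : S) + m * x) =
      Matrix.scalar _ a + (m : ℤ) • Algebra.leftMulMatrix b x := by
    have h₁ : (a : S) + m * x = algebraMap ℤ S a + (m : ℤ) • x := by simp
    rw [h₁, map_add, map_smul, AlgHom.commutes]
    rfl
  rw [Algebra.norm_eq_matrix_det b, h, ← eq_intCast (Int.castRingHom (ZMod m)), RingHom.map_det]
  have h₂ : (Int.castRingHom (ZMod m)).mapMatrix
      (Matrix.scalar _ a + (m : ℤ) • Algebra.leftMulMatrix b x) =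
      Matrix.scalar (Module.Free.ChooseBasisIndex ℤ S) (a : ZMod m) := by
    ext i j
    rw [RingHom.mapMatrix_apply, Matrix.map_apply, Matrix.add_apply, Matrix.smul_apply,
      smul_eq_mul, Matrix.scalar_apply, Matrix.scalar_apply]
    by_cases hij : i = j <;> simp [hij]
  rw [h₂, Matrix.scalar_apply, Matrix.det_diagonal, Finset.prod_const, Finset.card_univ,
    Module.finrank_eq_card_basis b]

/-- If the prime `N` divides `a ^ N`, where the ideal `(a)` has norm `N`, then every norm is
modulo `N` a power with exponent the rank. -/
theorem Algebra.exists_intCast_norm_eq_pow {S : Type*} [CommRing S] [IsDedekindDomain S]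
    [Module.Free ℤ S] [Module.Finite ℤ S] {N : ℕ} [Fact N.Prime] {a : S}
    (ha : (Ideal.span {a}).absNorm = N) (hdvd : (N : S) ∣ a ^ N) (x : S) :
    ∃ b : ℤ, ((Algebra.norm ℤ x : ℤ) : ZMod N) = (b : ZMod N) ^ Module.finrank ℤ S := by
  have hN : N.Prime := Fact.out
  obtain ⟨b, hb⟩ : ∃ b : ℤ, x - b ∈ Ideal.span {a} := by
    have hcard : Nat.card (S ⧸ Ideal.span {a}) = N := by
      rw [← ha, Ideal.absNorm_apply, Submodule.cardQuot_apply]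
    have : Finite (S ⧸ Ideal.span {a}) :=
      Nat.finite_of_card_ne_zero (hcard ▸ hN.ne_zero)
    let := Fintype.ofFinite (S ⧸ Ideal.span {a})
    rw [Nat.card_eq_fintype_card] at hcard
    let e := ZMod.ringEquivOfPrime (S ⧸ Ideal.span {a}) hN hcard
    obtain ⟨z, hz⟩ := e.surjective (Ideal.Quotient.mk _ x)
    obtain ⟨b, rfl⟩ := ZMod.intCast_surjective z
    refine ⟨b, ?_⟩
    rw [← Ideal.Quotient.eq, ← hz]
    simp
  obtain ⟨c, hc⟩ := Ideal.mem_span_singleton'.mp hb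
  obtain ⟨d, hd⟩ := hdvd
  obtain ⟨r, hr⟩ := exists_add_pow_prime_eq hN (b : S) (c * a)
  refine ⟨b, ?_⟩
  have hx : x ^ N = ((b ^ N : ℤ) : S) + N * (c ^ N * d + b * (c * a) * r) := by
    rw [show x = b + c * a by rw [hc]; ring, hr, mul_pow, hd]
    push_cast
    ring
  have h := Algebra.intCast_norm_intCast_add_mul (b ^ N) N (c ^ N * d + b * (c * a) * r)
  rw [← hx, map_pow] at h
  push_cast at h
  rwa [ZMod.pow_card, ZMod.pow_card] at h

/-- If the norm of `x` is divisible by a prime `q` exactly once, then `(q, x)` has norm `q`. -/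
theorem Ideal.absNorm_span_pair_eq_prime {S : Type*} [CommRing S] [IsDedekindDomain S]
    [Module.Free ℤ S] [Module.Finite ℤ S] {q : ℕ} (hq : q.Prime) {x : S}
    (h₁ : (q : ℤ) ∣ Algebra.norm ℤ x) (h₂ : ¬ (q : ℤ) ^ 2 ∣ Algebra.norm ℤ x) :
    (Ideal.span {(q : S), x}).absNorm = q := by
  have : Fact q.Prime := ⟨hq⟩
  have hdvd : (Ideal.span {(q : S), x}).absNorm ∣ q ^ Module.finrank ℤ S := by
    rw [← Ideal.absNorm_span_natCast]
    exact Ideal.absNorm_dvd_absNorm_of_le (Ideal.span_mono (by simp))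
  obtain ⟨k, -, hk⟩ := (Nat.dvd_prime_pow hq).mp hdvd
  have hx : ((Ideal.span {(q : S), x}).absNorm : ℤ) ∣ Algebra.norm ℤ x :=
    Ideal.absNorm_dvd_norm_of_mem (Ideal.subset_span (by simp))
  rw [hk] at hx ⊢
  push_cast at hx
  have hk2 : k < 2 := by
    by_contra! hk2
    exact h₂ ((pow_dvd_pow _ hk2).trans hx)
  interval_cases k
  · exfalso
    rw [pow_zero, Ideal.absNorm_eq_one_iff, Ideal.eq_top_iff_one, Ideal.mem_span_pair] at hk
    obtain ⟨u, v, huv⟩ := hk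
    have h := Algebra.intCast_norm_intCast_add_mul 1 q (-u)
    rw [show ((1 : ℤ) : S) + q * -u = v * x by rw [Int.cast_one, ← huv]; ring, map_mul] at h
    obtain ⟨t, ht⟩ := h₁
    simp [ht] at h
  · simp

/-- If an ideal has norm `q`, a primitive root modulo `N`, and all norms are `p`-th powers
modulo `N`, then `p` divides the class number. -/
theorem NumberField.dvd_classNumber_of_absNorm {K : Type*} [Field K] [NumberField K] {N p q : ℕ}
    [Fact N.Prime] (hp : Odd p) (hpN : p ∣ N - 1)
    (hnorm : ∀ x : 𝓞 K, ∃ b : ℤ, ((Algebra.norm ℤ x : ℤ) : ZMod N) = (b : ZMod N) ^ p)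
    (hq : orderOf (q : ZMod N) = N - 1) {I : Ideal (𝓞 K)} (hI : I.absNorm = q) :
    p ∣ classNumber K := by
  have hN : N.Prime := Fact.out
  have hN1 : 0 < N - 1 := by have := hN.two_le; omega
  have hq0 : (q : ZMod N) ≠ 0 := by
    intro h
    rw [h] at hq
    have h0 := pow_orderOf_eq_one (0 : ZMod N)
    rw [hq, zero_pow hN1.ne'] at h0
    exact zero_ne_one h0
  have hI0 : I ≠ ⊥ := by
    rintro rfl
    rw [Ideal.absNorm_bot] at hI
    simp [← hI] at hq0
  set h := classNumber K with hh
  obtain ⟨β, hβ⟩ : ∃ β : 𝓞 K, I ^ h = Ideal.span {β} := by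
    let J : nonZeroDivisors (Ideal (𝓞 K)) := ⟨I, mem_nonZeroDivisors_of_ne_zero hI0⟩
    have hJ : ClassGroup.mk0 (J ^ h) = 1 := by
      rw [map_pow, hh, classNumber, pow_card_eq_one]
    obtain ⟨β, hβ⟩ := ((ClassGroup.mk0_eq_one_iff (J ^ h).2).mp hJ).principal
    exact ⟨β, hβ⟩
  obtain ⟨c, hc⟩ : ∃ c : ZMod N, (q : ZMod N) ^ h = c ^ p := by
    obtain ⟨b, hb⟩ := hnorm β
    have habs : (Algebra.norm ℤ β).natAbs = q ^ h := by
      rw [← Ideal.absNorm_span_singleton, ← hβ, map_pow, hI]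
    rcases Int.natAbs_eq (Algebra.norm ℤ β) with h' | h' <;> rw [habs] at h' <;> rw [h'] at hb <;>
      push_cast at hb
    · exact ⟨b, hb⟩
    · exact ⟨-b, by rw [hp.neg_pow, ← hb, neg_neg]⟩
  obtain ⟨m, hm⟩ := hpN
  have hc0 : c ≠ 0 := by
    rintro rfl
    rw [zero_pow hp.pos.ne'] at hc
    exact pow_ne_zero _ hq0 hc
  have hpow : (q : ZMod N) ^ (h * m) = 1 := by
    rw [pow_mul, hc, ← pow_mul, ← hm, ZMod.pow_card_sub_one_eq_one hc0]
  have hdvd := orderOf_dvd_of_pow_eq_one hpow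
  rw [hq, hm] at hdvd
  exact Nat.dvd_of_mul_dvd_mul_right (Nat.pos_of_mul_pos_left (hm ▸ hN1)) hdvd

/-- There is a prime that is a primitive root modulo `N` and `-1` modulo `p`. -/
theorem Nat.exists_prime_gt_and_orderOf_eq {N p : ℕ} [Fact N.Prime] (hp : p.Prime) (hNp : N ≠ p)
    (n : ℕ) :
    ∃ q > n, q.Prime ∧ orderOf (q : ZMod N) = N - 1 ∧ q ≡ p - 1 [MOD p] := by
  have hN : N.Prime := Fact.out
  obtain ⟨g, hg⟩ := IsCyclic.exists_generator (α := (ZMod N)ˣ)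
  have hcop : N.Coprime p := (Nat.coprime_primes hN hp).mpr hNp
  obtain ⟨a, ha₁, ha₂⟩ := Nat.chineseRemainder hcop (g : ZMod N).val (p - 1)
  have haN : a.Coprime N := by
    rw [Nat.Coprime, ha₁.gcd_eq]
    exact ZMod.val_coe_unit_coprime g
  have hap : a.Coprime p := by
    rw [Nat.Coprime, ha₂.gcd_eq]
    exact (Nat.coprime_self_sub_left hp.one_le).mpr (Nat.coprime_one_left p)
  obtain ⟨q, hqn, hq, hqa⟩ := Nat.forall_exists_prime_gt_and_modEq n
    (Nat.mul_ne_zero hN.ne_zero hp.ne_zero) (haN.mul_right hap)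
  refine ⟨q, hqn, hq, ?_, (hqa.of_mul_left N).trans ha₂⟩
  have h := (ZMod.natCast_eq_natCast_iff _ _ _).mpr ((hqa.of_mul_right p).trans ha₁)
  rw [h, ZMod.natCast_val, ZMod.cast_id, orderOf_units, orderOf_eq_card_of_forall_mem_zpowers hg,
    Nat.card_eq_fintype_card, ZMod.card_units]

/-- If `q ∤ N` and `p` is coprime to `q (q - 1)`, then some `c ^ p - N` is divisible by `q` exactly
once. -/
theorem Nat.exists_dvd_pow_sub_and_not_sq_dvd {N p q : ℕ} (hq : q.Prime) (hqN : q.Coprime N)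
    (hp : (q * (q - 1)).Coprime p) :
    ∃ c : ℤ, (q : ℤ) ∣ c ^ p - N ∧ ¬ (q : ℤ) ^ 2 ∣ c ^ p - N := by
  have hu : (N + q).Coprime (q ^ 2) := by
    apply Nat.Coprime.pow_right
    simpa using hqN.symm
  have : NeZero (q ^ 2) := ⟨pow_ne_zero _ hq.ne_zero⟩
  have hcard : (Nat.card (ZMod (q ^ 2))ˣ).Coprime p := by
    rw [Nat.card_eq_fintype_card, ZMod.card_units_eq_totient, Nat.totient_prime_pow hq two_pos]
    simpa using hp
  obtain ⟨u, hu'⟩ := (powCoprime hcard).surjective (ZMod.unitOfCoprime (N + q) hu)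
  obtain ⟨c, hc⟩ := ZMod.intCast_surjective (u : ZMod (q ^ 2))
  have h : ((c ^ p - N - q : ℤ) : ZMod (q ^ 2)) = 0 := by
    have h' := congrArg (Units.val) hu'
    simp only [powCoprime_apply, Units.val_pow_eq_pow_val, ZMod.coe_unitOfCoprime, ← hc] at h'
    push_cast at h' ⊢
    rw [h']
    ring
  rw [ZMod.intCast_zmod_eq_zero_iff_dvd] at h
  push_cast at h
  refine ⟨c, ?_, fun h2 ↦ ?_⟩
  · have := (Dvd.intro_left _ (by ring : (q : ℤ) * q = q ^ 2)).trans h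
    simpa using this
  · have h3 := _root_.dvd_sub h2 h
    rw [sub_sub_cancel] at h3
    have h4 := Nat.le_of_dvd hq.pos (by exact_mod_cast h3 : q ^ 2 ∣ q)
    nlinarith [hq.two_le]

theorem minpoly_eq_X_pow_sub_C_of_pow_eq_prime {K : Type*} [Field K] [Algebra ℚ K] {N p : ℕ}
    (hN : N.Prime) (hp : p.Prime) {α : K} (hroot : α ^ p = (N : K)) :
    minpoly ℚ α = X ^ p - C (N : ℚ) := by
  refine (minpoly.eq_of_irreducible_of_monic (X_pow_sub_C_irreducible_of_prime hp fun b hb ↦ ?_)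
    (by simp [hroot]) (monic_X_pow_sub_C _ hp.ne_zero)).symm
  have : Fact N.Prime := ⟨hN⟩
  have h := congrArg (padicValRat N) hb
  rw [padicValRat.pow, padicValRat.self hN.one_lt] at h
  exact hp.one_lt.ne' (by exact_mod_cast Int.eq_one_of_mul_eq_one_right (by positivity) h)

/-- If `N` and `p` are primes with `p ≥ 5` and `N ≡ 1 (mod p)`, then `p` divides the
class number of `ℚ(N^{1/p})`, the number field obtained by adjoining to `ℚ` a root of
`x^p - N`. -/
theorem class_number_dvd_of_one_mod_p
    (N p : ℕ) (hN : N.Prime) (hp : p.Prime) (hp5 : 5 ≤ p)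
    (hcong : (N : ZMod p) = 1)
    (K : Type*) [Field K] [NumberField K] (α : K)
    (hroot : α ^ p = (N : K)) (hgen : Algebra.adjoin ℚ {α} = ⊤) :
    p ∣ NumberField.classNumber K := by
  have : Fact N.Prime := ⟨hN⟩
  have hmin := minpoly_eq_X_pow_sub_C_of_pow_eq_prime hN hp hroot
  let pb := PowerBasis.ofAdjoinEqTop (Algebra.IsIntegral.isIntegral (R := ℚ) α) hgen
  have hpb : pb.gen = α := PowerBasis.ofAdjoinEqTop_gen _ _
  have hrank : Module.finrank ℤ (𝓞 K) = p := by
    rw [RingOfIntegers.rank, pb.finrank, ← pb.natDegree_minpoly, hpb, hmin, natDegree_X_pow_sub_C]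
  obtain ⟨a, haα⟩ : ∃ a : 𝓞 K, (a : K) = α :=
    ⟨⟨α, IsIntegral.of_pow hp.pos (hroot ▸ isIntegral_natCast N)⟩, rfl⟩
  have ha : a ^ p = N := RingOfIntegers.ext (by simpa [haα] using hroot)
  have hnorm (c : ℤ) : Algebra.norm ℤ ((c : 𝓞 K) - a) = c ^ p - N := by
    have h : Algebra.norm ℚ (algebraMap ℚ K c - α) = c ^ p - N := by
      have h' := congrArg (eval (c : ℚ)) (charpoly_leftMulMatrix pb)
      rw [Matrix.eval_charpoly, hpb, hmin] at h'
      rw [Algebra.norm_eq_matrix_det pb.basis, map_sub, AlgHom.commutes]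
      simpa using h'
    have h₂ := Algebra.coe_norm_int ((c : 𝓞 K) - a)
    rw [show (((c : 𝓞 K) - a : 𝓞 K) : K) = algebraMap ℚ K c - α by simp [haα], h] at h₂
    exact_mod_cast h₂
  have hodd : Odd p := hp.odd_of_ne_two (by omega)
  have habs : (Ideal.span {a}).absNorm = N := by
    have h := hnorm 0
    rw [Int.cast_zero, zero_sub, zero_pow hp.ne_zero, zero_sub] at h
    rw [← Ideal.span_singleton_neg, Ideal.absNorm_span_singleton, h, Int.natAbs_neg,
      Int.natAbs_natCast]
  have hpN : p ∣ N - 1 := by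
    rw [← Nat.cast_one, ZMod.natCast_eq_natCast_iff] at hcong
    exact (Nat.modEq_iff_dvd' hN.one_le).mp hcong.symm
  have hltN : p < N := by
    have := Nat.le_of_dvd (by have := hN.two_le; omega) hpN
    omega
  obtain ⟨q, hqn, hq, hord, hqp⟩ := Nat.exists_prime_gt_and_orderOf_eq hp hltN.ne' N
  have hcop : (q * (q - 1)).Coprime p := by
    refine Nat.Coprime.mul_left ((Nat.coprime_primes hq hp).mpr (by omega)) ?_
    refine ((hp.coprime_iff_not_dvd).mpr fun h ↦ ?_).symm
    have h₁ := (Nat.modEq_iff_dvd' hq.one_le).mpr h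
    have h₂ : 1 % p = (p - 1) % p := h₁.trans hqp
    rw [Nat.mod_eq_of_lt (by omega), Nat.mod_eq_of_lt (by omega)] at h₂
    omega
  obtain ⟨c, hc₁, hc₂⟩ := Nat.exists_dvd_pow_sub_and_not_sq_dvd hq
    ((Nat.coprime_primes hq hN).mpr hqn.ne') hcop
  rw [← hnorm] at hc₁ hc₂
  have hdvd : (N : 𝓞 K) ∣ a ^ N := ha ▸ pow_dvd_pow a hltN.le
  refine dvd_classNumber_of_absNorm hodd hpN (fun x ↦ ?_) hord
    (Ideal.absNorm_span_pair_eq_prime hq hc₁ hc₂)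
  rw [← hrank]
  exact Algebra.exists_intCast_norm_eq_pow habs hdvd x
end
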